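/- Let n ≥ 2, p > 1, and let Ω ⊂ ℝⁿ be a bounded open convex set with boundary of class C². Let u ∈ C¹(cl Ω) be a positive first eigenfunction of the Gaussian-weighted p-Laplace operator, i.e. u > 0 in Ω, u = 0 on ∂Ω, and for every φ ∈ C_c^∞(Ω) one has ∫_Ω ‖∇u‖^{p-2} ⟨∇u, ∇φ⟩ dγ = λ_{p,γ}(Ω) ∫_Ω u^{p-1} φ dγ. Then the function w = −log u is convex on Ω. -/

import Mathlib

open MeasureTheory Real Set Metric Bornology
open scoped RealInnerProductSpace Pointwise NNReal Topology

noncomputable def gaussianMeasure (n : ℕ) : Measure (EuclideanSpace ℝ (Fin n)) :=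
  (volume : Measure (EuclideanSpace ℝ (Fin n))).withDensity
    (fun x => ENNReal.ofReal ((2 * π) ^ (-(n : ℝ) / 2) * Real.exp (-‖x‖ ^ 2 / 2)))

/-- `φ` is a smooth compactly supported test function on `Ω`. -/
def IsTestFun (n : ℕ) (Ω : Set (EuclideanSpace ℝ (Fin n)))
    (φ : EuclideanSpace ℝ (Fin n) → ℝ) : Prop :=
  ContDiff ℝ (⊤ : ℕ∞) φ ∧ HasCompactSupport φ ∧ tsupport φ ⊆ Ω

/-- The first eigenvalue of the Gaussian-weighted `p`-Laplacian on `Ω`. -/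
noncomputable def lambdaPGamma (n : ℕ) (p : ℝ) (Ω : Set (EuclideanSpace ℝ (Fin n))) : ℝ :=
  sInf { r : ℝ | ∃ v : EuclideanSpace ℝ (Fin n) → ℝ, IsTestFun n Ω v ∧ v ≠ 0 ∧
    r = (∫ x in Ω, ‖gradient v x‖ ^ p ∂(gaussianMeasure n)) /
        (∫ x in Ω, |v x| ^ p ∂(gaussianMeasure n)) }

/-- `Ω` has boundary of class `C²`. -/
def HasC2Boundary (n : ℕ) (Ω : Set (EuclideanSpace ℝ (Fin n))) : Prop :=
  ∀ x ∈ frontier Ω, ∃ (U : Set (EuclideanSpace ℝ (Fin n))) (f : EuclideanSpace ℝ (Fin n) → ℝ),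
    IsOpen U ∧ x ∈ U ∧ ContDiff ℝ 2 f ∧ (∀ y ∈ U, (y ∈ Ω ↔ f y < 0)) ∧
    (∀ y ∈ U, y ∈ frontier Ω → fderiv ℝ f y ≠ 0)

set_option linter.all false

section aFsec
variable {E : Type*} [NormedAddCommGroup E] [InnerProductSpace ℝ E]

noncomputable def aF (p : ℝ) (P : E) : E := ‖P‖ ^ (p - 2) • P

theorem aF_zero (p : ℝ) : aF p (0 : E) = 0 := by simp [aF]

theorem norm_aF {p : ℝ} (hp : 1 < p) (P : E) : ‖aF p P‖ = ‖P‖ ^ (p - 1) := by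
  by_cases h : P = 0
  · subst h; simp [aF, Real.zero_rpow (by linarith : p - 1 ≠ 0)]
  · have h' : 0 < ‖P‖ := norm_pos_iff.2 h
    rw [aF, norm_smul, Real.norm_of_nonneg (by positivity)]
    nth_rewrite 2 [← Real.rpow_one ‖P‖]
    rw [← Real.rpow_add h']; congr 1; ring

theorem inner_aF_self {p : ℝ} (hp : 1 < p) (P : E) : ⟪aF p P, P⟫ = ‖P‖ ^ p := by
  by_cases h : P = 0
  · subst h; simp [aF, Real.zero_rpow (by linarith : p ≠ 0)]
  · have h' : 0 < ‖P‖ := norm_pos_iff.2 h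
    rw [aF, real_inner_smul_left, real_inner_self_eq_norm_sq, ← Real.rpow_natCast,
      ← Real.rpow_add h']; congr 1; push_cast; ring

theorem aF_smul {p : ℝ} (hp : 1 < p) {c : ℝ} (hc : 0 ≤ c) (P : E) :
    aF p (c • P) = c ^ (p - 1) • aF p P := by
  rcases hc.eq_or_lt with rfl | hc
  · simp [aF_zero, Real.zero_rpow (by linarith : p - 1 ≠ 0)]
  · rw [aF, aF, norm_smul, Real.norm_of_nonneg hc.le, Real.mul_rpow hc.le (norm_nonneg _),
      smul_smul, smul_smul]
    congr 1
    have : c ^ (p - 1) = c ^ (p - 2) * c := by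
      nth_rewrite 3 [← Real.rpow_one c]
      rw [← Real.rpow_add hc]; congr 1; ring
    rw [this]; ring

theorem continuous_aF {p : ℝ} (hp : 1 < p) : Continuous (aF p : E → E) := by
  rw [continuous_iff_continuousAt]
  intro P
  by_cases h : P = 0
  · subst h
    rw [ContinuousAt, aF_zero, tendsto_zero_iff_norm_tendsto_zero]
    simp_rw [norm_aF hp]
    have : ContinuousAt (fun x : E => ‖x‖ ^ (p - 1)) 0 :=
      continuous_norm.continuousAt.rpow_const (Or.inr (by linarith))
    simpa [ContinuousAt, Real.zero_rpow (by linarith : p - 1 ≠ 0)] using this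
  · exact (continuous_norm.continuousAt.rpow_const (Or.inl (norm_ne_zero_iff.2 h))).smul
      continuousAt_id

theorem contDiffAt_aF {p : ℝ} {q : E} (hq : q ≠ 0) : ContDiffAt ℝ 1 (aF p : E → E) q := by
  unfold aF
  exact ((contDiffAt_norm ℝ hq).rpow_const_of_ne (norm_ne_zero_iff.2 hq)).smul contDiffAt_id

theorem hasFDerivAt_aF {p : ℝ} {q : E} (hq : q ≠ 0) :
    HasFDerivAt (aF p : E → E) (‖q‖ ^ (p - 2) • ContinuousLinearMap.id ℝ E +
      (((p - 2) * ‖q‖ ^ (p - 4)) • innerSL ℝ q).smulRight q) q := by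
  have h' : 0 < ‖q‖ := norm_pos_iff.2 hq
  have h1 : HasFDerivAt (fun x : E => ‖x‖ ^ 2) (2 • innerSL ℝ q) q := by
    exact (hasStrictFDerivAt_norm_sq q).hasFDerivAt
  have h2 : HasFDerivAt (fun x : E => (‖x‖ ^ 2) ^ ((p - 2) / 2))
      (((p - 2) * ‖q‖ ^ (p - 4)) • innerSL ℝ q) q := by
    have := h1.rpow_const (p := (p - 2) / 2) (Or.inl (by positivity))
    convert this using 1
    rw [← Real.rpow_natCast, ← Real.rpow_mul h'.le]
    ext v
    simp
    rw [show 2 * ((p - 2) / 2 - 1) = p - 4 by ring]; ring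
  have h3 := h2.smul (hasFDerivAt_id q)
  have e : ∀ x : E, (‖x‖ ^ 2) ^ ((p - 2) / 2) = ‖x‖ ^ (p - 2) := by
    intro x
    rw [← Real.rpow_natCast, ← Real.rpow_mul (norm_nonneg _)]; congr 1; push_cast; ring
  simp only [e, id] at h3
  convert h3 using 1
  rfl

/-- Bregman divergence. -/
noncomputable def bregD (p : ℝ) (Q P : E) : ℝ := ‖Q‖ ^ p + (p - 1) * ‖P‖ ^ p - p * ⟪aF p P, Q⟫

theorem young_aux {p : ℝ} (hp : 1 < p) {a b : ℝ} (ha : 0 ≤ a) (hb : 0 ≤ b) :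
    p * (b ^ (p - 1) * a) ≤ a ^ p + (p - 1) * b ^ p := by
  have hpq : p.HolderConjugate (p / (p - 1)) := Real.HolderConjugate.conjExponent hp
  have := Real.young_inequality_of_nonneg ha (Real.rpow_nonneg hb (p - 1)) hpq
  rw [← Real.rpow_mul hb] at this
  have h1 : (p - 1) * (p / (p - 1)) = p := by field_simp [(by linarith : p - 1 ≠ 0)]
  rw [h1] at this
  have h0 : 0 < p := by linarith
  have h2 : 0 < p - 1 := by linarith
  have := mul_le_mul_of_nonneg_left this h0.le
  calc p * (b ^ (p - 1) * a) = p * (a * b ^ (p - 1)) := by ring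
    _ ≤ _ := this
    _ = _ := by field_simp

theorem bregD_nonneg {p : ℝ} (hp : 1 < p) (Q P : E) : 0 ≤ bregD p Q P := by
  have h1 : ⟪aF p P, Q⟫ ≤ ‖P‖ ^ (p - 1) * ‖Q‖ := by
    rw [← norm_aF hp]; exact real_inner_le_norm _ _
  have := young_aux hp (norm_nonneg Q) (norm_nonneg P)
  unfold bregD
  nlinarith [mul_le_mul_of_nonneg_left h1 (by linarith : (0:ℝ) ≤ p)]

theorem bregD_eq_zero {p : ℝ} (hp : 1 < p) {Q P : E} (h : bregD p Q P ≤ 0) : Q = P := by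
  by_cases hP : P = 0
  · subst hP
    simp only [bregD, aF_zero, norm_zero, inner_zero_left,
      Real.zero_rpow (by linarith : p ≠ 0)] at h
    by_contra hQ
    have : 0 < ‖Q‖ ^ p := Real.rpow_pos_of_pos (norm_pos_iff.2 hQ) _
    linarith
  have hb : 0 < ‖P‖ := norm_pos_iff.2 hP
  have h1 : ⟪aF p P, Q⟫ ≤ ‖P‖ ^ (p - 1) * ‖Q‖ := by
    rw [← norm_aF hp]; exact real_inner_le_norm _ _
  have hp0 : 0 < p := by linarith
  have key : ‖Q‖ = ‖P‖ := by
    by_contra hne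
    have h2 := one_add_mul_self_lt_rpow_one_add (s := ‖Q‖ / ‖P‖ - 1)
      (by have : 0 ≤ ‖Q‖ / ‖P‖ := by positivity
          linarith) (by
        intro h0; apply hne
        have : ‖Q‖ / ‖P‖ = 1 := by linarith
        exact (div_eq_one_iff_eq hb.ne').1 this) hp
    rw [add_sub_cancel, Real.div_rpow (norm_nonneg _) hb.le] at h2
    have hbp : 0 < ‖P‖ ^ p := Real.rpow_pos_of_pos hb _
    rw [lt_div_iff₀ hbp] at h2
    have h3 : ‖P‖ ^ p = ‖P‖ ^ (p - 1) * ‖P‖ := by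
      nth_rewrite 3 [← Real.rpow_one ‖P‖]
      rw [← Real.rpow_add hb]; congr 1; ring
    have h4 : (1 + p * (‖Q‖ / ‖P‖ - 1)) * ‖P‖ ^ p
        = ‖P‖ ^ p + p * (‖P‖ ^ (p - 1) * ‖Q‖) - p * ‖P‖ ^ p := by
      rw [h3]; field_simp
      ring
    rw [h4] at h2
    have := mul_le_mul_of_nonneg_left h1 hp0.le
    unfold bregD at h
    nlinarith
  have hbp : 0 < ‖P‖ ^ (p - 2) := Real.rpow_pos_of_pos hb _
  have h5 : ‖P‖ ^ p = ‖P‖ ^ (p - 2) * ‖P‖ ^ 2 := by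
    rw [← Real.rpow_natCast, ← Real.rpow_add hb]; congr 1; push_cast; ring
  unfold bregD at h
  rw [key, aF, real_inner_smul_left, h5] at h
  have h6 : ‖P‖ ^ 2 ≤ ⟪P, Q⟫ := by
    have : 0 ≤ p * ‖P‖ ^ (p - 2) * (⟪P, Q⟫ - ‖P‖ ^ 2) := by nlinarith
    have h7 := nonneg_of_mul_nonneg_right this (by positivity)
    linarith
  have h8 : ‖Q - P‖ ^ 2 ≤ 0 := by
    rw [norm_sub_sq_real, key, real_inner_comm]; linarith
  have : ‖Q - P‖ = 0 := by
    have := sq_nonneg ‖Q - P‖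
    exact pow_eq_zero_iff (two_ne_zero) |>.1 (le_antisymm h8 this)
  exact sub_eq_zero.1 (norm_eq_zero.1 this)

theorem bregD_conv [FiniteDimensional ℝ E] {p : ℝ} (hp : 1 < p) (P : E) {Q : ℕ → E}
    (h : Filter.Tendsto (fun k => bregD p (Q k) P) Filter.atTop (𝓝 0)) :
    Filter.Tendsto Q Filter.atTop (𝓝 P) := by
  have hp0 : 0 < p := by linarith
  rw [Metric.tendsto_atTop]
  intro ε hε
  set f : E → ℝ := fun Q => bregD p Q P with hf
  have hfc : Continuous f := by
    have : Continuous (fun Q : E => ‖Q‖ ^ p) :=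
      continuous_norm.rpow_const (fun _ => Or.inr hp0.le)
    simp only [hf, bregD]
    fun_prop
  -- coercive
  have hco : Filter.Tendsto f (Filter.cocompact E) Filter.atTop := by
    have h1 : Filter.Tendsto (fun x : ℝ => x * (x ^ (p - 1) - p * ‖P‖ ^ (p - 1)))
        Filter.atTop Filter.atTop :=
      Filter.tendsto_id.atTop_mul_atTop₀ (Filter.tendsto_atTop_add_const_right _ _
        (tendsto_rpow_atTop (by linarith)))
    have h2 := h1.comp (tendsto_norm_cocompact_atTop (E := E))
    refine Filter.tendsto_atTop_mono (fun x => ?_) h2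
    have h3 : ⟪aF p P, x⟫ ≤ ‖P‖ ^ (p - 1) * ‖x‖ := by
      rw [← norm_aF hp]; exact real_inner_le_norm _ _
    have h4 : 0 ≤ (p - 1) * ‖P‖ ^ p := by
      have : 0 ≤ p - 1 := by linarith
      positivity
    have h5 : ‖x‖ ^ p = ‖x‖ * ‖x‖ ^ (p - 1) := by
      rcases (norm_nonneg x).eq_or_lt with h0 | h0
      · rw [← h0]; simp [Real.zero_rpow hp0.ne']
      · nth_rewrite 2 [← Real.rpow_one ‖x‖]
        rw [← Real.rpow_add h0]; congr 1; ring
    have := mul_le_mul_of_nonneg_left h3 hp0.le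
    simp only [hf, bregD, Function.comp, h5]
    nlinarith
  rcases ({x : E | ε ≤ dist x P}).eq_empty_or_nonempty with he | ⟨x1, hx1⟩
  · exact ⟨0, fun k _ => by
      by_contra hk
      have : Q k ∈ ({x : E | ε ≤ dist x P}) := not_lt.1 hk
      rw [he] at this; exact this⟩
  · have hcl : IsClosed {x : E | ε ≤ dist x P} :=
      isClosed_le continuous_const (continuous_id.dist continuous_const)
    obtain ⟨y, hy, hmin⟩ := hfc.continuousOn.exists_isMinOn' hcl hx1
      ((hco.eventually_ge_atTop (f x1)).filter_mono inf_le_left)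
    have hpos : 0 < f y := by
      by_contra hle
      have := bregD_eq_zero hp (not_lt.1 hle)
      subst this
      simp only [mem_ofPred_eq, dist_self] at hy
      linarith
    obtain ⟨N, hN⟩ := (Filter.eventually_atTop.1 (h.eventually_lt_const hpos))
    refine ⟨N, fun k hk => ?_⟩
    by_contra hk'
    exact absurd (hN k hk) (not_lt.2 (hmin (not_lt.1 hk')))

end aFsec


section mollify
variable {E : Type*} [NormedAddCommGroup E] [InnerProductSpace ℝ E] [FiniteDimensional ℝ E]
  [MeasurableSpace E] [BorelSpace E]

open scoped Convolution in
theorem mollify_C1 {φ : E → ℝ} (hφ : ContDiff ℝ 1 φ) (hc : HasCompactSupport φ) {r ε : ℝ}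
    (hr : 0 < r) (hε : 0 < ε) : ∃ ψ : E → ℝ, ContDiff ℝ (⊤ : ℕ∞) ψ ∧ HasCompactSupport ψ ∧
      tsupport ψ ⊆ cthickening r (tsupport φ) ∧ (∀ x, |ψ x - φ x| ≤ ε) ∧
      (∀ x, ‖fderiv ℝ ψ x - fderiv ℝ φ x‖ ≤ ε) := by
  have hφ'c : Continuous (fderiv ℝ φ) := hφ.continuous_fderiv (by norm_num)
  have u1 : UniformContinuous φ := hφ.continuous.uniformContinuous_of_tendsto_cocompact
    hc.is_zero_at_infty
  have u2 : UniformContinuous (fderiv ℝ φ) := hφ'c.uniformContinuous_of_tendsto_cocompact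
    (hc.fderiv ℝ).is_zero_at_infty
  obtain ⟨d1, hd1, h1⟩ := Metric.uniformContinuous_iff.1 u1 ε hε
  obtain ⟨d2, hd2, h2⟩ := Metric.uniformContinuous_iff.1 u2 ε hε
  set d := min r (min d1 d2) with hd
  have hd0 : 0 < d := by positivity
  let b : ContDiffBump (0 : E) := ⟨d / 2, d, by positivity, by linarith⟩
  have hb : b.rOut = d := rfl
  set ψ : E → ℝ := b.normed volume ⋆[ContinuousLinearMap.lsmul ℝ ℝ, volume] φ with hψ
  have hbi : LocallyIntegrable (b.normed volume) (volume : Measure E) :=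
    b.continuous_normed.locallyIntegrable
  have hsupp : tsupport ψ ⊆ cthickening r (tsupport φ) := by
    refine closure_minimal ?_ isClosed_cthickening
    refine (support_convolution_subset _).trans ?_
    rintro x ⟨y, hy, z, hz, rfl⟩
    rw [b.support_normed_eq] at hy
    refine mem_cthickening_of_dist_le _ z _ _ (subset_tsupport _ hz) ?_
    simp only [mem_ball, dist_zero_right] at hy
    rw [dist_eq_norm, add_sub_cancel_right]
    exact hy.le.trans (min_le_left _ _)
  refine ⟨ψ, ?_, ?_, hsupp, ?_, ?_⟩
  · exact b.hasCompactSupport_normed.contDiff_convolution_left _ b.contDiff_normed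
      hφ.continuous.locallyIntegrable
  · exact hc.isCompact.cthickening.of_isClosed_subset (isClosed_tsupport _) hsupp
  · intro x
    rw [← Real.dist_eq]
    refine b.dist_normed_convolution_le hφ.continuous.aestronglyMeasurable fun y hy => ?_
    refine (h1 ?_).le
    exact lt_of_lt_of_le hy ((min_le_right _ _).trans (min_le_left _ _))
  · intro x
    have := hc.hasFDerivAt_convolution_right (ContinuousLinearMap.lsmul ℝ ℝ) hbi hφ x
    rw [this.fderiv]
    have e : ((b.normed volume ⋆[(ContinuousLinearMap.lsmul ℝ ℝ).precompR E, volume]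
        fderiv ℝ φ) x : E →L[ℝ] ℝ) = (b.normed volume ⋆[ContinuousLinearMap.lsmul ℝ ℝ, volume]
        fderiv ℝ φ) x := by
      simp only [convolution_def]
      congr 1
    rw [e, ← dist_eq_norm]
    refine b.dist_normed_convolution_le hφ'c.aestronglyMeasurable fun y hy => ?_
    refine (h2 ?_).le
    exact lt_of_lt_of_le hy ((min_le_right _ _).trans (min_le_right _ _))

theorem weak_C1 {Ω : Set E} (hΩ : IsOpen Ω) {A : E → E} {H : E → ℝ} (hA : ContinuousOn A Ω)
    (hH : ContinuousOn H Ω)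
    (h : ∀ φ : E → ℝ, ContDiff ℝ (⊤ : ℕ∞) φ → HasCompactSupport φ → tsupport φ ⊆ Ω →
      ∫ x in Ω, fderiv ℝ φ x (A x) = ∫ x in Ω, H x * φ x)
    (φ : E → ℝ) (hφ : ContDiff ℝ 1 φ) (hc : HasCompactSupport φ) (hs : tsupport φ ⊆ Ω) :
    ∫ x in Ω, fderiv ℝ φ x (A x) = ∫ x in Ω, H x * φ x := by
  obtain ⟨r, hr, hrs⟩ := hc.isCompact.exists_cthickening_subset_open hΩ hs
  set K := cthickening r (tsupport φ) with hK
  have hKc : IsCompact K := hc.isCompact.cthickening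
  have hKm : MeasurableSet K := hKc.measurableSet
  have hfin : volume K < ⊤ := hKc.measure_lt_top
  have red : ∀ ψ : E → ℝ, tsupport ψ ⊆ K → ContDiff ℝ 1 ψ →
      (∫ x in Ω, fderiv ℝ ψ x (A x) = ∫ x in K, fderiv ℝ ψ x (A x)) ∧
      (∫ x in Ω, H x * ψ x = ∫ x in K, H x * ψ x) ∧
      IntegrableOn (fun x => fderiv ℝ ψ x (A x)) K ∧ IntegrableOn (fun x => H x * ψ x) K := by
    intro ψ hψ hψ1
    refine ⟨?_, ?_, ?_, ?_⟩
    · refine (setIntegral_eq_of_subset_of_forall_sdiff_eq_zero hΩ.measurableSet hrs ?_)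
      intro x hx
      have : fderiv ℝ ψ x = 0 := image_eq_zero_of_notMem_tsupport
        (fun hx' => hx.2 (hψ (tsupport_fderiv_subset ℝ hx')))
      simp [this]
    · refine (setIntegral_eq_of_subset_of_forall_sdiff_eq_zero hΩ.measurableSet hrs ?_)
      intro x hx
      have : ψ x = 0 := image_eq_zero_of_notMem_tsupport (fun hx' => hx.2 (hψ hx'))
      simp [this]
    · exact (((hψ1.continuous_fderiv (by norm_num)).continuousOn).clm_apply
        (hA.mono hrs)).integrableOn_compact hKc
    · exact ((hH.mono hrs).mul hψ1.continuous.continuousOn).integrableOn_compact hKc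
  obtain ⟨CA, hCA⟩ := hKc.exists_bound_of_continuousOn (hA.mono hrs)
  obtain ⟨CH, hCH⟩ := hKc.exists_bound_of_continuousOn (hH.mono hrs)
  have hφK : tsupport φ ⊆ K := self_subset_cthickening _
  obtain ⟨e1, e2, i1, i2⟩ := red φ hφK hφ
  rw [e1, e2]
  have key : ∀ ε > 0, |(∫ x in K, fderiv ℝ φ x (A x)) - ∫ x in K, H x * φ x| ≤
      ε * ((|CA| + |CH|) * volume.real K) := by
    intro ε hε
    obtain ⟨ψ, p1, p2, p3, p4, p5⟩ := mollify_C1 hφ hc hr hε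
    obtain ⟨e1', e2', i1', i2'⟩ := red ψ p3 (p1.of_le (by exact_mod_cast le_top))
    have h0 := h ψ p1 p2 (p3.trans hrs)
    rw [e1', e2'] at h0
    have a1 : ‖∫ x in K, (fderiv ℝ φ x (A x) - fderiv ℝ ψ x (A x))‖ ≤ ε * |CA| * volume.real K := by
      refine norm_setIntegral_le_of_norm_le_const hfin fun x hx => ?_
      rw [← sub_apply]
      refine (ContinuousLinearMap.le_opNorm _ _).trans ?_
      have := p5 x
      rw [norm_sub_rev] at this
      exact mul_le_mul this ((hCA x hx).trans (le_abs_self _)) (norm_nonneg _) hε.le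
    have a2 : ‖∫ x in K, (H x * φ x - H x * ψ x)‖ ≤ ε * |CH| * volume.real K := by
      refine norm_setIntegral_le_of_norm_le_const hfin fun x hx => ?_
      rw [← mul_sub, norm_mul, mul_comm]
      have := p4 x
      rw [abs_sub_comm] at this
      exact mul_le_mul this ((hCH x hx).trans (le_abs_self _)) (norm_nonneg _) hε.le
    rw [integral_sub i1 i1', Real.norm_eq_abs] at a1
    rw [integral_sub i2 i2', Real.norm_eq_abs] at a2
    rw [abs_le] at *
    constructor <;> nlinarith
  have : |(∫ x in K, fderiv ℝ φ x (A x)) - ∫ x in K, H x * φ x| ≤ 0 := by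
    refine le_of_forall_pos_le_add fun ε hε => ?_
    set M := (|CA| + |CH|) * volume.real K with hM
    have hM0 : 0 ≤ M := by positivity
    refine (key (ε / (M + 1)) (by positivity)).trans ?_
    rw [zero_add, div_mul_eq_mul_div, div_le_iff₀ (by positivity)]
    nlinarith
  exact sub_eq_zero.1 (abs_nonpos_iff.1 this)

end mollify


section divg
variable {E : Type*} [NormedAddCommGroup E] [InnerProductSpace ℝ E] [FiniteDimensional ℝ E]

noncomputable def trc (L : E →L[ℝ] E) : ℝ := LinearMap.trace ℝ E (L : E →ₗ[ℝ] E)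

theorem trc_eq_sum {ι : Type*} [Fintype ι] (b : OrthonormalBasis ι ℝ E) (L : E →L[ℝ] E) :
    trc L = ∑ k, ⟪b k, L (b k)⟫ := by
  rw [trc, LinearMap.trace_eq_sum_inner _ b]; rfl

theorem trc_add (L M : E →L[ℝ] E) : trc (L + M) = trc L + trc M := by
  simp [trc]

theorem trc_smul (c : ℝ) (L : E →L[ℝ] E) : trc (c • L) = c * trc L := by
  simp [trc]

theorem continuous_trc : Continuous (trc : (E →L[ℝ] E) → ℝ) := by
  have : (trc : (E →L[ℝ] E) → ℝ) = fun L => ∑ k, ⟪stdOrthonormalBasis ℝ E k,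
      L (stdOrthonormalBasis ℝ E k)⟫ := by
    ext L; exact trc_eq_sum _ _
  rw [this]
  fun_prop

theorem trc_sum {ι : Type*} (s : Finset ι) (f : ι → E →L[ℝ] E) :
    trc (∑ i ∈ s, f i) = ∑ i ∈ s, trc (f i) := by
  classical
  induction s using Finset.induction_on with
  | empty => simp [trc]
  | insert a s ha ih => rw [Finset.sum_insert ha, Finset.sum_insert ha, trc_add, ih]

variable [MeasurableSpace E] [BorelSpace E]

theorem div_ibp {A : E → E} (hA : ContDiff ℝ 1 A) {φ : E → ℝ} (hφ : ContDiff ℝ 1 φ)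
    (hc : HasCompactSupport φ) :
    ∫ x, fderiv ℝ φ x (A x) = - ∫ x, trc (fderiv ℝ A x) * φ x := by
  set b := stdOrthonormalBasis ℝ E
  have hφ' : Continuous (fderiv ℝ φ) := hφ.continuous_fderiv (by norm_num)
  have hA' : Continuous (fderiv ℝ A) := hA.continuous_fderiv (by norm_num)
  have hc' : HasCompactSupport (fderiv ℝ φ) := hc.fderiv ℝ
  have e1 : ∀ x, fderiv ℝ φ x (A x) = ∑ k, ⟪b k, A x⟫ * fderiv ℝ φ x (b k) := by
    intro x
    conv_lhs => rw [← b.sum_repr' (A x)]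
    simp [map_sum]
  have e2 : ∀ x, trc (fderiv ℝ A x) * φ x = ∑ k, ⟪b k, fderiv ℝ A x (b k)⟫ * φ x := by
    intro x; rw [trc_eq_sum b, Finset.sum_mul]
  have c2 : ∀ k, HasCompactSupport fun x => fderiv ℝ φ x (b k) := fun k =>
    hc'.comp_left (g := fun L : E →L[ℝ] ℝ => L (b k)) (by simp)
  have i1 : ∀ k, Integrable (fun x => ⟪b k, A x⟫ * fderiv ℝ φ x (b k)) := fun k => by
    refine Continuous.integrable_of_hasCompactSupport ?_ (HasCompactSupport.mul_left (c2 k))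
    have := hA.continuous
    fun_prop
  have i2 : ∀ k, Integrable (fun x => ⟪b k, fderiv ℝ A x (b k)⟫ * φ x) := fun k => by
    refine Continuous.integrable_of_hasCompactSupport ?_ (HasCompactSupport.mul_left hc)
    have := hφ.continuous
    fun_prop
  simp_rw [e1, e2]
  rw [integral_finsetSum _ (fun k _ => i1 k), integral_finsetSum _ (fun k _ => i2 k),
    ← Finset.sum_neg_distrib]
  refine Finset.sum_congr rfl fun k _ => ?_
  have hd : ∀ x, HasFDerivAt (fun x => ⟪b k, A x⟫) ((innerSL ℝ (b k)).comp (fderiv ℝ A x)) x := by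
    intro x
    exact (innerSL ℝ (b k)).hasFDerivAt.comp x ((hA.differentiable (by norm_num)) x).hasFDerivAt
  have hdd : ∀ x v, fderiv ℝ (fun x => ⟪b k, A x⟫) x v = ⟪b k, fderiv ℝ A x v⟫ := by
    intro x v; rw [(hd x).fderiv]; rfl
  have := integral_mul_fderiv_eq_neg_fderiv_mul_of_integrable (μ := (volume : Measure E))
    (f := fun x => ⟪b k, A x⟫) (g := φ) (v := b k) (by simpa [hdd] using i2 k) (i1 k)
    (by refine Continuous.integrable_of_hasCompactSupport ?_ (HasCompactSupport.mul_left hc)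
        have := hA.continuous
        have := hφ.continuous
        fun_prop)
    (fun x _ => (hd x).differentiableAt) (fun x _ => (hφ.differentiable (by norm_num)) x)
  rw [this]
  simp [hdd]

theorem fub_pi {m : ℕ} (j : Fin (m + 1)) {A : (Fin (m + 1) → E) → E} {H : (Fin (m + 1) → E) → ℝ}
    (hA : Continuous A) (hH : Continuous H) {η : (Fin (m + 1) → E) → ℝ} (hη : ContDiff ℝ 1 η)
    (hc : HasCompactSupport η)
    (h : ∀ X : Fin (m + 1) → E, ∫ x, fderiv ℝ (fun y => η (Function.update X j y)) x
      (A (Function.update X j x)) = - ∫ x, H (Function.update X j x) * η (Function.update X j x)) :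
    ∫ X, fderiv ℝ η X (Pi.single j (A X)) = - ∫ X, H X * η X := by
  have hη' : Continuous (fderiv ℝ η) := hη.continuous_fderiv (by norm_num)
  have hc' : HasCompactSupport (fderiv ℝ η) := hc.fderiv ℝ
  have i1 : Integrable (fun X => fderiv ℝ η X (Pi.single j (A X))) := by
    refine Continuous.integrable_of_hasCompactSupport ?_ ?_
    · exact hη'.clm_apply ((ContinuousLinearMap.single ℝ (fun _ => E) j).continuous.comp hA)
    · refine hc'.mono fun X hX => ?_
      rw [Function.mem_support] at hX ⊢
      intro h0; apply hX; simp [h0]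
  have i2 : Integrable (fun X => H X * η X) :=
    Continuous.integrable_of_hasCompactSupport (hH.mul hη.continuous) hc.mul_left
  have mp := (volume_preserving_piFinSuccAbove (fun _ : Fin (m + 1) => E) j).symm
  have red : ∀ F : (Fin (m + 1) → E) → ℝ, Integrable F →
      ∫ X, F X = ∫ Y : Fin m → E, ∫ x : E, F (j.insertNth x Y) := by
    intro F hF
    rw [← mp.integral_comp' (g := F), Measure.volume_eq_prod, integral_prod_symm]
    · rfl
    · exact (mp.integrable_comp_emb (MeasurableEquiv.measurableEmbedding _)).2 hF
  rw [red _ i1, red _ i2, ← integral_neg]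
  congr 1
  ext Y
  have hh := h (j.insertNth 0 Y)
  have eu : ∀ x : E, Function.update (j.insertNth (0 : E) Y : Fin (m + 1) → E) j x
      = j.insertNth x Y := by
    intro x; simp
  rw [← integral_neg] at hh ⊢
  simp only [eu] at hh
  rw [← hh]
  congr 1
  ext x
  have hd : HasFDerivAt (fun y : E => η (j.insertNth y Y))
      ((fderiv ℝ η (j.insertNth x Y)).comp (ContinuousLinearMap.single ℝ (fun _ => E) j)) x := by
    have h1 : HasFDerivAt (fun y : E => (j.insertNth y Y : Fin (m + 1) → E))
        (ContinuousLinearMap.single ℝ (fun _ => E) j) x := by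
      have := hasFDerivAt_update (𝕜 := ℝ) (j.insertNth (0 : E) Y : Fin (m + 1) → E) (i := j) x
      convert this using 1
      · ext y; simp
      · ext v k
        simp [Pi.single_apply]
        by_cases hk : k = j
        · subst hk; simp
        · simp [hk]
    have h2 := ((hη.differentiable (by norm_num)) (j.insertNth x Y)).hasFDerivAt
    exact h2.comp x h1
  rw [hd.fderiv]; rfl

end divg


theorem hasDerivAt_posSq (x : ℝ) : HasDerivAt (fun x : ℝ => (max x 0) ^ 2) (2 * max x 0) x := by
  rcases lt_trichotomy x 0 with h | h | h
  · rw [max_eq_right h.le, mul_zero]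
    refine (hasDerivAt_const x (0 : ℝ)).congr_of_eventuallyEq ?_
    filter_upwards [gt_mem_nhds h] with y hy
    rw [max_eq_right hy.le]; norm_num
  · subst h
    rw [max_self, mul_zero, hasDerivAt_iff_isLittleO]
    simp only [max_self, sub_zero, smul_zero, ne_eq, OfNat.ofNat_ne_zero, not_false_eq_true,
      zero_pow]
    have h1 : (fun x : ℝ => (max x 0) ^ 2) =O[𝓝 0] (fun x : ℝ => x ^ 2) := by
      refine Asymptotics.IsBigO.of_bound 1 (Filter.Eventually.of_forall fun y => ?_)
      rw [one_mul, Real.norm_of_nonneg (by positivity), Real.norm_of_nonneg (by positivity)]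
      rcases le_total y 0 with hy | hy
      · rw [max_eq_right hy]; simpa using sq_nonneg y
      · rw [max_eq_left hy]
    refine h1.trans_isLittleO ?_
    have := Asymptotics.isLittleO_pow_id (𝕜 := ℝ) (n := 2) (by norm_num)
    simpa using this
  · rw [max_eq_left h.le]
    have := (hasDerivAt_id x).pow 2
    simp only [id, Nat.cast_ofNat, Nat.add_one_sub_one, pow_one, mul_one] at this
    refine this.congr_of_eventuallyEq ?_
    filter_upwards [lt_mem_nhds h] with y hy
    rw [max_eq_left hy.le]; rfl

theorem contDiff_posSq : ContDiff ℝ 1 (fun x : ℝ => (max x 0) ^ 2) := by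
  rw [contDiff_one_iff_deriv]
  refine ⟨fun x => (hasDerivAt_posSq x).differentiableAt, ?_⟩
  have : deriv (fun x : ℝ => (max x 0) ^ 2) = fun x => 2 * max x 0 := by
    ext x; exact (hasDerivAt_posSq x).deriv
  rw [this]; fun_prop

section doubling
variable {E : Type*} [NormedAddCommGroup E] [InnerProductSpace ℝ E]

theorem dbl_pointwise {ι : Type*} [Fintype ι] {t : ι → ℝ} (ht : ∀ i, 0 ≤ t i)
    (hsum : ∑ i, t i = 1) {L : E →L[ℝ] E} {ℓ μ ω : ℝ} (hμ : 0 ≤ μ) (hω : 0 ≤ ω) (hℓ : 0 ≤ ℓ)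
    (hell : ∀ v, ℓ * ‖v‖ ^ 2 ≤ ⟪L v, v⟫) (hωμ : ω * (1 + μ) ≤ μ * ℓ) (D α : ι → E)
    (hα : ∀ i, ‖α i - L (D i)‖ ≤ ω * ‖D i‖) :
    0 ≤ ∑ j, t j * ⟪D j, ∑ i, t i • α i + μ • α j⟫ := by
  set S := ∑ i, t i * ‖D i‖ with hS
  set S2 := ∑ i, t i * ‖D i‖ ^ 2 with hS2
  have hS0 : 0 ≤ S := Finset.sum_nonneg fun i _ => mul_nonneg (ht i) (norm_nonneg _)
  have jen : S ^ 2 ≤ S2 := by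
    have h1 : 0 ≤ ∑ i, t i * (‖D i‖ - S) ^ 2 :=
      Finset.sum_nonneg fun i _ => mul_nonneg (ht i) (sq_nonneg _)
    have h2 : ∑ i, t i * (‖D i‖ - S) ^ 2 = S2 - 2 * S * S + S ^ 2 := by
      have e : ∀ i, t i * (‖D i‖ - S) ^ 2 = t i * ‖D i‖ ^ 2 - 2 * S * (t i * ‖D i‖)
          + t i * S ^ 2 := fun i => by ring
      simp_rw [e]
      rw [Finset.sum_add_distrib, Finset.sum_sub_distrib, ← Finset.mul_sum, ← Finset.sum_mul,
        hsum]
      ring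
    nlinarith
  have e1 : ∑ j, t j * ⟪D j, ∑ i, t i • α i + μ • α j⟫
      = ⟪∑ j, t j • D j, ∑ i, t i • α i⟫ + μ * ∑ j, t j * ⟪D j, α j⟫ := by
    simp_rw [inner_add_right, mul_add, Finset.sum_add_distrib, sum_inner, real_inner_smul_left,
      real_inner_smul_right, Finset.mul_sum]
    congr 1
    refine Finset.sum_congr rfl fun j _ => by ring
  set Db := ∑ j, t j • D j with hDb
  have hDbn : ‖Db‖ ≤ S := by
    refine (norm_sum_le _ _).trans (Finset.sum_le_sum fun i _ => ?_)
    rw [norm_smul, Real.norm_of_nonneg (ht i)]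
  have e2 : ∑ i, t i • α i = L Db + ∑ i, t i • (α i - L (D i)) := by
    simp_rw [hDb, map_sum, map_smul, smul_sub, Finset.sum_sub_distrib]
    abel
  have n2 : ‖∑ i, t i • (α i - L (D i))‖ ≤ ω * S := by
    rw [hS, Finset.mul_sum]
    refine (norm_sum_le _ _).trans (Finset.sum_le_sum fun i _ => ?_)
    rw [norm_smul, Real.norm_of_nonneg (ht i)]
    nlinarith [mul_le_mul_of_nonneg_left (hα i) (ht i)]
  have b1 : -(ω * S ^ 2) ≤ ⟪Db, ∑ i, t i • α i⟫ := by
    rw [e2, inner_add_right]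
    have h1 : 0 ≤ ⟪Db, L Db⟫ := by
      rw [real_inner_comm]
      exact le_trans (by positivity) (hell Db)
    have h2 := abs_real_inner_le_norm Db (∑ i, t i • (α i - L (D i)))
    have h3 : ‖Db‖ * ‖∑ i, t i • (α i - L (D i))‖ ≤ S * (ω * S) :=
      mul_le_mul hDbn n2 (norm_nonneg _) hS0
    have := neg_le_of_abs_le (h2.trans h3)
    nlinarith
  have b2 : (ℓ - ω) * S2 ≤ ∑ j, t j * ⟪D j, α j⟫ := by
    rw [hS2, Finset.mul_sum]
    refine Finset.sum_le_sum fun j _ => ?_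
    have h0 : α j = L (D j) + (α j - L (D j)) := by abel
    have h1 : (ℓ - ω) * ‖D j‖ ^ 2 ≤ ⟪D j, α j⟫ := by
      rw [h0, inner_add_right, real_inner_comm]
      have h2 := abs_real_inner_le_norm (D j) (α j - L (D j))
      have h3 := mul_le_mul_of_nonneg_left (hα j) (norm_nonneg (D j))
      have := neg_le_of_abs_le (h2.trans h3)
      nlinarith [hell (D j)]
    nlinarith [mul_le_mul_of_nonneg_left h1 (ht j)]
  rw [e1]
  have hS20 : 0 ≤ S2 := le_trans (sq_nonneg _) jen
  nlinarith [mul_le_mul_of_nonneg_left b2 hμ, mul_le_mul_of_nonneg_left jen hω,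
    mul_le_mul_of_nonneg_right hωμ hS20]

end doubling


section doubling2
variable {E : Type*} [NormedAddCommGroup E] [InnerProductSpace ℝ E] [FiniteDimensional ℝ E]

/-- the quantity that must be positive -/
noncomputable def dblT {m : ℕ} (t : Fin (m + 1) → ℝ) (q : E) (a : E → E) (B : E →L[ℝ] E)
    (G : Fin (m + 1) → E → ℝ) (κ μ : ℝ) (X : Fin (m + 1) → E) (j : Fin (m + 1)) : ℝ :=
  (∑ i, t i * trc ((fderiv ℝ a (q + B (∑ k, t k • X k) - (2 * κ) • X i)).comp
      (t j • B - (2 * κ * (if i = j then 1 else 0)) • ContinuousLinearMap.id ℝ E)))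
    + μ * trc ((fderiv ℝ a (q + B (∑ k, t k • X k) - (2 * κ) • X j)).comp
      (t j • B - (2 * κ) • ContinuousLinearMap.id ℝ E))
    - (t j + μ) * G j (X j)

theorem dblT_cont {m : ℕ} (t : Fin (m + 1) → ℝ) (q : E) {a : E → E} (ha : ContDiff ℝ 1 a)
    (B : E →L[ℝ] E) {G : Fin (m + 1) → E → ℝ} (hG : ∀ i, Continuous (G i)) (j : Fin (m + 1)) :
    Continuous (fun z : ℝ × ℝ × (Fin (m + 1) → E) => dblT t q a B G z.1 z.2.1 z.2.2 j) := by
  have ha' : Continuous (fderiv ℝ a) := ha.continuous_fderiv (by norm_num)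
  unfold dblT
  have h1 : ∀ i, Continuous (fun z : ℝ × ℝ × (Fin (m + 1) → E) =>
      fderiv ℝ a (q + B (∑ k, t k • z.2.2 k) - (2 * z.1) • z.2.2 i)) := fun i =>
    ha'.comp (by fun_prop)
  have h2 := hG j
  refine Continuous.sub (Continuous.add ?_ ?_) (by fun_prop)
  · refine continuous_finsetSum _ fun i _ => continuous_const.mul ?_
    exact continuous_trc.comp ((h1 i).clm_comp (by fun_prop))
  · refine Continuous.mul (by fun_prop) ?_
    exact continuous_trc.comp ((h1 j).clm_comp (by fun_prop))

variable [MeasurableSpace E] [BorelSpace E]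

/-- weak equation in one slot -/
theorem dbl_slot {m : ℕ} {t : Fin (m + 1) → ℝ} {w : Fin (m + 1) → E → ℝ}
    (hw : ∀ i, ContDiff ℝ 1 (w i)) {q : E} {a : E → E} (ha : ContDiff ℝ 1 a) {B : E →L[ℝ] E}
    {G : Fin (m + 1) → E → ℝ} (hG : ∀ i, Continuous (G i)) {r : ℝ}
    (heq : ∀ i, ∀ φ : E → ℝ, ContDiff ℝ 1 φ → HasCompactSupport φ → tsupport φ ⊆ ball 0 r →
      ∫ x, fderiv ℝ φ x (a (gradient (w i) x)) = - ∫ x, G i x * φ x)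
    (κ μ : ℝ) {η : (Fin (m + 1) → E) → ℝ} (hη : ContDiff ℝ 1 η) (hc : HasCompactSupport η)
    (hηs : tsupport η ⊆ ball 0 r) (j : Fin (m + 1)) :
    ∫ X, fderiv ℝ η X (Pi.single j (
      ∑ i, t i • (a (q + B (∑ k, t k • X k) - (2 * κ) • X i) - a (gradient (w i) (X i)))
      + μ • (a (q + B (∑ k, t k • X k) - (2 * κ) • X j) - a (gradient (w j) (X j)))))
    = - ∫ X, dblT t q a B G κ μ X j * η X := by
  have hgw : ∀ i, Continuous (gradient (w i)) := fun i => by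
    have := (hw i).continuous_fderiv (by norm_num)
    unfold gradient
    fun_prop
  have hac := ha.continuous
  refine fub_pi j (A := fun X => _) (H := fun X => dblT t q a B G κ μ X j) ?_ ?_ hη hc ?_
  · have h1 : ∀ i, Continuous (fun X : Fin (m + 1) → E => a (gradient (w i) (X i))) := fun i =>
      hac.comp ((hgw i).comp (continuous_apply i))
    have h2 : ∀ i, Continuous (fun X : Fin (m + 1) → E =>
        a (q + B (∑ k, t k • X k) - (2 * κ) • X i)) := fun i => hac.comp (by fun_prop)
    fun_prop
  · exact (dblT_cont t q ha B hG j).comp (f := fun X => (κ, μ, X)) (by fun_prop)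
  intro X
  set φ : E → ℝ := fun y => η (Function.update X j y) with hφd
  have hup : ContDiff ℝ 1 (fun y : E => Function.update X j y) := contDiff_update 1 X j
  have hφ : ContDiff ℝ 1 φ := hη.comp hup
  have hts : tsupport φ ⊆ ball 0 r := by
    intro y hy
    have h1 : tsupport φ ⊆ (fun y : E => Function.update X j y) ⁻¹' tsupport η := by
      refine closure_minimal (fun z hz => subset_tsupport _ hz)
        ((isClosed_tsupport _).preimage hup.continuous)
    have h2 := hηs (h1 hy)
    rw [mem_ball_zero_iff] at h2 ⊢
    have := norm_le_pi_norm (Function.update X j y) j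
    rw [Function.update_self] at this
    linarith
  have hcφ : HasCompactSupport φ := by
    refine HasCompactSupport.of_support_subset_isCompact (isCompact_closedBall (0 : E) r) ?_
    exact (subset_tsupport _).trans (hts.trans ball_subset_closedBall)
  have hφ' : Continuous (fderiv ℝ φ) := hφ.continuous_fderiv (by norm_num)
  have hcφ' : HasCompactSupport (fderiv ℝ φ) := hcφ.fderiv ℝ
  -- the smooth part
  set Q : Fin (m + 1) → E → E := fun i x => q + B (∑ k, t k • Function.update X j x k)
      - (2 * κ) • Function.update X j x i with hQ
  set F1 : E → E := fun x => ∑ i, t i • a (Q i x) + μ • a (Q j x) with hF1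
  have hcomp : ∀ i x, HasFDerivAt (fun y => Function.update X j y i)
      (((if i = j then 1 else 0 : ℝ)) • ContinuousLinearMap.id ℝ E) x := by
    intro i x
    by_cases hi : i = j
    · subst hi
      simp only [Function.update_self, if_true, one_smul]
      exact hasFDerivAt_id x
    · simp only [hi, if_false, zero_smul]
      simp only [Function.update_of_ne hi]
      exact hasFDerivAt_const _ _
  have hQd : ∀ i x, HasFDerivAt (Q i)
      (t j • B - (2 * κ * (if i = j then 1 else 0)) • ContinuousLinearMap.id ℝ E) x := by
    intro i x
    have h1 : HasFDerivAt (fun y => ∑ k, t k • Function.update X j y k)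
        (∑ k, t k • ((if k = j then 1 else 0 : ℝ)) • ContinuousLinearMap.id ℝ E) x :=
      HasFDerivAt.fun_sum fun k _ => (hcomp k x).const_smul (t k)
    have h2 := ((B.hasFDerivAt.comp x h1).const_add q).sub ((hcomp i x).const_smul (2 * κ))
    have e1 : ∑ k, t k • ((if k = j then 1 else 0 : ℝ)) • ContinuousLinearMap.id ℝ E
        = t j • ContinuousLinearMap.id ℝ E := by
      rw [Finset.sum_eq_single j]
      · simp
      · intro k _ hk; simp [hk]
      · simp
    have e2 : t j • B - (2 * κ * (if i = j then 1 else 0)) • ContinuousLinearMap.id ℝ E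
        = B.comp (∑ k, t k • ((if k = j then 1 else 0 : ℝ)) • ContinuousLinearMap.id ℝ E)
          - (2 * κ) • ((if i = j then 1 else 0 : ℝ)) • ContinuousLinearMap.id ℝ E := by
      rw [e1, smul_smul]
      congr 1
      ext v; simp
    rw [e2]
    exact h2
  have hQc : ∀ i, ContDiff ℝ 1 (Q i) := by
    intro i
    have hk : ∀ k, ContDiff ℝ 1 (fun x => Function.update X j x k) := fun k =>
      (contDiff_pi.1 hup) k
    simp only [hQ]
    fun_prop
  have hF1c : ContDiff ℝ 1 F1 := by
    have : ∀ i, ContDiff ℝ 1 (fun x => a (Q i x)) := fun i => ha.comp (hQc i)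
    simp only [hF1]
    fun_prop
  have had : Differentiable ℝ a := ha.differentiable (by norm_num)
  have hF1d : ∀ x, HasFDerivAt F1 (∑ i, t i • ((fderiv ℝ a (Q i x)).comp
      (t j • B - (2 * κ * (if i = j then 1 else 0)) • ContinuousLinearMap.id ℝ E))
      + μ • ((fderiv ℝ a (Q j x)).comp (t j • B - (2 * κ) • ContinuousLinearMap.id ℝ E))) x := by
    intro x
    have h1 : ∀ i, HasFDerivAt (fun x => a (Q i x)) _ x := fun i =>
      (had (Q i x)).hasFDerivAt.comp x (hQd i x)
    have h2 := h1 j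
    simp only [if_true, mul_one] at h2
    exact (HasFDerivAt.fun_sum fun i _ => (h1 i).const_smul (t i)).add (h2.const_smul μ)
  have J1 := div_ibp hF1c hφ hcφ
  -- the constant part
  set c : E := ∑ i ∈ Finset.univ.erase j, t i • a (gradient (w i) (X i)) with hcdef
  have J3 := div_ibp (contDiff_const (c := c)) hφ hcφ
  have J2 := heq j φ hφ hcφ hts
  have hsplit : ∀ x, (∑ i, t i • (a (Q i x) - a (gradient (w i) (Function.update X j x i)))
      + μ • (a (Q j x) - a (gradient (w j) (Function.update X j x j))))
      = F1 x - (t j + μ) • a (gradient (w j) x) - c := by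
    intro x
    have : ∑ i, t i • a (gradient (w i) (Function.update X j x i))
        = t j • a (gradient (w j) x) + c := by
      rw [← Finset.add_sum_erase _ _ (Finset.mem_univ j), Function.update_self, hcdef]
      congr 1
      refine Finset.sum_congr rfl fun i hi => ?_
      rw [Function.update_of_ne (Finset.ne_of_mem_erase hi)]
    simp only [hF1, smul_sub, Finset.sum_sub_distrib, this, Function.update_self, add_smul]
    abel
  have hint : ∀ F : E → E, Continuous F → Integrable (fun x => fderiv ℝ φ x (F x)) := by
    intro F hF
    refine Continuous.integrable_of_hasCompactSupport (hφ'.clm_apply hF) ?_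
    refine hcφ'.mono fun x hx => ?_
    rw [Function.mem_support] at hx ⊢
    intro h0; apply hx; simp [h0]
  have hint2 : ∀ F : E → ℝ, Continuous F → Integrable (fun x => F x * φ x) := by
    intro F hF
    exact Continuous.integrable_of_hasCompactSupport (hF.mul hφ.continuous) hcφ.mul_left
  have hHx : ∀ x, dblT t q a B G κ μ (Function.update X j x) j
      = trc (fderiv ℝ F1 x) - (t j + μ) * G j x := by
    intro x
    rw [(hF1d x).fderiv, trc_add, trc_sum, trc_smul]
    simp only [trc_smul, dblT, Function.update_self, hQ]
  calc _ = ∫ x, (fderiv ℝ φ x (F1 x) - (t j + μ) * fderiv ℝ φ x (a (gradient (w j) x))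
        - fderiv ℝ φ x c) := by
        refine integral_congr_ae (Filter.Eventually.of_forall fun x => ?_)
        have := hsplit x
        simp only [hQ] at this
        simp only []
        rw [this, map_sub, map_sub, map_smul, smul_eq_mul]
    _ = - ∫ x, (trc (fderiv ℝ F1 x) * φ x - (t j + μ) * (G j x * φ x)) := by
        have k1 := hint F1 hF1c.continuous
        have k2 := hint (fun x => a (gradient (w j) x)) (hac.comp (hgw j))
        have k3 := hint (fun x => c) continuous_const
        have k4 := hint2 (fun x => trc (fderiv ℝ F1 x))
          (continuous_trc.comp (hF1c.continuous_fderiv (by norm_num)))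
        have k5 := hint2 (G j) (hG j)
        have k12 : Integrable (fun x => fderiv ℝ φ x (F1 x)
          - (t j + μ) * fderiv ℝ φ x (a (gradient (w j) x))) := k1.sub (k2.const_mul _)
        rw [integral_sub k12 k3, integral_sub k1 (k2.const_mul _),
          integral_const_mul, J1, J2, integral_sub k4 (k5.const_mul _), integral_const_mul, J3]
        simp [trc]
        ring
    _ = _ := by
        congr 1
        refine integral_congr_ae (Filter.Eventually.of_forall fun x => ?_)
        simp only [hHx, hφd]
        ring

end doubling2


section doubling3
variable {E : Type*} [NormedAddCommGroup E] [InnerProductSpace ℝ E] [FiniteDimensional ℝ E]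
  [MeasurableSpace E] [BorelSpace E]

theorem doubling {m : ℕ} {t : Fin (m + 1) → ℝ} (ht : ∀ i, 0 < t i) (hsum : ∑ i, t i = 1)
    {w : Fin (m + 1) → E → ℝ} (hw : ∀ i, ContDiff ℝ 1 (w i)) {q : E}
    (hq : ∀ i, gradient (w i) 0 = q) {a : E → E} (ha : ContDiff ℝ 1 a) {ℓ : ℝ} (hℓ : 0 < ℓ)
    (hell : ∀ v, ℓ * ‖v‖ ^ 2 ≤ ⟪fderiv ℝ a q v, v⟫) {B : E →L[ℝ] E}
    (hB : ∀ v z, ⟪B v, z⟫ = ⟪v, B z⟫)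
    {G : Fin (m + 1) → E → ℝ} (hG : ∀ i, Continuous (G i)) {r : ℝ} (hr : 0 < r)
    (heq : ∀ i, ∀ φ : E → ℝ, ContDiff ℝ 1 φ → HasCompactSupport φ → tsupport φ ⊆ ball 0 r →
      ∫ x, fderiv ℝ φ x (a (gradient (w i) x)) = - ∫ x, G i x * φ x)
    (htouch : ∀ κ > 0, ∃ r' > 0, ∀ X : Fin (m + 1) → E, (∀ i, ‖X i‖ < r') →
      ∑ i, t i * w i 0 + ⟪q, ∑ i, t i • X i⟫ + 1 / 2 * ⟪B (∑ i, t i • X i), ∑ i, t i • X i⟫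
        - κ * ‖∑ i, t i • X i‖ ^ 2 ≤ ∑ i, t i * w i (X i)) :
    trc ((fderiv ℝ a q).comp B) ≤ ∑ i, t i * G i 0 := by
  by_contra hcon
  rw [not_le] at hcon
  have hgw : ∀ i, Continuous (gradient (w i)) := fun i => by
    have := (hw i).continuous_fderiv (by norm_num)
    unfold gradient
    fun_prop
  -- choose κ, μ
  set T : ℝ × ℝ × (Fin (m + 1) → E) → ℝ := fun z => ∑ j, dblT t q a B G z.1 z.2.1 z.2.2 j with hT
  have hTc : Continuous T := continuous_finsetSum _ fun j _ => dblT_cont t q ha B hG j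
  have hT0 : 0 < T (0, 0, 0) := by
    have : T (0, 0, 0) = trc ((fderiv ℝ a q).comp B) - ∑ i, t i * G i 0 := by
      simp only [hT, dblT, Pi.zero_apply, smul_zero, Finset.sum_const_zero, map_zero, add_zero,
        sub_zero, mul_zero, zero_mul, zero_smul, ContinuousLinearMap.comp_smul, trc_smul,
        ← Finset.sum_mul, hsum, one_mul, Finset.sum_sub_distrib]
    rw [this]; linarith
  obtain ⟨σ, hσ, hσT⟩ := Metric.eventually_nhds_iff_ball.1
    (hTc.continuousAt.eventually (lt_mem_nhds hT0))
  obtain ⟨κ, hκ0, hκσ⟩ : ∃ κ : ℝ, 0 < κ ∧ κ < σ := ⟨σ / 2, by linarith, by linarith⟩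
  have hTpos : ∀ X : Fin (m + 1) → E, ‖X‖ < σ → 0 < T (κ, κ, X) := by
    intro X hX
    apply hσT
    have e : ((0, 0, 0) : ℝ × ℝ × (Fin (m + 1) → E)) = 0 := rfl
    rw [e, mem_ball_zero_iff, Prod.norm_def, Prod.norm_def, max_lt_iff, max_lt_iff]
    simp only [Real.norm_of_nonneg hκ0.le]
    exact ⟨hκσ, hκσ, hX⟩
  set μ := κ with hμ
  obtain ⟨r1, hr1, ht1⟩ := htouch (κ / 2) (by linarith)
  set ω := μ * ℓ / (1 + μ) with hω
  have hω0 : 0 < ω := by positivity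
  have hωμ : ω * (1 + μ) ≤ μ * ℓ := by rw [hω]; field_simp; rfl
  have hstrict : HasStrictFDerivAt a (fderiv ℝ a q) q :=
    ha.contDiffAt.hasStrictFDerivAt (by norm_num)
  have hev := hstrict.isLittleO.def hω0
  obtain ⟨U, hU, hUe⟩ : ∃ U ∈ 𝓝 q, ∀ x ∈ U, ∀ y ∈ U,
      ‖a x - a y - fderiv ℝ a q (x - y)‖ ≤ ω * ‖x - y‖ := by
    rw [nhds_prod_eq] at hev
    exact Filter.eventually_prod_self_iff'.1 hev
  set Q : Fin (m + 1) → (Fin (m + 1) → E) → E :=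
    fun i X => q + B (∑ k, t k • X k) - (2 * κ) • X i with hQ
  have hQc : ∀ i, Continuous (Q i) := fun i => by simp only [hQ]; fun_prop
  have hev2 : ∀ᶠ X in 𝓝 (0 : Fin (m + 1) → E), ∀ i, Q i X ∈ U ∧ gradient (w i) (X i) ∈ U := by
    rw [Filter.eventually_all]
    intro i
    refine Filter.Eventually.and ?_ ?_
    · refine (hQc i).continuousAt.eventually_mem ?_
      simpa [hQ] using hU
    · refine ((hgw i).comp (continuous_apply i)).continuousAt.eventually_mem ?_
      simpa [hq i] using hU
  obtain ⟨r2, hr2, hr2U⟩ := Metric.eventually_nhds_iff_ball.1 hev2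
  set R := min (min σ r) (min r1 r2) with hR
  have hR0 : 0 < R := by positivity
  have hRσ : R ≤ σ := (min_le_left _ _).trans (min_le_left _ _)
  have hRr : R ≤ r := (min_le_left _ _).trans (min_le_right _ _)
  have hRr1 : R ≤ r1 := (min_le_right _ _).trans (min_le_left _ _)
  have hRr2 : R ≤ r2 := (min_le_right _ _).trans (min_le_right _ _)
  obtain ⟨τ, hτ0, hτ⟩ : ∃ τ > 0, ∀ i, τ ≤ t i := by
    obtain ⟨i0, _, hi0⟩ := Finset.exists_min_image Finset.univ t Finset.univ_nonempty
    exact ⟨t i0, ht i0, fun i => hi0 i (Finset.mem_univ i)⟩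
  set δ := κ / 2 * (τ * (R / 4) ^ 2) with hδ
  have hδ0 : 0 < δ := by positivity
  set s : (Fin (m + 1) → E) → ℝ := fun X => δ + (∑ i, t i * w i 0 + ⟪q, ∑ i, t i • X i⟫
    + 1 / 2 * ⟪B (∑ i, t i • X i), ∑ i, t i • X i⟫ - κ * ∑ i, t i * ‖X i‖ ^ 2)
    - ∑ i, t i * w i (X i) with hs
  have hs1 : ContDiff ℝ 1 s := by
    have h1 : ∀ i, ContDiff ℝ 1 (fun X : Fin (m + 1) → E => w i (X i)) := fun i =>
      (hw i).comp (contDiff_apply ℝ E i)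
    have h2 : ∀ i, ContDiff ℝ 1 (fun X : Fin (m + 1) → E => ‖X i‖ ^ 2) := fun i =>
      (contDiff_apply ℝ E i).norm_sq ℝ
    have h3 : ContDiff ℝ 1 (fun X : Fin (m + 1) → E => ∑ i, t i • X i) := by fun_prop
    have h4 : ContDiff ℝ 1 (fun X : Fin (m + 1) → E => ⟪B (∑ i, t i • X i), ∑ i, t i • X i⟫) :=
      (B.contDiff.comp h3).inner ℝ h3
    have h5 : ContDiff ℝ 1 (fun X : Fin (m + 1) → E => ⟪q, ∑ i, t i • X i⟫) :=
      contDiff_const.inner ℝ h3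
    simp only [hs]
    fun_prop
  have hsd : ∀ X V, fderiv ℝ s X V = ∑ j, t j * ⟪Q j X - gradient (w j) (X j), V j⟫ := by
    intro X V
    have d0 : ∀ i, HasFDerivAt (fun X : Fin (m + 1) → E => X i)
        (ContinuousLinearMap.proj i) X := fun i => (ContinuousLinearMap.proj (R := ℝ)
          (φ := fun _ : Fin (m + 1) => E) i).hasFDerivAt
    have d1 : ∀ i, HasFDerivAt (fun X : Fin (m + 1) → E => w i (X i))
        ((fderiv ℝ (w i) (X i)).comp (ContinuousLinearMap.proj i)) X := fun i =>
      (((hw i).differentiable (by norm_num)) (X i)).hasFDerivAt.comp X (d0 i)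
    have d2 : ∀ i, HasFDerivAt (fun X : Fin (m + 1) → E => ‖X i‖ ^ 2)
        (2 • (innerSL ℝ (X i)).comp (ContinuousLinearMap.proj i)) X := fun i => (d0 i).norm_sq
    have d3 : HasFDerivAt (fun X : Fin (m + 1) → E => ∑ i, t i • X i)
        (∑ i, t i • (ContinuousLinearMap.proj i : (Fin (m + 1) → E) →L[ℝ] E)) X :=
      HasFDerivAt.fun_sum fun i _ => (d0 i).const_smul (t i)
    have d4 := (B.hasFDerivAt.comp X d3).inner ℝ d3
    have d5 := (hasFDerivAt_const q X).inner ℝ d3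
    have d6 := ((((d5.const_add (∑ i, t i * w i 0)).add (d4.const_mul (1 / 2))).sub
      ((HasFDerivAt.fun_sum (u := Finset.univ) fun i _ => (d2 i).const_mul (t i)).const_mul
        κ)).const_add δ).sub
      (HasFDerivAt.fun_sum (u := Finset.univ) fun i _ => (d1 i).const_mul (t i))
    have d7 : HasFDerivAt s _ X := d6
    have hgr : ∀ i, fderiv ℝ (w i) (X i) (V i) = ⟪gradient (w i) (X i), V i⟫ := fun i => by
      simp [gradient]
    rw [d7.fderiv]
    have hBs : ⟪B (∑ i, t i • V i), ∑ i, t i • X i⟫ = ⟪B (∑ i, t i • X i), ∑ i, t i • V i⟫ := by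
      rw [hB, real_inner_comm]
    simp only [hQ, inner_sub_left, inner_add_left, mul_sub, mul_add, Finset.sum_sub_distrib,
      Finset.sum_add_distrib, real_inner_smul_left]
    have r1 : ∀ y : E, ∑ i, t i * ⟪y, V i⟫ = ⟪y, ∑ i, t i • V i⟫ := fun y => by
      simp [inner_sum, real_inner_smul_right]
    rw [r1, r1]
    simp only [add_apply, sub_apply, smul_apply, sum_apply,
      ContinuousLinearMap.comp_apply, fderivInnerCLM_apply, ContinuousLinearMap.prod_apply,
      ContinuousLinearMap.proj_apply, hgr, zero_apply, inner_zero_left, innerSL_apply_apply,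
      smul_eq_mul, nsmul_eq_mul, Nat.cast_ofNat, Function.comp_apply, add_zero, hBs]
    have r2 : κ * ∑ x, t x * (2 * ⟪X x, V x⟫) = ∑ x, t x * (2 * κ * ⟪X x, V x⟫) := by
      rw [Finset.mul_sum]
      exact Finset.sum_congr rfl fun i _ => by ring
    rw [r2]; ring
  have hsle : ∀ X, ‖X‖ < R → s X ≤ δ - κ / 2 * ∑ i, t i * ‖X i‖ ^ 2 := by
    intro X hX
    have h1 := ht1 X (fun i => (norm_le_pi_norm X i).trans_lt (hX.trans_le hRr1))
    have h2 : ‖∑ i, t i • X i‖ ^ 2 ≤ ∑ i, t i * ‖X i‖ ^ 2 := by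
      have h3 : ‖∑ i, t i • X i‖ ≤ ∑ i, t i * ‖X i‖ := by
        refine (norm_sum_le _ _).trans (Finset.sum_le_sum fun i _ => ?_)
        rw [norm_smul, Real.norm_of_nonneg (ht i).le]
      have h4 : (∑ i, t i * ‖X i‖) ^ 2 ≤ ∑ i, t i * ‖X i‖ ^ 2 :=
        Real.pow_arith_mean_le_arith_mean_pow Finset.univ t (fun i => ‖X i‖)
          (fun i _ => (ht i).le) hsum (fun i _ => norm_nonneg _) 2
      exact (pow_le_pow_left₀ (norm_nonneg _) h3 2).trans h4
    simp only [hs]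
    nlinarith
  let ζ : ContDiffBump (0 : Fin (m + 1) → E) := ⟨R / 4, R / 2, by positivity, by linarith⟩
  have hζi : ζ.rIn = R / 4 := rfl
  have hζo : ζ.rOut = R / 2 := rfl
  set η : (Fin (m + 1) → E) → ℝ := fun X => ζ X * (max (s X) 0) ^ 2 with hη
  have hsq : ContDiff ℝ 1 (fun X => (max (s X) 0) ^ 2) := contDiff_posSq.comp hs1
  have hη1 : ContDiff ℝ 1 η := ζ.contDiff.mul hsq
  have hηc : HasCompactSupport η := ζ.hasCompactSupport.mul_right
  have hηs' : tsupport η ⊆ closedBall 0 (R / 2) := by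
    rw [← hζo, ← ζ.tsupport_eq]
    exact closure_mono (Function.support_mul_subset_left _ _)
  have hηs : tsupport η ⊆ ball 0 r := hηs'.trans (closedBall_subset_ball (by linarith))
  have hout : ∀ X, R / 4 ≤ ‖X‖ → ‖X‖ < R → max (s X) 0 = 0 := by
    intro X h1 h2
    refine max_eq_right ((hsle X h2).trans ?_)
    obtain ⟨i, hi⟩ : ∃ i, R / 4 ≤ ‖X i‖ := by
      by_contra hno
      push Not at hno
      exact absurd ((pi_norm_lt_iff (by positivity)).2 hno) (not_lt.2 h1)
    have h3 : τ * (R / 4) ^ 2 ≤ ∑ i, t i * ‖X i‖ ^ 2 := by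
      refine le_trans ?_ (Finset.single_le_sum (f := fun i => t i * ‖X i‖ ^ 2)
        (fun j _ => mul_nonneg (ht j).le (sq_nonneg _)) (Finset.mem_univ i))
      exact mul_le_mul (hτ i) (pow_le_pow_left₀ (by positivity) hi 2) (by positivity) (ht i).le
    have : κ / 2 * (τ * (R / 4) ^ 2) ≤ κ / 2 * ∑ i, t i * ‖X i‖ ^ 2 :=
      mul_le_mul_of_nonneg_left h3 (by positivity)
    rw [hδ]; linarith
  have hηd : ∀ X V, fderiv ℝ η X V = 2 * ζ X * max (s X) 0 *
      ∑ j, t j * ⟪Q j X - gradient (w j) (X j), V j⟫ := by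
    intro X V
    have h1 : HasFDerivAt (fun X => (max (s X) 0) ^ 2) ((2 * max (s X) 0) • fderiv ℝ s X) X :=
      (hasDerivAt_posSq (s X)).comp_hasFDerivAt X
        ((hs1.differentiable (by norm_num)) X).hasFDerivAt
    have h2 : HasFDerivAt ζ (fderiv ℝ ζ X) X :=
      ((ζ.contDiff (n := 1)).differentiable (by norm_num) X).hasFDerivAt
    have h3 : HasFDerivAt η _ X := h2.mul h1
    have h4 : (max (s X) 0) ^ 2 • fderiv ℝ ζ X = 0 := by
      by_cases hX1 : ‖X‖ < R / 4
      · have : (ζ : (Fin (m + 1) → E) → ℝ) =ᶠ[𝓝 X] fun _ => (1 : ℝ) := by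
          filter_upwards [isOpen_ball.mem_nhds (mem_ball_zero_iff.2 hX1)] with y hy
          exact ζ.one_of_mem_closedBall (ball_subset_closedBall hy)
        rw [this.fderiv_eq]; simp
      · by_cases hX2 : ‖X‖ < R
        · rw [hout X (not_lt.1 hX1) hX2]; simp
        · have : fderiv ℝ ζ X = 0 := by
            refine image_eq_zero_of_notMem_tsupport fun hx => ?_
            have := tsupport_fderiv_subset ℝ hx
            rw [ζ.tsupport_eq, hζo, mem_closedBall_zero_iff] at this
            linarith
          rw [this, smul_zero]
    rw [h3.fderiv, h4, add_zero]
    simp only [smul_smul, FunLike.coe_smul, Pi.smul_apply, hsd, smul_eq_mul]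
    ring
  -- the total integral
  set Af : Fin (m + 1) → (Fin (m + 1) → E) → E := fun j X =>
    ∑ i, t i • (a (Q i X) - a (gradient (w i) (X i)))
      + μ • (a (Q j X) - a (gradient (w j) (X j))) with hAf
  have slot : ∀ j, ∫ X, fderiv ℝ η X (Pi.single j (Af j X))
      = - ∫ X, dblT t q a B G κ μ X j * η X := fun j =>
    dbl_slot hw ha hG heq κ μ hη1 hηc hηs j
  have hint1 : ∀ j, Integrable (fun X => fderiv ℝ η X (Pi.single j (Af j X))) := by
    intro j
    have hAc : Continuous (Af j) := by
      have h1 : ∀ i, Continuous (fun X : Fin (m + 1) → E => a (gradient (w i) (X i))) := fun i =>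
        ha.continuous.comp ((hgw i).comp (continuous_apply i))
      have h2 : ∀ i, Continuous (fun X : Fin (m + 1) → E => a (Q i X)) := fun i =>
        ha.continuous.comp (hQc i)
      simp only [hAf]
      fun_prop
    refine Continuous.integrable_of_hasCompactSupport ((hη1.continuous_fderiv
      (by norm_num)).clm_apply ((ContinuousLinearMap.single ℝ (fun _ => E) j).continuous.comp
      hAc)) ?_
    refine (hηc.fderiv ℝ).mono fun X hX => ?_
    rw [Function.mem_support] at hX ⊢
    intro h0; apply hX; simp [h0]
  have hint2 : ∀ j, Integrable (fun X => dblT t q a B G κ μ X j * η X) := fun j =>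
    Continuous.integrable_of_hasCompactSupport (((dblT_cont t q ha B hG j).comp
      (f := fun X => (κ, μ, X)) (by fun_prop)).mul hη1.continuous) hηc.mul_left
  have hη0 : ∀ X, 0 ≤ η X := fun X => mul_nonneg (ζ.nonneg) (sq_nonneg _)
  have tot : ∫ X, ∑ j, fderiv ℝ η X (Pi.single j (Af j X)) = - ∫ X, T (κ, μ, X) * η X := by
    rw [integral_finsetSum _ (fun j _ => hint1 j)]
    simp_rw [slot, hT, Finset.sum_mul]
    rw [integral_finsetSum _ (fun j _ => hint2 j), Finset.sum_neg_distrib]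
  have low : 0 ≤ ∫ X, ∑ j, fderiv ℝ η X (Pi.single j (Af j X)) := by
    refine integral_nonneg fun X => ?_
    have e : ∑ j, fderiv ℝ η X (Pi.single j (Af j X)) = 2 * ζ X * max (s X) 0 *
        ∑ j, t j * ⟪Q j X - gradient (w j) (X j), Af j X⟫ := by
      rw [Finset.mul_sum]
      refine Finset.sum_congr rfl fun j _ => ?_
      rw [hηd, Finset.sum_eq_single j]
      · simp
      · intro k _ hk; simp [hk]
      · simp
    simp only [Pi.zero_apply]
    rw [e]
    by_cases hX : ‖X‖ < R
    · refine mul_nonneg (mul_nonneg (mul_nonneg (by norm_num) ζ.nonneg) (le_max_right _ _)) ?_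
      have hm := hr2U X (mem_ball_zero_iff.2 (hX.trans_le hRr2))
      refine dbl_pointwise (fun i => (ht i).le) hsum hκ0.le hω0.le hℓ.le hell hωμ _ _ fun i => ?_
      exact hUe _ (hm i).1 _ (hm i).2
    · have : ζ X = 0 := ζ.zero_of_le_dist (by rw [hζo, dist_zero_right]; linarith)
      rw [this]; simp
  have up : 0 < ∫ X, T (κ, μ, X) * η X := by
    have hcont : Continuous (fun X => T (κ, μ, X) * η X) :=
      (hTc.comp (f := fun X => (κ, μ, X)) (by fun_prop)).mul hη1.continuous
    refine hcont.integral_pos_of_hasCompactSupport_nonneg_nonzero hηc.mul_left ?_ (x := 0) ?_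
    · intro X
      by_cases hX : ‖X‖ < R
      · exact mul_nonneg (hTpos X (hX.trans_le hRσ)).le (hη0 X)
      · have : ζ X = 0 := ζ.zero_of_le_dist (by rw [hζo, dist_zero_right]; linarith)
        simp [hη, this]
    · have h1 := hTpos 0 (by simpa using hσ)
      have h2 : η 0 = δ ^ 2 := by
        have : s 0 = δ := by simp [hs]
        have h3 : ζ 0 = 1 := ζ.one_of_mem_closedBall (by simp [hζi]; positivity)
        simp only [hη, this, h3, one_mul, max_eq_left hδ0.le]
      rw [h2]; positivity
  linarith

end doubling3


section leg
variable {E : Type*} [NormedAddCommGroup E] [InnerProductSpace ℝ E] [FiniteDimensional ℝ E]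

theorem isCompact_convexHull_of_isCompact {S : Set E} (hS : IsCompact S) :
    IsCompact (convexHull ℝ S) := by
  classical
  set d := Module.finrank ℝ E + 1 with hd
  have himg : convexHull ℝ S = (fun z : (Fin d → ℝ) × (Fin d → E) => ∑ i, z.1 i • z.2 i) ''
      (stdSimplex ℝ (Fin d) ×ˢ Set.pi Set.univ (fun _ => S)) := by
    apply Set.Subset.antisymm
    · intro x hx
      obtain ⟨ι, hι, z, w, hz, hai, hw, hw1, rfl⟩ := eq_pos_convex_span_of_mem_convexHull hx
      have hcard : Fintype.card ι ≤ d := hai.card_le_finrank_succ.trans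
        (Nat.succ_le_succ (Submodule.finrank_le _))
      have hne : Nonempty ι := by
        by_contra hno
        rw [not_nonempty_iff] at hno
        simp at hw1
      obtain ⟨i0⟩ := hne
      obtain ⟨f⟩ : Nonempty (ι ↪ Fin d) := Function.Embedding.nonempty_of_card_le (by simpa using hcard)
      refine ⟨(Function.extend f w 0, Function.extend f z (fun _ => z i0)), ⟨⟨?_, ?_⟩, ?_⟩, ?_⟩
      · intro k
        by_cases hk : ∃ i, f i = k
        · obtain ⟨i, rfl⟩ := hk
          simp only [f.injective.extend_apply]; exact (hw i).le
        · simp only [Function.extend_apply' _ _ _ hk]; exact le_rfl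
      · rw [← hw1]
        refine (Fintype.sum_of_injective f f.injective _ _ ?_ ?_).symm
        · intro k hk
          exact Function.extend_apply' _ _ _ (by simpa using hk)
        · intro i; simp [f.injective.extend_apply]
      · intro k _
        by_cases hk : ∃ i, f i = k
        · obtain ⟨i, rfl⟩ := hk
          simp only [f.injective.extend_apply]; exact hz ⟨i, rfl⟩
        · simp only [Function.extend_apply' _ _ _ hk]; exact hz ⟨i0, rfl⟩
      · refine (Fintype.sum_of_injective f f.injective _ _ ?_ ?_).symm
        · intro k hk
          simp only []
          rw [Function.extend_apply' _ _ _ (by simpa using hk)]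
          simp
        · intro i; simp [f.injective.extend_apply]
    · rintro _ ⟨⟨w, z⟩, ⟨hw, hz⟩, rfl⟩
      exact (convex_convexHull ℝ S).sum_mem (fun i _ => hw.1 i) hw.2
        (fun i _ => subset_convexHull ℝ S (hz i (Set.mem_univ i)))
  rw [himg]
  refine ((isCompact_stdSimplex ℝ (Fin d)).prod (isCompact_univ_pi fun _ => hS)).image ?_
  fun_prop

theorem legendre_exists {K : Set E} (hK : IsCompact K) {u : E → ℝ} (hu : ContinuousOn u K)
    (hu0 : ∀ y ∈ K, 0 ≤ u y) {y0 : E} (hy0 : y0 ∈ K) (huy0 : 0 < u y0) :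
    ∃ ws : E → ℝ, (∀ q, ∀ y ∈ K, Real.exp ⟪q, y⟫ * u y ≤ Real.exp (ws q)) ∧
      (∀ q, ∃ y ∈ K, Real.exp ⟪q, y⟫ * u y = Real.exp (ws q)) := by
  have hmax : ∀ q : E, ∃ y ∈ K, ∀ z ∈ K, Real.exp ⟪q, z⟫ * u z ≤ Real.exp ⟪q, y⟫ * u y := by
    intro q
    have hc : ContinuousOn (fun y => Real.exp ⟪q, y⟫ * u y) K :=
      ContinuousOn.mul (by fun_prop) hu
    obtain ⟨y, hy, hm⟩ := hK.exists_isMaxOn ⟨y0, hy0⟩ hc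
    exact ⟨y, hy, fun z hz => hm hz⟩
  choose Y hY hYm using hmax
  have hpos : ∀ q, 0 < Real.exp ⟪q, Y q⟫ * u (Y q) := fun q =>
    lt_of_lt_of_le (by positivity) (hYm q y0 hy0)
  refine ⟨fun q => Real.log (Real.exp ⟪q, Y q⟫ * u (Y q)), fun q y hy => ?_, fun q => ?_⟩
  · rw [Real.exp_log (hpos q)]; exact hYm q y hy
  · exact ⟨Y q, hY q, by rw [Real.exp_log (hpos q)]⟩

theorem leg_Vmax {K : Set E} (hK : IsCompact K) {u : E → ℝ} (hu : ContinuousOn u K)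
    (hu0 : ∀ y ∈ K, 0 ≤ u y) {y0 : E} (hy0 : y0 ∈ K) (huy0 : 0 < u y0) {ws : E → ℝ}
    (h1 : ∀ q, ∀ y ∈ K, Real.exp ⟪q, y⟫ * u y ≤ Real.exp (ws q))
    (h2 : ∀ q, ∃ y ∈ K, Real.exp ⟪q, y⟫ * u y = Real.exp (ws q)) :
    Continuous ws ∧ ∀ ε > 0, ∀ x, ∃ q : E, ∀ q' : E,
      ⟪q', x⟫ - ws q' - ε / 2 * ‖q'‖ ^ 2 ≤ ⟪q, x⟫ - ws q - ε / 2 * ‖q‖ ^ 2 := by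
  obtain ⟨R, hR⟩ := hK.isBounded.exists_norm_le
  have hlip : ∀ q q', ws q ≤ ws q' + R * ‖q - q'‖ := by
    intro q q'
    obtain ⟨y, hy, hye⟩ := h2 q
    have h3 := h1 q' y hy
    rw [← Real.exp_le_exp, ← hye]
    have h4 : ⟪q, y⟫ ≤ ⟪q', y⟫ + R * ‖q - q'‖ := by
      have : ⟪q, y⟫ - ⟪q', y⟫ = ⟪q - q', y⟫ := by rw [inner_sub_left]
      have h5 := real_inner_le_norm (q - q') y
      nlinarith [norm_nonneg (q - q'), hR y hy]
    calc Real.exp ⟪q, y⟫ * u y ≤ Real.exp (⟪q', y⟫ + R * ‖q - q'‖) * u y :=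
          mul_le_mul_of_nonneg_right (Real.exp_le_exp.2 h4) (hu0 y hy)
      _ = (Real.exp ⟪q', y⟫ * u y) * Real.exp (R * ‖q - q'‖) := by rw [Real.exp_add]; ring
      _ ≤ Real.exp (ws q') * Real.exp (R * ‖q - q'‖) :=
          mul_le_mul_of_nonneg_right h3 (Real.exp_pos _).le
      _ = _ := by rw [Real.exp_add]
  have hR0 : 0 ≤ R := (norm_nonneg y0).trans (hR y0 hy0)
  have hcont : Continuous ws := by
    refine (LipschitzWith.of_dist_le_mul (K := R.toNNReal) fun q q' => ?_).continuous
    rw [Real.dist_eq, dist_eq_norm, Real.coe_toNNReal _ hR0, abs_le]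
    have := hlip q q'
    have h' := hlip q' q
    rw [norm_sub_rev] at h'
    constructor <;> linarith
  refine ⟨hcont, fun ε hε x => ?_⟩
  set F : E → ℝ := fun q => -(⟪q, x⟫ - ws q - ε / 2 * ‖q‖ ^ 2) with hF
  have hFc : Continuous F := by simp only [hF]; fun_prop
  have hco : Filter.Tendsto F (Filter.cocompact E) Filter.atTop := by
    have hlow : ∀ q, ‖q‖ * (ε / 2 * ‖q‖ - ‖x - y0‖) + Real.log (u y0) ≤ F q := by
      intro q
      have h3 : ⟪q, y0⟫ + Real.log (u y0) ≤ ws q := by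
        rw [← Real.exp_le_exp, Real.exp_add, Real.exp_log huy0]; exact h1 q y0 hy0
      have h5 := real_inner_le_norm q (x - y0)
      rw [inner_sub_right] at h5
      simp only [hF]
      nlinarith
    refine Filter.tendsto_atTop_mono hlow ?_
    refine Filter.tendsto_atTop_add_const_right _ _ ?_
    have ha : Filter.Tendsto (fun s : ℝ => s * (ε / 2 * s - ‖x - y0‖)) Filter.atTop Filter.atTop :=
      Filter.tendsto_id.atTop_mul_atTop₀ (Filter.tendsto_atTop_add_const_right _ _
        (Filter.tendsto_id.const_mul_atTop (by positivity)))
    exact ha.comp (tendsto_norm_cocompact_atTop (E := E))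
  obtain ⟨q, hq⟩ := hFc.exists_forall_le hco
  refine ⟨q, fun q' => ?_⟩
  have := hq q'
  simp only [hF] at this
  linarith

/-- Danskin: the barycentre condition -/
theorem leg_contact {K : Set E} (hK : IsCompact K) {u : E → ℝ} (hu : ContinuousOn u K)
    {ws : E → ℝ} (hws : Continuous ws)
    (h1 : ∀ q, ∀ y ∈ K, Real.exp ⟪q, y⟫ * u y ≤ Real.exp (ws q))
    (h2 : ∀ q, ∃ y ∈ K, Real.exp ⟪q, y⟫ * u y = Real.exp (ws q)) {ε : ℝ} (hε : 0 < ε) {x q : E}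
    (hq : ∀ q' : E, ⟪q', x⟫ - ws q' - ε / 2 * ‖q'‖ ^ 2 ≤ ⟪q, x⟫ - ws q - ε / 2 * ‖q‖ ^ 2) :
    x - ε • q ∈ convexHull ℝ {y ∈ K | Real.exp ⟪q, y⟫ * u y = Real.exp (ws q)} := by
  set S := {y ∈ K | Real.exp ⟪q, y⟫ * u y = Real.exp (ws q)} with hS
  have hSc : IsCompact S := by
    refine hK.of_isClosed_subset ?_ (fun y hy => hy.1)
    have hc : ContinuousOn (fun y => Real.exp ⟪q, y⟫ * u y) K :=
      ContinuousOn.mul (by fun_prop) hu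
    exact hc.preimage_isClosed_of_isClosed hK.isClosed (isClosed_singleton (x := Real.exp (ws q)))
  by_contra hno
  obtain ⟨f, c, hf1, hf2⟩ := geometric_hahn_banach_closed_point (convex_convexHull ℝ S)
    (isCompact_convexHull_of_isCompact hSc).isClosed hno
  set v : E := (InnerProductSpace.toDual ℝ E).symm f with hv
  have hfv : ∀ y, f y = ⟪v, y⟫ := fun y => by simp [hv]
  set s : ℕ → ℝ := fun k => 1 / ((k : ℝ) + 1) with hs
  have hs0 : ∀ k, 0 < s k := fun k => by simp only [hs]; positivity
  have hslim : Filter.Tendsto s Filter.atTop (𝓝 0) := tendsto_one_div_add_atTop_nhds_zero_nat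
  choose Y hYK hYe using fun k => h2 (q + s k • v)
  have ineq : ∀ k, ⟪v, x - ε • q⟫ ≤ ⟪v, Y k⟫ + ε / 2 * s k * ‖v‖ ^ 2 := by
    intro k
    have a1 := hq (q + s k • v)
    have a2 : ws (q + s k • v) ≤ ws q + s k * ⟪v, Y k⟫ := by
      rw [← Real.exp_le_exp, ← hYe k, inner_add_left, real_inner_smul_left, Real.exp_add,
        Real.exp_add]
      have := mul_le_mul_of_nonneg_right (h1 q (Y k) (hYK k)) (Real.exp_pos (s k * ⟪v, Y k⟫)).le
      linarith
    rw [inner_add_left, real_inner_smul_left, norm_add_sq_real, real_inner_smul_right, norm_smul,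
      Real.norm_of_nonneg (hs0 k).le] at a1
    rw [inner_sub_right, real_inner_smul_right]
    rw [real_inner_comm v q] at a1
    have a3 : s k * (⟪v, x⟫ - ε * ⟪v, q⟫) ≤ s k * (⟪v, Y k⟫ + ε / 2 * s k * ‖v‖ ^ 2) := by
      nlinarith
    exact le_of_mul_le_mul_left a3 (hs0 k)
  obtain ⟨y, hyK, θ, hθ, hlim⟩ := hK.tendsto_subseq hYK
  have hsθ : Filter.Tendsto (fun k => s (θ k)) Filter.atTop (𝓝 0) := hslim.comp hθ.tendsto_atTop
  have hqθ : Filter.Tendsto (fun k => q + s (θ k) • v) Filter.atTop (𝓝 q) := by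
    simpa using (tendsto_const_nhds (x := q)).add (hsθ.smul (tendsto_const_nhds (x := v)))
  have hyS : y ∈ S := by
    refine ⟨hyK, ?_⟩
    have hul : Filter.Tendsto (fun k => u (Y (θ k))) Filter.atTop (𝓝 (u y)) :=
      (hu y hyK).tendsto.comp (tendsto_nhdsWithin_iff.2
        ⟨hlim, Filter.Eventually.of_forall fun k => hYK _⟩)
    have b1 : Filter.Tendsto (fun k => Real.exp ⟪q + s (θ k) • v, Y (θ k)⟫ * u (Y (θ k)))
        Filter.atTop (𝓝 (Real.exp ⟪q, y⟫ * u y)) :=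
      ((Real.continuous_exp.tendsto _).comp (hqθ.inner hlim)).mul hul
    have b2 : Filter.Tendsto (fun k => Real.exp (ws (q + s (θ k) • v)))
        Filter.atTop (𝓝 (Real.exp (ws q))) :=
      (Real.continuous_exp.tendsto _).comp ((hws.tendsto q).comp hqθ)
    refine tendsto_nhds_unique b1 (b2.congr fun k => ?_)
    exact (hYe (θ k)).symm
  have l1 : Filter.Tendsto (fun k => ⟪v, Y (θ k)⟫ + ε / 2 * s (θ k) * ‖v‖ ^ 2) Filter.atTop
      (𝓝 (⟪v, y⟫ + ε / 2 * 0 * ‖v‖ ^ 2)) :=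
    ((tendsto_const_nhds (x := v)).inner hlim).add ((hsθ.const_mul _).mul_const _)
  have l2 := ge_of_tendsto' l1 (fun k => ineq (θ k))
  have l3 := hf1 y (subset_convexHull ℝ S hyS)
  rw [hfv] at l3 hf2
  linarith

end leg


section leg2
variable {E : Type*} [NormedAddCommGroup E] [InnerProductSpace ℝ E]

structure LegData (K : Set E) (u : E → ℝ) (ε : ℝ) (V : E → ℝ) (qf : E → E) : Prop where
  P1 : ∀ x y, ε * ‖qf x - qf y‖ ^ 2 ≤ ⟪qf x - qf y, x - y⟫
  P2 : ∀ x y, V x + ⟪qf x, y - x⟫ ≤ V y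
  P3 : ∀ x ∈ K, 0 < u x → V x ≤ -Real.log (u x)
  P4 : ∀ (ν : E) (c : ℝ), (∀ y ∈ K, 0 < u y → ⟪ν, y⟫ + Real.log (u y) ≤ c) →
    ∀ x, ⟪ν, x⟫ - c - ε / 2 * ‖ν‖ ^ 2 ≤ V x
  P5 : ∀ x, ∃ (m : ℕ) (t : Fin (m + 1) → ℝ) (xi : Fin (m + 1) → E), (∀ i, 0 < t i) ∧
    ∑ i, t i = 1 ∧ (∀ i, xi i ∈ K) ∧ (∀ i, 0 < u (xi i)) ∧ x - ε • qf x = ∑ i, t i • xi i ∧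
    (∀ i, ∀ y ∈ K, 0 < u y → ⟪qf x, y⟫ + Real.log (u y) ≤ ⟪qf x, xi i⟫ + Real.log (u (xi i))) ∧
    ∀ X : Fin (m + 1) → E, (∀ i, xi i + X i ∈ K) → (∀ i, 0 < u (xi i + X i)) →
      V (x + ∑ i, t i • X i) - V x ≤
        ∑ i, t i * (Real.log (u (xi i)) - Real.log (u (xi i + X i)))

theorem legData_exists [FiniteDimensional ℝ E] {K : Set E} (hK : IsCompact K) {u : E → ℝ}
    (hu : ContinuousOn u K)
    (hu0 : ∀ y ∈ K, 0 ≤ u y) {y0 : E} (hy0 : y0 ∈ K) (huy0 : 0 < u y0) {ε : ℝ} (hε : 0 < ε) :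
    ∃ (V : E → ℝ) (qf : E → E), LegData K u ε V qf := by
  obtain ⟨ws, h1, h2⟩ := legendre_exists hK hu hu0 hy0 huy0
  obtain ⟨hws, hV⟩ := leg_Vmax hK hu hu0 hy0 huy0 h1 h2
  choose qf hq using hV ε hε
  have h1' : ∀ q, ∀ y ∈ K, 0 < u y → ⟪q, y⟫ + Real.log (u y) ≤ ws q := by
    intro q y hy hp
    rw [← Real.exp_le_exp, Real.exp_add, Real.exp_log hp]; exact h1 q y hy
  have hpos : ∀ q y, Real.exp ⟪q, y⟫ * u y = Real.exp (ws q) → 0 < u y ∧ ⟪q, y⟫ + Real.log (u y) = ws q := by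
    intro q y h
    have : 0 < u y := by
      have := Real.exp_pos (ws q)
      rw [← h] at this
      exact (mul_pos_iff_of_pos_left (Real.exp_pos _)).1 this
    refine ⟨this, ?_⟩
    apply Real.exp_injective
    rw [Real.exp_add, Real.exp_log this, h]
  have hrep : ∀ x, ∃ (m : ℕ) (t : Fin (m + 1) → ℝ) (xi : Fin (m + 1) → E), (∀ i, 0 < t i) ∧
      ∑ i, t i = 1 ∧ (∀ i, xi i ∈ K) ∧ (∀ i, 0 < u (xi i)) ∧ x - ε • qf x = ∑ i, t i • xi i ∧
      (∀ i, ⟪qf x, xi i⟫ + Real.log (u (xi i)) = ws (qf x)) := by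
    intro x
    have hc := leg_contact hK hu hws h1 h2 hε (hq x)
    obtain ⟨ι, hι, z, w, hz, hai, hw, hw1, he⟩ := eq_pos_convex_span_of_mem_convexHull hc
    have hne : Nonempty ι := by
      by_contra hno
      rw [not_nonempty_iff] at hno
      simp at hw1
    obtain ⟨m, hm⟩ : ∃ m, Fintype.card ι = m + 1 :=
      Nat.exists_eq_succ_of_ne_zero Fintype.card_ne_zero
    let e : Fin (m + 1) ≃ ι := (Fintype.equivFinOfCardEq hm).symm
    refine ⟨m, w ∘ e, z ∘ e, fun i => hw _, ?_, fun i => (hz ⟨e i, rfl⟩).1, fun i => (hpos _ _ (hz ⟨e i, rfl⟩).2).1, ?_, fun i => (hpos _ _ (hz ⟨e i, rfl⟩).2).2⟩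
    · rw [← hw1]; exact e.sum_comp w
    · rw [← he]; exact (e.sum_comp (fun i => w i • z i)).symm
  have hsub : ∀ x q', ws (qf x) + ⟪q' - qf x, x - ε • qf x⟫ ≤ ws q' := by
    intro x q'
    obtain ⟨m, t, xi, ht, hs, hk, hup, he, hcon⟩ := hrep x
    have : ∑ i, t i * (ws (qf x) + ⟪q' - qf x, xi i⟫) ≤ ∑ i, t i * ws q' := by
      refine Finset.sum_le_sum fun i _ => mul_le_mul_of_nonneg_left ?_ (ht i).le
      have := h1' q' (xi i) (hk i) (hup i)
      rw [← hcon i, inner_sub_left]; linarith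
    rw [← Finset.sum_mul, hs, one_mul] at this
    refine le_trans (le_of_eq ?_) this
    rw [he, inner_sum]
    simp only [mul_add, Finset.sum_add_distrib, ← Finset.sum_mul, hs, one_mul, real_inner_smul_right]
  refine ⟨fun x => ⟪qf x, x⟫ - ws (qf x) - ε / 2 * ‖qf x‖ ^ 2, qf, ?_, ?_, ?_, ?_, ?_⟩
  · intro x y
    have a := hsub x (qf y)
    have b := hsub y (qf x)
    have : ‖qf x - qf y‖ ^ 2 = ⟪qf x - qf y, qf x - qf y⟫ := (real_inner_self_eq_norm_sq _).symm
    rw [this]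
    simp only [inner_sub_left, inner_sub_right, real_inner_smul_right] at *
    linarith
  · intro x y
    have := hq y (qf x)
    rw [inner_sub_right]
    linarith
  · intro x hx hp
    have := h1' (qf x) x hx hp
    have : 0 ≤ ε / 2 * ‖qf x‖ ^ 2 := by positivity
    linarith
  · intro ν c hc x
    have := hq x ν
    obtain ⟨y, hy, hye⟩ := h2 ν
    obtain ⟨hp, hl⟩ := hpos _ _ hye
    have := hc y hy hp
    linarith
  · intro x
    obtain ⟨m, t, xi, ht, hs, hk, hup, he, hcon⟩ := hrep x
    refine ⟨m, t, xi, ht, hs, hk, hup, he, ?_, ?_⟩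
    · intro i y hy hp
      rw [hcon i]; exact h1' _ y hy hp
    · intro X hX hXp
      set h := ∑ i, t i • X i with hh
      set q' := qf (x + h) with hq'
      have e1 : ∑ i, t i * (⟪q', xi i + X i⟫ + Real.log (u (xi i + X i))) ≤ ∑ i, t i * ws q' :=
        Finset.sum_le_sum fun i _ => mul_le_mul_of_nonneg_left (h1' q' _ (hX i) (hXp i)) (ht i).le
      rw [← Finset.sum_mul, hs, one_mul] at e1
      have e2 : ∑ i, t i * (⟪qf x, xi i⟫ + Real.log (u (xi i))) = ws (qf x) := by
        rw [Finset.sum_congr rfl (fun i _ => by rw [hcon i]), ← Finset.sum_mul, hs, one_mul]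
      have e3 : ∑ i, t i * ⟪q', xi i + X i⟫ = ⟪q', x - ε • qf x + h⟫ := by
        rw [he, hh, ← Finset.sum_add_distrib, inner_sum]
        simp only [← smul_add, real_inner_smul_right]
      have e4 : ∑ i, t i * ⟪qf x, xi i⟫ = ⟪qf x, x - ε • qf x⟫ := by
        rw [he, inner_sum]; simp only [real_inner_smul_right]
      simp only [mul_add, mul_sub, Finset.sum_add_distrib, Finset.sum_sub_distrib] at e1 e2 ⊢
      rw [e3] at e1
      rw [e4] at e2
      have e5 : 0 ≤ ε / 2 * ‖q' - qf x‖ ^ 2 := by positivity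
      rw [@norm_sub_sq_real] at e5
      simp only [inner_sub_left, inner_sub_right, real_inner_smul_right, inner_add_right, real_inner_self_eq_norm_sq] at *
      linarith

theorem LegData.lip {K : Set E} {u : E → ℝ} {ε : ℝ} {V : E → ℝ} {qf : E → E}
    (H : LegData K u ε V qf) (hε : 0 < ε) : LipschitzWith (1 / ε).toNNReal qf := by
  refine LipschitzWith.of_dist_le_mul fun x y => ?_
  rw [dist_eq_norm, dist_eq_norm, Real.coe_toNNReal _ (by positivity)]
  have h1 := H.P1 x y
  have h2 := real_inner_le_norm (qf x - qf y) (x - y)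
  have h3 : ε * ‖qf x - qf y‖ ≤ ‖x - y‖ := by
    by_contra hno
    push Not at hno
    have : 0 < ‖qf x - qf y‖ := by
      by_contra h0
      have : ‖qf x - qf y‖ = 0 := le_antisymm (not_lt.1 h0) (norm_nonneg _)
      rw [this] at hno; linarith [norm_nonneg (x - y)]
    nlinarith
  rw [div_mul_eq_mul_div, one_mul, le_div_iff₀ hε]; linarith

theorem LegData.hasGradientAt [CompleteSpace E] {K : Set E} {u : E → ℝ} {ε : ℝ} {V : E → ℝ} {qf : E → E}
    (H : LegData K u ε V qf) (hε : 0 < ε) (x : E) : HasGradientAt V (qf x) x := by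
  rw [hasGradientAt_iff_isLittleO]
  have hb : ∀ y, |V y - V x - ⟪qf x, y - x⟫| ≤ (1 / ε) * (‖y - x‖ * ‖y - x‖) := by
    intro y
    have h1 := H.P2 x y
    have h2 := H.P2 y x
    rw [abs_of_nonneg (by linarith)]
    have h3 := (H.lip hε).dist_le_mul y x
    rw [dist_eq_norm, dist_eq_norm, Real.coe_toNNReal _ (by positivity)] at h3
    have h4 := real_inner_le_norm (qf y - qf x) (y - x)
    have h5 : ‖qf y - qf x‖ * ‖y - x‖ ≤ (1 / ε) * ‖y - x‖ * ‖y - x‖ :=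
      mul_le_mul_of_nonneg_right h3 (norm_nonneg _)
    simp only [inner_sub_left, inner_sub_right] at *
    linarith
  rw [Asymptotics.isLittleO_iff]
  intro c hc
  filter_upwards [Metric.ball_mem_nhds x (show 0 < c * ε by positivity)] with y hy
  rw [mem_ball, dist_eq_norm] at hy
  rw [Real.norm_eq_abs]
  refine (hb y).trans ?_
  rw [← mul_assoc]
  refine mul_le_mul_of_nonneg_right ?_ (norm_nonneg _)
  rw [div_mul_eq_mul_div, one_mul, div_le_iff₀ hε]; exact hy.le
end leg2


section L6a
variable {E : Type*} [NormedAddCommGroup E] [InnerProductSpace ℝ E]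

noncomputable def Gf (p lam : ℝ) (x P : E) : ℝ := (p - 1) * ‖P‖ ^ p + lam + ⟪aF p P, x⟫

theorem aF_ell {p : ℝ} (hp : 1 < p) {q : E} (hq : q ≠ 0) (v : E) :
    (‖q‖ ^ (p - 2) * min 1 (p - 1)) * ‖v‖ ^ 2 ≤ ⟪fderiv ℝ (aF p) q v, v⟫ := by
  rw [(hasFDerivAt_aF hq).fderiv]
  have h' : 0 < ‖q‖ := norm_pos_iff.2 hq
  simp only [add_apply, smul_apply, ContinuousLinearMap.smulRight_apply, innerSL_apply_apply,
    ContinuousLinearMap.id_apply, inner_add_left, real_inner_smul_left, smul_eq_mul, real_inner_self_eq_norm_sq]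
  have e : ‖q‖ ^ (p - 2) = ‖q‖ ^ (p - 4) * ‖q‖ ^ 2 := by
    rw [← Real.rpow_natCast, ← Real.rpow_add h']; congr 1; push_cast; ring
  have h0 : 0 < ‖q‖ ^ (p - 4) := by positivity
  have hcs : ⟪q, v⟫ ^ 2 ≤ ‖q‖ ^ 2 * ‖v‖ ^ 2 := by
    have := abs_real_inner_le_norm q v
    rw [← mul_pow, ← sq_abs]
    exact pow_le_pow_left₀ (abs_nonneg _) this 2
  rw [e]
  rcases le_total 2 p with h | h
  · rw [min_eq_left (by linarith)]
    have : 0 ≤ (p - 2) * (‖q‖ ^ (p - 4) * ⟪q, v⟫ ^ 2) := mul_nonneg (by linarith) (by positivity)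
    nlinarith
  · rw [min_eq_right (by linarith)]
    have := mul_nonneg (mul_nonneg (sub_nonneg.2 h) h0.le) (sub_nonneg.2 hcs)
    nlinarith

theorem contDiff_of_tsupp {F : Type*} [NormedAddCommGroup F] [NormedSpace ℝ F] {f : E → F}
    (h : ∀ x ∈ tsupport f, ContDiffAt ℝ 1 f x) : ContDiff ℝ 1 f := by
  rw [contDiff_iff_contDiffAt]
  intro x
  by_cases hx : x ∈ tsupport f
  · exact h x hx
  · exact (contDiffAt_const (c := (0:F))).congr_of_eventuallyEq (notMem_tsupport_iff_eventuallyEq.1 hx)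

theorem cutoff_C1 [FiniteDimensional ℝ E] {F : Type*} [NormedAddCommGroup F] [NormedSpace ℝ F] {f : E → F} {U : Set E}
    (hU : IsOpen U) {x0 : E} (hx0 : x0 ∈ U) (hf : ContDiffOn ℝ 1 f U) :
    ∃ g : E → F, ContDiff ℝ 1 g ∧ ∃ r > 0, ball x0 r ⊆ U ∧ ∀ x ∈ ball x0 r, g x = f x := by
  obtain ⟨R, hR, hRU⟩ := Metric.nhds_basis_closedBall.mem_iff.1 (hU.mem_nhds hx0)
  let χ : ContDiffBump x0 := ⟨R / 2, R, by positivity, by linarith⟩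
  refine ⟨fun x => χ x • f x, ?_, R / 2, by positivity, ?_, ?_⟩
  · refine contDiff_of_tsupp ?_
    intro x hx
    have h1 : x ∈ closedBall x0 R := by
      have : tsupport (fun x => χ x • f x) ⊆ tsupport χ := closure_mono (Function.support_smul_subset_left χ f)
      have h2 := this hx
      rwa [χ.tsupport_eq] at h2
    exact χ.contDiff.contDiffAt.smul (hf.contDiffAt (hU.mem_nhds (hRU h1)))
  · exact (ball_subset_ball (by linarith)).trans (ball_subset_closedBall.trans hRU)
  · intro x hx
    have : χ x = 1 := χ.one_of_mem_closedBall (ball_subset_closedBall hx)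
    simp [this]

variable [CompleteSpace E]

theorem hasFD_of_grad {V : E → ℝ} {q x : E} (h : HasGradientAt V q x) :
    HasFDerivAt V (innerSL ℝ q) x := h.hasFDerivAt

theorem leg_symm {V : E → ℝ} {qf : E → E} (hV : ∀ x, HasGradientAt V (qf x) x) {x : E}
    (hd : DifferentiableAt ℝ qf x) (v z : E) : ⟪fderiv ℝ qf x v, z⟫ = ⟪v, fderiv ℝ qf x z⟫ := by
  have h2 : HasFDerivAt (fun y => innerSL ℝ (qf y)) ((innerSL ℝ).comp (fderiv ℝ qf x)) x :=
    (innerSL ℝ : E →L[ℝ] E →L[ℝ] ℝ).hasFDerivAt.comp x hd.hasFDerivAt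
  have h1 : ∀ y, HasFDerivAt V ((fun y => innerSL ℝ (qf y)) y) y := fun y => hasFD_of_grad (hV y)
  have := second_derivative_symmetric h1 h2 v z
  simp only [ContinuousLinearMap.comp_apply, innerSL_apply_apply] at this
  rw [this, real_inner_comm]

theorem leg_psd {qf : E → E} (hm : ∀ x y, 0 ≤ ⟪qf x - qf y, x - y⟫) {x : E}
    (hd : DifferentiableAt ℝ qf x) (v : E) : 0 ≤ ⟪fderiv ℝ qf x v, v⟫ := by
  have h1 : HasDerivAt (fun s : ℝ => qf (x + s • v)) (fderiv ℝ qf x v) 0 := by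
    have : HasDerivAt (fun s : ℝ => x + s • v) v 0 := by
      simpa using ((hasDerivAt_id (0:ℝ)).smul_const v).const_add x
    refine HasFDerivAt.comp_hasDerivAt (0:ℝ) ?_ this
    simpa using hd.hasFDerivAt
  have h2 : HasDerivAt (fun s : ℝ => ⟪qf (x + s • v), v⟫) ⟪fderiv ℝ qf x v, v⟫ 0 := by
    simpa using h1.inner ℝ (hasDerivAt_const (0:ℝ) v)
  have h3 : Monotone (fun s : ℝ => ⟪qf (x + s • v), v⟫) := by
    intro a b hab
    rcases hab.eq_or_lt with rfl | hlt
    · exact le_rfl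
    have := hm (x + b • v) (x + a • v)
    rw [add_sub_add_left_eq_sub, ← sub_smul, real_inner_smul_right, inner_sub_left] at this
    have := nonneg_of_mul_nonneg_right this (sub_pos.2 hlt)
    simp only []; linarith
  exact h2.deriv ▸ h3.deriv_nonneg

theorem leg_taylor {V : E → ℝ} {qf : E → E} (hV : ∀ x, HasGradientAt V (qf x) x) {x : E}
    (hd : DifferentiableAt ℝ qf x) {κ : ℝ} (hκ : 0 < κ) : ∃ r > 0, ∀ h : E, ‖h‖ < r →
      V x + ⟪qf x, h⟫ + 1 / 2 * ⟪fderiv ℝ qf x h, h⟫ - κ * ‖h‖ ^ 2 ≤ V (x + h) := by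
  set B := fderiv ℝ qf x
  have h1 := hd.hasFDerivAt.isLittleO.def hκ
  obtain ⟨r, hr, hb⟩ := Metric.eventually_nhds_iff_ball.1 h1
  refine ⟨r, hr, fun h hh => ?_⟩
  set g : ℝ → ℝ := fun s => V (x + s • h) - s * ⟪qf x, h⟫ - s ^ 2 / 2 * ⟪B h, h⟫ with hg
  have hgd : ∀ s, HasDerivAt g (⟪qf (x + s • h), h⟫ - ⟪qf x, h⟫ - s * ⟪B h, h⟫) s := by
    intro s
    have e1 : HasDerivAt (fun s : ℝ => x + s • h) h s := by
      simpa using ((hasDerivAt_id s).smul_const h).const_add x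
    have e2 : HasDerivAt (fun s : ℝ => V (x + s • h)) ⟪qf (x + s • h), h⟫ s := by
      exact (hasFD_of_grad (hV (x + s • h))).comp_hasDerivAt s e1
    have e3 : HasDerivAt (fun s : ℝ => s * ⟪qf x, h⟫) ⟪qf x, h⟫ s := by
      simpa using (hasDerivAt_id s).mul_const ⟪qf x, h⟫
    have e4 : HasDerivAt (fun s : ℝ => s ^ 2 / 2 * ⟪B h, h⟫) (s * ⟪B h, h⟫) s := by
      have := (((hasDerivAt_id s).pow 2).div_const 2).mul_const ⟪B h, h⟫
      simpa using this
    exact (e2.sub e3).sub e4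
  obtain ⟨c, hc, hcs⟩ := exists_hasDerivAt_eq_slope g _ (zero_lt_one) 
    (fun s _ => (hgd s).continuousAt.continuousWithinAt) (fun s _ => hgd s)
  have h2 := hb (x + c • h) (by
    rw [mem_ball, dist_eq_norm, add_sub_cancel_left, norm_smul, Real.norm_of_nonneg hc.1.le]
    nlinarith [norm_nonneg h, hc.2])
  rw [add_sub_cancel_left, norm_smul, Real.norm_of_nonneg hc.1.le, map_smul] at h2
  have h3 := abs_le.1 (abs_real_inner_le_norm (qf (x + c • h) - qf x - c • B h) h)
  have h4 : ‖qf (x + c • h) - qf x - c • B h‖ * ‖h‖ ≤ κ * ‖h‖ ^ 2 := by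
    have := mul_le_mul_of_nonneg_right h2 (norm_nonneg h)
    have h5 : κ * (c * ‖h‖) * ‖h‖ = c * (κ * ‖h‖ ^ 2) := by ring
    have h6 : c * (κ * ‖h‖ ^ 2) ≤ 1 * (κ * ‖h‖ ^ 2) := mul_le_mul_of_nonneg_right hc.2.le (by positivity)
    linarith
  rw [inner_sub_left, inner_sub_left, real_inner_smul_left] at h3
  simp only [hg] at hcs
  simp at hcs
  linarith [h3.1]

end L6a


section L6b
variable {E : Type*} [NormedAddCommGroup E] [InnerProductSpace ℝ E] [FiniteDimensional ℝ E]
  [MeasurableSpace E] [BorelSpace E]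

def WeakW (p lam : ℝ) (Ω : Set E) (w : E → ℝ) : Prop :=
  ∀ φ : E → ℝ, ContDiff ℝ 1 φ → HasCompactSupport φ → tsupport φ ⊆ Ω →
    ∫ x in Ω, fderiv ℝ φ x (aF p (gradient w x)) = -∫ x in Ω, Gf p lam x (gradient w x) * φ x

theorem gradient_congr {f g : E → ℝ} {x : E} (h : f =ᶠ[𝓝 x] g) : gradient f x = gradient g x := by
  unfold gradient; rw [h.fderiv_eq]

theorem gradient_shift (f : E → ℝ) (a h : E) :
    gradient (fun z => f (a + z)) h = gradient f (a + h) := by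
  unfold gradient; rw [fderiv_comp_add_left]

/-- localized problem at one contact point -/
theorem contact_local {p lam : ℝ} (hp : 1 < p) {Ω : Set E} (hΩ : IsOpen Ω) {w : E → ℝ}
    (hw : ContDiffOn ℝ 1 w Ω) (hweq : WeakW p lam Ω w) {q : E} {a : E → E}
    {s : ℝ} (hs : 0 < s) (ha : ∀ P ∈ ball q s, a P = aF p P) {x0 : E} (hx0 : x0 ∈ Ω)
    (hq : gradient w x0 = q) :
    ∃ (W : E → ℝ), ContDiff ℝ 1 W ∧ gradient W 0 = q ∧ ∃ r > 0, (∀ h ∈ ball (0:E) r, x0 + h ∈ Ω ∧ W h = w (x0 + h)) ∧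
      ∀ φ : E → ℝ, ContDiff ℝ 1 φ → HasCompactSupport φ → tsupport φ ⊆ ball 0 r →
      ∫ x, fderiv ℝ φ x (a (gradient W x)) = - ∫ x, Gf p lam (x0 + x) (gradient W x) * φ x := by
  have hsh : ContDiffOn ℝ 1 (fun h => w (x0 + h)) ((fun h => x0 + h) ⁻¹' Ω) :=
    hw.comp (by fun_prop) (fun h hh => hh)
  obtain ⟨W, hW, r, hr, hrU, hWe⟩ := cutoff_C1 (x0 := (0:E)) (hΩ.preimage (by fun_prop : Continuous (fun h : E => x0 + h)))
    (by simpa using hx0) hsh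
  have hgr : ∀ h ∈ ball (0:E) r, gradient W h = gradient w (x0 + h) := by
    intro h hh
    rw [← gradient_shift]
    refine gradient_congr ?_
    filter_upwards [isOpen_ball.mem_nhds hh] with z hz using hWe z hz
  have hgc : Continuous (gradient W) := by
    have := hW.continuous_fderiv (by norm_num)
    unfold gradient
    fun_prop
  have hg0 : gradient W 0 = q := by rw [hgr 0 (mem_ball_self hr), add_zero, hq]
  have hnear : ∀ᶠ h in 𝓝 (0:E), gradient W h ∈ ball q s := by
    refine hgc.continuousAt.eventually (isOpen_ball.mem_nhds ?_)
    rw [hg0]; exact mem_ball_self hs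
  obtain ⟨r2, hr2, hb2⟩ := Metric.eventually_nhds_iff_ball.1 hnear
  refine ⟨W, hW, hg0, min r r2, lt_min hr hr2, ?_, ?_⟩
  · intro h hh
    have hh' := ball_subset_ball (min_le_left _ _) hh
    exact ⟨hrU hh', hWe h hh'⟩
  · intro φ hφ hc hsup
    set φ' : E → ℝ := fun y => φ (y - x0) with hφ'
    have hts : ∀ y, y ∈ tsupport φ' → y - x0 ∈ tsupport φ := by
      intro y hy
      have : φ' = φ ∘ (Homeomorph.addRight (-x0)) := by ext y; simp [hφ', sub_eq_add_neg]
      rw [this, tsupport_comp_eq_preimage] at hy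
      simpa [sub_eq_add_neg] using hy
    have hc' : HasCompactSupport φ' := by
      have : φ' = φ ∘ (Homeomorph.addRight (-x0)) := by ext y; simp [hφ', sub_eq_add_neg]
      rw [this]; exact hc.comp_homeomorph _
    have hsup' : tsupport φ' ⊆ Ω := by
      intro y hy
      have := hrU (ball_subset_ball (min_le_left _ _) (hsup (hts y hy)))
      simpa using this
    have key := hweq φ' (hφ.comp (by fun_prop)) hc' hsup'
    have hzero : ∀ y, y ∉ Ω → φ' y = 0 ∧ fderiv ℝ φ' y = 0 := by
      intro y hy
      have hn : y ∉ tsupport φ' := fun h => hy (hsup' h)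
      refine ⟨image_eq_zero_of_notMem_tsupport hn, ?_⟩
      have := tsupport_fderiv_subset ℝ (f := φ')
      exact image_eq_zero_of_notMem_tsupport (fun h => hn (this h))
    rw [setIntegral_eq_integral_of_forall_compl_eq_zero (fun y hy => by rw [(hzero y hy).2]; simp),
      setIntegral_eq_integral_of_forall_compl_eq_zero (fun y hy => by rw [(hzero y hy).1]; simp),
      ← integral_add_left_eq_self _ x0, ← integral_add_left_eq_self (fun x => _ * φ' x) x0] at key
    rw [show (∫ x, fderiv ℝ φ x (a (gradient W x))) = _ from integral_congr_ae (Filter.Eventually.of_forall (fun h => ?_)), key]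
    swap
    · simp only []
      have e1 : fderiv ℝ φ' (x0 + h) = fderiv ℝ φ h := by
        rw [hφ', fderiv_comp_sub]; simp
      rw [e1]
      by_cases hh : h ∈ tsupport φ
      · have hb := hsup hh
        have h1 := ball_subset_ball (min_le_left _ _) hb
        have h2 := ball_subset_ball (min_le_right _ _) hb
        rw [ha _ (hb2 h h2), hgr h h1]
      · have : fderiv ℝ φ h = 0 :=
          image_eq_zero_of_notMem_tsupport (fun h' => hh (tsupport_fderiv_subset ℝ (f := φ) h'))
        simp [this]
    · congr 1
      refine integral_congr_ae (Filter.Eventually.of_forall (fun h => ?_))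
      simp only []
      have e1 : φ' (x0 + h) = φ h := by simp [hφ']
      rw [e1]
      by_cases hh : h ∈ tsupport φ
      · have h1 := ball_subset_ball (min_le_left _ _) (hsup hh)
        rw [hgr h h1]
      · rw [image_eq_zero_of_notMem_tsupport hh]; simp

theorem L6main {p lam : ℝ} (hp : 1 < p) {Ω K : Set E} (hΩ : IsOpen Ω) (hΩK : Ω ⊆ K) {u : E → ℝ}
    (hu : ContDiffOn ℝ 1 u Ω) (hupos : ∀ x ∈ Ω, 0 < u x) (hKpos : ∀ x ∈ K, 0 < u x → x ∈ Ω)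
    (hweq : WeakW p lam Ω (fun x => -Real.log (u x))) {ε : ℝ} (hε : 0 < ε) {V : E → ℝ} {qf : E → E}
    (H : LegData K u ε V qf) {x : E} (hd : DifferentiableAt ℝ qf x) (hq0 : qf x ≠ 0) :
    trc ((fderiv ℝ (aF p) (qf x)).comp (fderiv ℝ qf x)) ≤ Gf p lam x (qf x) := by
  set q := qf x with hq
  set w : E → ℝ := fun x => -Real.log (u x) with hwdef
  have hw : ContDiffOn ℝ 1 w Ω := (hu.log (fun y hy => (hupos y hy).ne')).neg
  obtain ⟨m, t, xi, ht, hs, hk, hup, he, hmax, hV⟩ := H.P5 x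
  have hxi : ∀ i, xi i ∈ Ω := fun i => hKpos _ (hk i) (hup i)
  have hgrad : ∀ i, gradient w (xi i) = q := by
    intro i
    have hdw : HasFDerivAt w (fderiv ℝ w (xi i)) (xi i) :=
      ((hw.contDiffAt (hΩ.mem_nhds (hxi i))).differentiableAt (by norm_num)).hasFDerivAt
    have hloc : IsLocalMax (fun y => ⟪q, y⟫ - w y) (xi i) := by
      filter_upwards [hΩ.mem_nhds (hxi i)] with y hy
      have := hmax i y (hΩK hy) (hupos y hy)
      simp only [hwdef, sub_neg_eq_add]; exact this
    have h1 : HasFDerivAt (fun y => ⟪q, y⟫ - w y) (innerSL ℝ q - fderiv ℝ w (xi i)) (xi i) :=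
      (innerSL ℝ q).hasFDerivAt.sub hdw
    have h2 := hloc.hasFDerivAt_eq_zero h1
    have h3 : fderiv ℝ w (xi i) = innerSL ℝ q := (sub_eq_zero.1 h2).symm
    unfold gradient
    rw [h3]
    exact (InnerProductSpace.toDual ℝ E).symm_apply_apply q
  obtain ⟨a, ha, s, hs0, -, hae⟩ := cutoff_C1 (F := E) (U := {0}ᶜ) isOpen_compl_singleton
    (x0 := q) (by simpa using hq0) (f := aF p)
    (fun P hP => (contDiffAt_aF (by simpa using hP)).contDiffWithinAt)
  choose W hW hW0 r hr hWe heqn using fun i => contact_local hp hΩ hw hweq hs0 hae (hxi i) (hgrad i)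
  obtain ⟨r0, hr0, hr0i⟩ : ∃ r0 > 0, ∀ i, r0 ≤ r i := by
    refine ⟨Finset.univ.inf' Finset.univ_nonempty r, ?_, fun i => Finset.inf'_le _ (Finset.mem_univ i)⟩
    rw [gt_iff_lt, Finset.lt_inf'_iff]; exact fun i _ => hr i
  have hfd : fderiv ℝ a q = fderiv ℝ (aF p) q := by
    refine Filter.EventuallyEq.fderiv_eq ?_
    filter_upwards [ball_mem_nhds q hs0] with P hP using hae P hP
  have hgc : ∀ i, Continuous (gradient (W i)) := fun i => by
    have := (hW i).continuous_fderiv (by norm_num)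
    unfold gradient
    fun_prop
  have hVg := H.hasGradientAt hε
  have main := doubling ht hs hW hW0 ha (ℓ := ‖q‖ ^ (p - 2) * min 1 (p - 1))
    (by have := norm_pos_iff.2 hq0
        have h2 : 0 < min 1 (p - 1) := lt_min one_pos (by linarith)
        positivity)
    (by rw [hfd]; exact aF_ell hp hq0) (B := fderiv ℝ qf x) (leg_symm hVg hd)
    (G := fun i h => Gf p lam (xi i + h) (gradient (W i) h))
    (by
      intro i
      have := (continuous_aF hp (E := E)).comp (hgc i)
      have h2 : Continuous fun h => ‖gradient (W i) h‖ ^ p :=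
        (hgc i).norm.rpow_const (fun _ => Or.inr (by linarith))
      unfold Gf
      refine ((continuous_const.mul h2).add continuous_const).add (this.inner (by fun_prop)))
    hr0 (fun i φ h1 h2 h3 => heqn i φ h1 h2 (h3.trans (ball_subset_ball (hr0i i))))
    (by
      intro κ hκ
      obtain ⟨r1, hr1, hT⟩ := leg_taylor hVg hd hκ
      refine ⟨min r0 r1, lt_min hr0 hr1, fun X hX => ?_⟩
      have hXm : ∀ i, X i ∈ ball (0:E) (r i) := fun i => by
        rw [mem_ball_zero_iff]; exact (hX i).trans_le ((min_le_left _ _).trans (hr0i i))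
      have hsm : ‖∑ i, t i • X i‖ < r1 := by
        calc ‖∑ i, t i • X i‖ ≤ ∑ i, ‖t i • X i‖ := norm_sum_le _ _
          _ < ∑ i, t i * r1 := by
            refine Finset.sum_lt_sum_of_nonempty Finset.univ_nonempty fun i _ => ?_
            rw [norm_smul, Real.norm_of_nonneg (ht i).le]
            exact mul_lt_mul_of_pos_left ((hX i).trans_le (min_le_right _ _)) (ht i)
          _ = r1 := by rw [← Finset.sum_mul, hs, one_mul]
      have e1 := hT _ hsm
      have e2 := hV X (fun i => hΩK (hWe i _ (hXm i)).1) (fun i => hupos _ (hWe i _ (hXm i)).1)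
      have e3 : ∑ i, t i * W i (X i) - ∑ i, t i * W i 0 =
          ∑ i, t i * (Real.log (u (xi i)) - Real.log (u (xi i + X i))) := by
        rw [← Finset.sum_sub_distrib]
        refine Finset.sum_congr rfl fun i _ => ?_
        rw [(hWe i _ (hXm i)).2, (hWe i 0 (mem_ball_self (hr i))).2]
        simp only [hwdef, add_zero]; ring
      linarith)
  rw [hfd] at main
  refine main.trans ?_
  simp only [hW0, add_zero, Gf]
  have e5 : ∑ i, t i * ⟪aF p q, xi i⟫ = ⟪aF p q, x - ε • q⟫ := by
    rw [he, inner_sum]; simp only [real_inner_smul_right]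
  simp only [mul_add _ (_ + _), Finset.sum_add_distrib, ← Finset.sum_mul, hs, one_mul]
  rw [e5, inner_sub_right, real_inner_smul_right, inner_aF_self hp]
  have : 0 ≤ ε * ‖q‖ ^ p := by positivity
  linarith
end L6b


section L7a
variable {E : Type*} [NormedAddCommGroup E] [InnerProductSpace ℝ E] [FiniteDimensional ℝ E]

noncomputable def bd (p δ : ℝ) (P : E) : E := (‖P‖ ^ 4 / (‖P‖ ^ 4 + δ)) • aF p P

theorem bd_eq {p δ : ℝ} (hp : 1 < p) (P : E) :
    bd p δ P = (‖P‖ ^ (p + 2) / ((‖P‖ ^ 2) ^ 2 + δ)) • P := by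
  by_cases h : P = 0
  · subst h; simp [bd, aF_zero]
  · have h' : 0 < ‖P‖ := norm_pos_iff.2 h
    rw [bd, aF, smul_smul]
    congr 1
    have : ‖P‖ ^ (p + 2) = ‖P‖ ^ 4 * ‖P‖ ^ (p - 2) := by
      rw [← Real.rpow_natCast, ← Real.rpow_add h']; congr 1; push_cast; ring
    rw [this]; ring

theorem bd_scal_C1 {p δ : ℝ} (hp : 1 < p) (hδ : 0 < δ) :
    ContDiff ℝ 1 (fun P : E => ‖P‖ ^ (p + 2) / ((‖P‖ ^ 2) ^ 2 + δ)) := by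
  refine (contDiff_norm_rpow (by linarith)).div (((contDiff_norm_sq ℝ).pow 2).add contDiff_const) ?_
  intro P; positivity

theorem bd_C1 {p δ : ℝ} (hp : 1 < p) (hδ : 0 < δ) : ContDiff ℝ 1 (bd p δ : E → E) := by
  have : (bd p δ : E → E) = fun P => (‖P‖ ^ (p + 2) / ((‖P‖ ^ 2) ^ 2 + δ)) • P := by
    ext1 P; exact bd_eq hp P
  rw [this]
  exact (bd_scal_C1 hp hδ).smul contDiff_id

theorem bd_fderiv_zero {p δ : ℝ} (hp : 1 < p) (hδ : 0 < δ) : fderiv ℝ (bd p δ : E → E) 0 = 0 := by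
  have : (bd p δ : E → E) = fun P => (‖P‖ ^ (p + 2) / ((‖P‖ ^ 2) ^ 2 + δ)) • P := by
    ext1 P; exact bd_eq hp P
  rw [this]
  have h1 := (((bd_scal_C1 hp hδ (E := E)).differentiable (by norm_num)) 0).hasFDerivAt.smul (hasFDerivAt_id (0:E))
  have := h1.fderiv
  have h0 : (0:ℝ) ^ (p + 2) = 0 := Real.zero_rpow (by linarith)
  simp only [id] at this
  refine Eq.trans this ?_
  ext v
  simp [h0]

theorem bd_hasFDerivAt {p δ : ℝ} (hδ : 0 < δ) {q : E} (hq : q ≠ 0) :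
    HasFDerivAt (bd p δ : E → E) ((‖q‖ ^ 4 / (‖q‖ ^ 4 + δ)) • fderiv ℝ (aF p) q +
      ((4 * ‖q‖ ^ 2 * δ / (‖q‖ ^ 4 + δ) ^ 2) • innerSL ℝ q).smulRight (aF p q)) q := by
  have h1 : HasFDerivAt (fun x : E => ‖x‖ ^ 2) (2 • innerSL ℝ q) q := by
    exact (hasStrictFDerivAt_norm_sq q).hasFDerivAt
  have hg : HasDerivAt (fun s : ℝ => s ^ 2 / (s ^ 2 + δ)) (2 * ‖q‖ ^ 2 * δ / (‖q‖ ^ 4 + δ) ^ 2) (‖q‖ ^ 2) := by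
    have a1 : HasDerivAt (fun s : ℝ => s ^ 2) (2 * ‖q‖ ^ 2) (‖q‖ ^ 2) := by
      simpa using hasDerivAt_pow 2 (‖q‖ ^ 2)
    have := a1.div (a1.add_const δ) (by positivity)
    have e : (2 * ‖q‖ ^ 2 * δ / (‖q‖ ^ 4 + δ) ^ 2) = (2 * ‖q‖ ^ 2 * ((‖q‖ ^ 2) ^ 2 + δ) - (‖q‖ ^ 2) ^ 2 * (2 * ‖q‖ ^ 2)) / ((‖q‖ ^ 2) ^ 2 + δ) ^ 2 := by
      rw [show (‖q‖ ^ 2) ^ 2 = ‖q‖ ^ 4 by ring]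
      congr 1; ring
    rw [e]; exact this
  have h2 : HasFDerivAt (fun x : E => ‖x‖ ^ 4 / (‖x‖ ^ 4 + δ))
      ((4 * ‖q‖ ^ 2 * δ / (‖q‖ ^ 4 + δ) ^ 2) • innerSL ℝ q) q := by
    have := hg.comp_hasFDerivAt q h1
    have e1 : (fun x : E => ‖x‖ ^ 4 / (‖x‖ ^ 4 + δ)) = (fun s : ℝ => s ^ 2 / (s ^ 2 + δ)) ∘ fun x : E => ‖x‖ ^ 2 := by
      ext x; simp only [Function.comp]; rw [show (‖x‖ ^ 2) ^ 2 = ‖x‖ ^ 4 by ring]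
    have e2 : (4 * ‖q‖ ^ 2 * δ / (‖q‖ ^ 4 + δ) ^ 2) • (innerSL ℝ) q = (2 * ‖q‖ ^ 2 * δ / (‖q‖ ^ 4 + δ) ^ 2) • 2 • (innerSL ℝ) q := by
      ext v; simp; ring
    rw [e1, e2]; exact this
  have h3 := h2.smul ((contDiffAt_aF (p := p) hq).differentiableAt (by norm_num)).hasFDerivAt
  exact h3

theorem trc_smulRight (L : E →L[ℝ] ℝ) (z : E) : trc (L.smulRight z) = L z := by
  rw [trc_eq_sum (stdOrthonormalBasis ℝ E)]
  conv_rhs => rw [← (stdOrthonormalBasis ℝ E).sum_repr' z]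
  simp [map_sum, real_inner_smul_right, mul_comm]

theorem trc_ge {B : E →L[ℝ] E} (hB : ∀ v, 0 ≤ ⟪B v, v⟫) (q : E) :
    ⟪q, B q⟫ ≤ ‖q‖ ^ 2 * trc B := by
  by_cases h : q = 0
  · subst h; simp
  have h' : 0 < ‖q‖ := norm_pos_iff.2 h
  set e : E := ‖q‖⁻¹ • q with he
  have hen : ‖e‖ = 1 := by rw [he, norm_smul, norm_inv, norm_norm, inv_mul_cancel₀ h'.ne']
  have hqe : q = ‖q‖ • e := by rw [he, smul_smul, mul_inv_cancel₀ h'.ne', one_smul]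
  have ho : Orthonormal ℝ ((↑) : ({e} : Set E) → E) := by
    refine ⟨?_, ?_⟩
    · rintro ⟨v, hv⟩; rw [mem_singleton_iff] at hv; subst hv; exact hen
    · rintro ⟨v, hv⟩ ⟨v', hv'⟩ hne
      rw [mem_singleton_iff] at hv hv'; subst hv; exact absurd (Subtype.ext hv'.symm) hne
  obtain ⟨U, b, hU, hb⟩ := ho.exists_orthonormalBasis_extension
  have heU : e ∈ U := by have := hU (mem_singleton e); simpa using this
  have h1 : ⟪e, B e⟫ ≤ trc B := by
    rw [trc_eq_sum b]
    have := Finset.single_le_sum (s := Finset.univ) (f := fun k => ⟪b k, B (b k)⟫)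
      (fun k _ => by rw [real_inner_comm]; exact hB _) (Finset.mem_univ (⟨e, heU⟩ : U))
    simpa [hb] using this
  have h2 : ⟪q, B q⟫ = ‖q‖ ^ 2 * ⟪e, B e⟫ := by
    conv_lhs => rw [hqe]
    rw [map_smul, real_inner_smul_left, real_inner_smul_right]; ring
  rw [h2]
  exact mul_le_mul_of_nonneg_left h1 (by positivity)

/-- error factor -/
noncomputable def erF (p δ : ℝ) (q : E) : ℝ := 4 * ‖q‖ ^ 4 * δ / (‖q‖ ^ 4 + δ) ^ 2 / (p - 1)

theorem bd_trace {p δ : ℝ} (hp : 1 < p) (hδ : 0 < δ) {q : E} {B : E →L[ℝ] E}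
    (hB : ∀ v, 0 ≤ ⟪B v, v⟫) {G : ℝ} (hG : q ≠ 0 → trc ((fderiv ℝ (aF p) q).comp B) ≤ G)
    (hG0 : q = 0 → 0 ≤ G) :
    trc ((fderiv ℝ (bd p δ) q).comp B) ≤ (1 + erF p δ q) * G ∧ 0 ≤ G := by
  by_cases hq : q = 0
  · refine ⟨?_, hG0 hq⟩
    subst hq
    rw [bd_fderiv_zero hp hδ]
    simp [erF, trc, hG0 rfl]
  have h' : 0 < ‖q‖ := norm_pos_iff.2 hq
  set T := trc ((fderiv ℝ (aF p) q).comp B) with hT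
  set T2 := ⟪q, B q⟫ with hT2
  have hT20 : 0 ≤ T2 := by rw [hT2, real_inner_comm]; exact hB q
  have eT : T = ‖q‖ ^ (p - 2) * trc B + (p - 2) * ‖q‖ ^ (p - 4) * T2 := by
    rw [hT, (hasFDerivAt_aF hq).fderiv, ContinuousLinearMap.add_comp, trc_add,
      ContinuousLinearMap.smul_comp, trc_smul, ContinuousLinearMap.id_comp]
    congr 1
    have : ((((p - 2) * ‖q‖ ^ (p - 4)) • innerSL ℝ q).smulRight q).comp B =
        ((((p - 2) * ‖q‖ ^ (p - 4)) • innerSL ℝ q).comp B).smulRight q := by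
      ext v; simp
    rw [this, trc_smulRight]; simp [hT2]
  have e : ‖q‖ ^ (p - 2) = ‖q‖ ^ (p - 4) * ‖q‖ ^ 2 := by
    rw [← Real.rpow_natCast, ← Real.rpow_add h']; congr 1; push_cast; ring
  have h0 : 0 < ‖q‖ ^ (p - 4) := by positivity
  have hge := trc_ge hB q
  have hTge : (p - 1) * ‖q‖ ^ (p - 4) * T2 ≤ T := by
    rw [eT, e]
    have := mul_le_mul_of_nonneg_left hge h0.le
    nlinarith
  have hT0 : 0 ≤ T := le_trans (mul_nonneg (mul_nonneg (by linarith) h0.le) hT20) hTge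
  have hTG := hG hq
  have hG1 : 0 ≤ G := hT0.trans hTG
  refine ⟨?_, hG1⟩
  rw [(bd_hasFDerivAt hδ hq).fderiv, ContinuousLinearMap.add_comp, trc_add,
      ContinuousLinearMap.smul_comp, trc_smul]
  set c := 4 * ‖q‖ ^ 2 * δ / (‖q‖ ^ 4 + δ) ^ 2 with hc
  have hc0 : 0 ≤ c := by positivity
  have : ((c • innerSL ℝ q).smulRight (aF p q)).comp B =
        ((c • innerSL ℝ q).comp B).smulRight (aF p q) := by
      ext v; simp
  rw [this, trc_smulRight]
  have e2 : ((c • innerSL ℝ q).comp B) (aF p q) = c * (‖q‖ ^ (p - 2) * T2) := by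
    simp [aF, hT2, real_inner_smul_right]; ring
  rw [e2, ← hT, e]
  have e3 : erF p δ q = c * ‖q‖ ^ 2 / (p - 1) := by rw [erF, hc]; ring
  have hth : ‖q‖ ^ 4 / (‖q‖ ^ 4 + δ) ≤ 1 := by rw [div_le_one (by positivity)]; linarith
  have e4 : ‖q‖ ^ (p - 4) * T2 ≤ G / (p - 1) := by
    rw [le_div_iff₀ (by linarith)]; linarith
  have e5 : c * ‖q‖ ^ 2 * (‖q‖ ^ (p - 4) * T2) ≤ c * ‖q‖ ^ 2 * (G / (p - 1)) :=
    mul_le_mul_of_nonneg_left e4 (by positivity)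
  have e6 : ‖q‖ ^ 4 / (‖q‖ ^ 4 + δ) * T ≤ 1 * G := mul_le_mul hth hTG hT0 (by norm_num)
  rw [e3]
  calc _ ≤ 1 * G + c * ‖q‖ ^ 2 * (G / (p - 1)) := by nlinarith
    _ = _ := by ring

variable [MeasurableSpace E] [BorelSpace E]

theorem lip_ibp {A : E → E} {C : ℝ≥0} (hA : LipschitzWith C A) {φ : E → ℝ} (hφ : ContDiff ℝ 1 φ)
    (hc : HasCompactSupport φ) :
    Integrable (fun x => trc (fderiv ℝ A x) * φ x) ∧
    ∫ x, fderiv ℝ φ x (A x) = - ∫ x, trc (fderiv ℝ A x) * φ x := by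
  set b := stdOrthonormalBasis ℝ E
  have hφ' : Continuous (fderiv ℝ φ) := hφ.continuous_fderiv (by norm_num)
  have hc' : HasCompactSupport (fderiv ℝ φ) := hc.fderiv ℝ
  have e1 : ∀ x, fderiv ℝ φ x (A x) = ∑ k, ⟪b k, A x⟫ * fderiv ℝ φ x (b k) := by
    intro x
    conv_lhs => rw [← b.sum_repr' (A x)]
    simp [map_sum]
  have e2 : ∀ x, trc (fderiv ℝ A x) * φ x = ∑ k, ⟪b k, fderiv ℝ A x (b k)⟫ * φ x := by
    intro x; rw [trc_eq_sum b, Finset.sum_mul]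
  have c2 : ∀ k, HasCompactSupport fun x => fderiv ℝ φ x (b k) := fun k =>
    hc'.comp_left (g := fun L : E →L[ℝ] ℝ => L (b k)) (by simp)
  have i1 : ∀ k, Integrable (fun x => ⟪b k, A x⟫ * fderiv ℝ φ x (b k)) := fun k => by
    refine Continuous.integrable_of_hasCompactSupport ?_ (HasCompactSupport.mul_left (c2 k))
    have := hA.continuous
    fun_prop
  have i2 : ∀ k, Integrable (fun x => ⟪b k, fderiv ℝ A x (b k)⟫ * φ x) := fun k => by
    have hφi : Integrable φ := hφ.continuous.integrable_of_hasCompactSupport hc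
    refine hφi.bdd_mul (c := C) ?_ ?_
    · have : Measurable fun x => fderiv ℝ A x (b k) := measurable_fderiv_apply_const ℝ A (b k)
      exact (this.const_inner).aestronglyMeasurable
    · refine Filter.Eventually.of_forall fun x => ?_
      have h1 := norm_inner_le_norm (𝕜 := ℝ) (b k) (fderiv ℝ A x (b k))
      have h2 := (fderiv ℝ A x).le_opNorm (b k)
      have h3 := norm_fderiv_le_of_lipschitz ℝ hA (x₀ := x)
      have h4 : ‖b k‖ = 1 := b.orthonormal.1 k
      rw [h4] at h1 h2
      linarith
  simp_rw [e1, e2]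
  refine ⟨integrable_finsetSum _ fun k _ => i2 k, ?_⟩
  rw [integral_finsetSum _ (fun k _ => i1 k), integral_finsetSum _ (fun k _ => i2 k),
    ← Finset.sum_neg_distrib]
  refine Finset.sum_congr rfl fun k _ => ?_
  have hd : ∀ᵐ x : E, lineDeriv ℝ (fun x => ⟪b k, A x⟫) x (b k) = ⟪b k, fderiv ℝ A x (b k)⟫ := by
    filter_upwards [hA.ae_differentiableAt] with x hx
    have h1 : HasFDerivAt (fun x => ⟪b k, A x⟫) ((innerSL ℝ (b k)).comp (fderiv ℝ A x)) x :=
      (innerSL ℝ (b k)).hasFDerivAt.comp x hx.hasFDerivAt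
    rw [(h1.hasLineDerivAt (b k)).lineDeriv]; rfl
  obtain ⟨D, hD⟩ := hφ.lipschitzWith_of_hasCompactSupport hc (by norm_num)
  have hL : LipschitzWith C (fun x => ⟪b k, A x⟫) := by
    have := (innerSL ℝ (b k)).lipschitz.comp hA
    refine this.weaken ?_
    have : ‖innerSL ℝ (b k)‖₊ = 1 := by
      ext; simp [b.orthonormal.1 k]
    rw [this, one_mul]
  have key := hL.integral_lineDeriv_mul_eq (μ := (volume : Measure E)) hD hc (b k)
  have k1 : ∫ x, lineDeriv ℝ (fun x => ⟪b k, A x⟫) x (b k) * φ x = ∫ x, ⟪b k, fderiv ℝ A x (b k)⟫ * φ x := by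
    refine integral_congr_ae ?_
    filter_upwards [hd] with x hx
    simp only [hx]
  have k2 : ∫ x, lineDeriv ℝ φ x (-(b k)) * ⟪b k, A x⟫ = - ∫ x, ⟪b k, A x⟫ * fderiv ℝ φ x (b k) := by
    rw [← integral_neg]
    refine integral_congr_ae (Filter.Eventually.of_forall fun x => ?_)
    simp only []
    rw [((hφ.differentiable (by norm_num)) x).lineDeriv_eq_fderiv, map_neg]; ring
  rw [k1, k2] at key
  rw [key, neg_neg]
end L7a


section L7b
variable {E : Type*} [NormedAddCommGroup E] [InnerProductSpace ℝ E] [FiniteDimensional ℝ E]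

theorem erF_nonneg {p δ : ℝ} (hp : 1 < p) (hδ : 0 < δ) (q : E) : 0 ≤ erF p δ q := by
  have : 0 < p - 1 := by linarith
  unfold erF; positivity

theorem erF_le {p δ : ℝ} (hp : 1 < p) (hδ : 0 < δ) (q : E) : erF p δ q ≤ 1 / (p - 1) := by
  have : 0 < p - 1 := by linarith
  unfold erF
  refine div_le_div_of_nonneg_right ?_ this.le
  rw [div_le_one (by positivity)]
  nlinarith [sq_nonneg (‖q‖ ^ 4 - δ)]

theorem continuous_erF {p δ : ℝ} (hδ : 0 < δ) : Continuous (erF p δ : E → ℝ) := by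
  unfold erF
  refine Continuous.div_const (Continuous.div (by fun_prop) (by fun_prop) fun q => by positivity) _

theorem erF_tendsto {p : ℝ} (q : E) {δ : ℕ → ℝ} (hδ : Filter.Tendsto δ Filter.atTop (𝓝 0)) :
    Filter.Tendsto (fun k => erF p (δ k) q) Filter.atTop (𝓝 0) := by
  by_cases h : q = 0
  · subst h; simp [erF]
  have h' : 0 < ‖q‖ := norm_pos_iff.2 h
  have h1 : Filter.Tendsto (fun k => 4 * ‖q‖ ^ 4 * δ k / (‖q‖ ^ 4 + δ k) ^ 2 / (p - 1)) Filter.atTop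
      (𝓝 (4 * ‖q‖ ^ 4 * 0 / (‖q‖ ^ 4 + 0) ^ 2 / (p - 1))) :=
    ((hδ.const_mul _).div ((hδ.const_add _).pow 2) (by positivity)).div_const _
  simpa [erF] using h1

theorem bd_tendsto {p : ℝ} (q : E) {δ : ℕ → ℝ} (hδ : Filter.Tendsto δ Filter.atTop (𝓝 0)) :
    Filter.Tendsto (fun k => bd p (δ k) q) Filter.atTop (𝓝 (aF p q)) := by
  by_cases h : q = 0
  · subst h; simp [bd, aF_zero]
  have h' : 0 < ‖q‖ := norm_pos_iff.2 h
  have h1 : Filter.Tendsto (fun k => ‖q‖ ^ 4 / (‖q‖ ^ 4 + δ k)) Filter.atTop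
      (𝓝 (‖q‖ ^ 4 / (‖q‖ ^ 4 + 0))) :=
    tendsto_const_nhds.div (hδ.const_add _) (by positivity)
  rw [add_zero, div_self (by positivity)] at h1
  simpa [bd] using h1.smul_const (aF p q)

theorem bd_norm_le {p δ : ℝ} (hδ : 0 < δ) (q : E) : ‖bd p δ q‖ ≤ ‖aF p q‖ := by
  rw [bd, norm_smul, Real.norm_of_nonneg (by positivity)]
  refine mul_le_of_le_one_left (norm_nonneg _) ?_
  rw [div_le_one (by positivity)]; linarith

theorem continuous_Gf {p lam : ℝ} (hp : 1 < p) {qf : E → E} (hq : Continuous qf) :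
    Continuous fun x => Gf p lam x (qf x) := by
  have := (continuous_aF hp (E := E)).comp hq
  have h2 : Continuous fun h => ‖qf h‖ ^ p := hq.norm.rpow_const (fun _ => Or.inr (by linarith))
  unfold Gf
  exact ((continuous_const.mul h2).add continuous_const).add (this.inner continuous_id)

variable [MeasurableSpace E] [BorelSpace E]

theorem L7step {p lam : ℝ} (hp : 1 < p) (hlam : 0 ≤ lam) {qf : E → E} {C : ℝ≥0}
    (hL : LipschitzWith C qf)
    (hpsd : ∀ x, DifferentiableAt ℝ qf x → ∀ v, 0 ≤ ⟪fderiv ℝ qf x v, v⟫)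
    (hL6 : ∀ x, DifferentiableAt ℝ qf x → qf x ≠ 0 →
      trc ((fderiv ℝ (aF p) (qf x)).comp (fderiv ℝ qf x)) ≤ Gf p lam x (qf x))
    {φ : E → ℝ} (hφ : ContDiff ℝ 1 φ) (hc : HasCompactSupport φ) (h0 : ∀ x, 0 ≤ φ x)
    {δ : ℝ} (hδ : 0 < δ) :
    - ∫ x, (1 + erF p δ (qf x)) * (Gf p lam x (qf x) * φ x) ≤ ∫ x, fderiv ℝ φ x (bd p δ (qf x)) := by
  obtain ⟨R, hR⟩ := (hc.isCompact.image hL.continuous).isBounded.exists_norm_le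
  have hRb : ∀ x ∈ tsupport φ, qf x ∈ ball (0:E) (|R| + 1) := fun x hx => by
    rw [mem_ball_zero_iff]
    have := hR _ (mem_image_of_mem qf hx)
    have := le_abs_self R
    linarith
  let χ : ContDiffBump (0:E) := ⟨|R| + 1, |R| + 2, by positivity, by linarith⟩
  set b : E → E := fun P => χ P • bd p δ P with hb
  have hbC : ContDiff ℝ 1 b := χ.contDiff.smul (bd_C1 hp hδ)
  have hbc : HasCompactSupport b := χ.hasCompactSupport.smul_right
  have hbe : ∀ P ∈ ball (0:E) (|R| + 1), b P = bd p δ P := fun P hP => by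
    have : χ P = 1 := χ.one_of_mem_closedBall (ball_subset_closedBall hP)
    simp [hb, this]
  obtain ⟨D, hD⟩ := hbC.lipschitzWith_of_hasCompactSupport hbc (by norm_num)
  obtain ⟨hi, he⟩ := lip_ibp (hD.comp hL) hφ hc
  have e1 : ∫ x, fderiv ℝ φ x (bd p δ (qf x)) = ∫ x, fderiv ℝ φ x ((b ∘ qf) x) := by
    refine integral_congr_ae (Filter.Eventually.of_forall fun x => ?_)
    simp only [Function.comp]
    by_cases hx : x ∈ tsupport φ
    · rw [hbe _ (hRb x hx)]
    · have : fderiv ℝ φ x = 0 :=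
        image_eq_zero_of_notMem_tsupport (fun h' => hx (tsupport_fderiv_subset ℝ (f := φ) h'))
      simp [this]
  rw [e1, he]
  refine neg_le_neg (integral_mono_ae hi ?_ ?_)
  · refine Continuous.integrable_of_hasCompactSupport ?_
      (HasCompactSupport.mul_left (HasCompactSupport.mul_left hc))
    exact (continuous_const.add ((continuous_erF hδ).comp hL.continuous)).mul
      ((continuous_Gf hp hL.continuous).mul hφ.continuous)
  · filter_upwards [hL.ae_differentiableAt] with x hx
    by_cases hxs : x ∈ tsupport φ
    · have h1 : fderiv ℝ (b ∘ qf) x = (fderiv ℝ (bd p δ) (qf x)).comp (fderiv ℝ qf x) := by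
        rw [fderiv_comp _ ((hbC.differentiable (by norm_num)) _) hx]
        congr 1
        refine Filter.EventuallyEq.fderiv_eq ?_
        filter_upwards [isOpen_ball.mem_nhds (hRb x hxs)] with P hP using hbe P hP
      have h2 := (bd_trace hp hδ (hpsd x hx) (hL6 x hx) (fun h => by
        rw [h]; simp [Gf, aF_zero, Real.zero_rpow (by linarith : p ≠ 0), hlam])).1
      simp only [h1]
      rw [← mul_assoc]
      exact mul_le_mul_of_nonneg_right h2 (h0 x)
    · simp [image_eq_zero_of_notMem_tsupport hxs]

theorem L7 {p lam : ℝ} (hp : 1 < p) (hlam : 0 ≤ lam) {qf : E → E} {C : ℝ≥0}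
    (hL : LipschitzWith C qf)
    (hpsd : ∀ x, DifferentiableAt ℝ qf x → ∀ v, 0 ≤ ⟪fderiv ℝ qf x v, v⟫)
    (hL6 : ∀ x, DifferentiableAt ℝ qf x → qf x ≠ 0 →
      trc ((fderiv ℝ (aF p) (qf x)).comp (fderiv ℝ qf x)) ≤ Gf p lam x (qf x))
    {φ : E → ℝ} (hφ : ContDiff ℝ 1 φ) (hc : HasCompactSupport φ) (h0 : ∀ x, 0 ≤ φ x) :
    - ∫ x, Gf p lam x (qf x) * φ x ≤ ∫ x, fderiv ℝ φ x (aF p (qf x)) := by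
  set δ : ℕ → ℝ := fun k => 1 / ((k : ℝ) + 1) with hδd
  have hδ0 : ∀ k, 0 < δ k := fun k => by simp only [hδd]; positivity
  have hδ : Filter.Tendsto δ Filter.atTop (𝓝 0) := tendsto_one_div_add_atTop_nhds_zero_nat
  have hφ' : Continuous (fderiv ℝ φ) := hφ.continuous_fderiv (by norm_num)
  have hqc := hL.continuous
  have hGi : Integrable (fun x => Gf p lam x (qf x) * φ x) :=
    ((continuous_Gf hp hqc).mul hφ.continuous).integrable_of_hasCompactSupport
      (HasCompactSupport.mul_left hc)
  have l1 : Filter.Tendsto (fun k => ∫ x, (1 + erF p (δ k) (qf x)) * (Gf p lam x (qf x) * φ x))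
      Filter.atTop (𝓝 (∫ x, Gf p lam x (qf x) * φ x)) := by
    refine tendsto_integral_of_dominated_convergence
      (fun x => (1 + 1 / (p - 1)) * ‖Gf p lam x (qf x) * φ x‖) ?_ (hGi.norm.const_mul _) ?_ ?_
    · intro k
      exact ((continuous_const.add ((continuous_erF (hδ0 k)).comp hqc)).mul
        ((continuous_Gf hp hqc).mul hφ.continuous)).aestronglyMeasurable
    · intro k
      refine Filter.Eventually.of_forall fun x => ?_
      have a1 := erF_nonneg hp (hδ0 k) (qf x)
      have a2 := erF_le hp (hδ0 k) (qf x)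
      rw [norm_mul, Real.norm_of_nonneg (by linarith : 0 ≤ 1 + erF p (δ k) (qf x))]
      exact mul_le_mul_of_nonneg_right (by linarith) (norm_nonneg _)
    · refine Filter.Eventually.of_forall fun x => ?_
      have := ((erF_tendsto (p := p) (qf x) hδ).const_add 1).mul_const (Gf p lam x (qf x) * φ x)
      simpa using this
  have l2 : Filter.Tendsto (fun k => ∫ x, fderiv ℝ φ x (bd p (δ k) (qf x)))
      Filter.atTop (𝓝 (∫ x, fderiv ℝ φ x (aF p (qf x)))) := by
    refine tendsto_integral_of_dominated_convergence
      (fun x => ‖fderiv ℝ φ x‖ * ‖aF p (qf x)‖) ?_ ?_ ?_ ?_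
    · intro k
      have : Continuous fun x => bd p (δ k) (qf x) := (bd_C1 hp (hδ0 k)).continuous.comp hqc
      exact (hφ'.clm_apply this).aestronglyMeasurable
    · refine Continuous.integrable_of_hasCompactSupport ?_ (HasCompactSupport.mul_right (hc.fderiv ℝ).norm)
      exact hφ'.norm.mul ((continuous_aF hp).comp hqc).norm
    · intro k
      refine Filter.Eventually.of_forall fun x => ?_
      refine ((fderiv ℝ φ x).le_opNorm _).trans ?_
      exact mul_le_mul_of_nonneg_left (bd_norm_le (hδ0 k) _) (norm_nonneg _)
    · refine Filter.Eventually.of_forall fun x => ?_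
      exact ((fderiv ℝ φ x).continuous.tendsto _).comp (bd_tendsto (qf x) hδ)
  exact le_of_tendsto_of_tendsto' l1.neg l2 fun k => L7step hp hlam hL hpsd hL6 hφ hc h0 (hδ0 k)
end L7b


section L8
variable {E : Type*} [NormedAddCommGroup E] [InnerProductSpace ℝ E] [FiniteDimensional ℝ E]

theorem u_lip {Ω : Set E} (hΩo : IsOpen Ω) (hne : Ω.Nonempty) (hΩb : IsBounded Ω)
    (hΩc : Convex ℝ Ω) {u : E → ℝ} (hu1 : ContDiffOn ℝ 1 u (closure Ω)) :
    ∃ C : ℝ, 0 < C ∧ ∀ x ∈ closure Ω, ∀ y ∈ closure Ω, |u x - u y| ≤ C * ‖x - y‖ := by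
  have hint : (interior (closure Ω)).Nonempty :=
    hne.mono (interior_maximal subset_closure hΩo)
  have hud : UniqueDiffOn ℝ (closure Ω) := uniqueDiffOn_convex hΩc.closure hint
  have hcont := hu1.continuousOn_fderivWithin hud (by norm_num)
  obtain ⟨M, hM⟩ := hΩb.isCompact_closure.exists_bound_of_continuousOn hcont
  refine ⟨|M| + 1, by positivity, fun x hx y hy => ?_⟩
  have := hΩc.closure.norm_image_sub_le_of_norm_fderivWithin_le (hu1.differentiableOn (by norm_num))
    (C := |M| + 1) (fun z hz => (hM z hz).trans (by linarith [le_abs_self M])) hy hx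
  exact this

theorem L8 {Ω : Set E} (hΩo : IsOpen Ω) (hne : Ω.Nonempty) (hΩb : IsBounded Ω)
    (hΩc : Convex ℝ Ω) {u : E → ℝ} (hu1 : ContDiffOn ℝ 1 u (closure Ω))
    (hub : ∀ x ∈ frontier Ω, u x = 0) {τ : ℝ} (hτ : 0 < τ) :
    ∃ ε0 > 0, ∀ ε, 0 < ε → ε ≤ ε0 → ∀ (V : E → ℝ) (qf : E → E), LegData (closure Ω) u ε V qf →
      ∀ x, τ ≤ Real.exp (-V x) → x ∈ Ω := by
  obtain ⟨C, hC, hlip⟩ := u_lip hΩo hne hΩb hΩc hu1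
  set t := C / τ with ht
  have ht0 : 0 < t := by positivity
  refine ⟨1 / t ^ 2, by positivity, fun ε hε hεε V qf H x hx => ?_⟩
  by_contra hxΩ
  obtain ⟨f, hf⟩ := geometric_hahn_banach_open_point hΩc hΩo hxΩ
  set v : E := (InnerProductSpace.toDual ℝ E).symm f with hv
  have hfv : ∀ y, f y = ⟪v, y⟫ := fun y => by simp [hv]
  have hv0 : v ≠ 0 := by
    intro h
    obtain ⟨y, hy⟩ := hne
    have := hf y hy
    rw [hfv, hfv, h] at this; simp at this
  have hvn : 0 < ‖v‖ := norm_pos_iff.2 hv0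
  set ν : E := ‖v‖⁻¹ • v with hν
  have hνn : ‖ν‖ = 1 := by rw [hν, norm_smul, norm_inv, norm_norm, inv_mul_cancel₀ hvn.ne']
  have hlt : ∀ y ∈ Ω, ⟪ν, y⟫ < ⟪ν, x⟫ := by
    intro y hy
    have := hf y hy
    rw [hfv, hfv] at this
    rw [hν, real_inner_smul_left, real_inner_smul_left]
    exact mul_lt_mul_of_pos_left this (by positivity)
  have hbd : ∀ y ∈ Ω, u y ≤ C * (⟪ν, x⟫ - ⟪ν, y⟫) := by
    intro y hy
    set d := ⟪ν, x⟫ - ⟪ν, y⟫ with hd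
    have hd0 : 0 < d := sub_pos.2 (hlt y hy)
    have hout : y + d • ν ∉ Ω := by
      intro h
      have := hlt _ h
      rw [inner_add_right, real_inner_smul_right, real_inner_self_eq_norm_sq, hνn] at this
      linarith
    obtain ⟨z, hz, hzf⟩ : ∃ z ∈ segment ℝ y (y + d • ν), z ∈ frontier Ω := by
      by_contra hno
      push Not at hno
      have hcl : ∀ z ∈ segment ℝ y (y + d • ν), z ∉ Ω → z ∈ (closure Ω)ᶜ := by
        intro z hz hzo hzc
        exact hno z hz ⟨hzc, fun h => hzo (interior_subset h)⟩
      obtain ⟨z, -, hz1, hz2⟩ := (convex_segment y (y + d • ν)).isPreconnected Ω (closure Ω)ᶜ hΩo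
        isClosed_closure.isOpen_compl (fun z hz => by
          by_cases h : z ∈ Ω
          · exact Or.inl h
          · exact Or.inr (hcl z hz h)) ⟨y, left_mem_segment ℝ _ _, hy⟩
          ⟨_, right_mem_segment ℝ _ _, hcl _ (right_mem_segment ℝ _ _) hout⟩
      exact hz2 (subset_closure hz1)
    have h1 := hlip y (subset_closure hy) z (frontier_subset_closure hzf)
    rw [hub z hzf, sub_zero] at h1
    have h2 : ‖y - z‖ ≤ d := by
      have := (segment_subset_closedBall_left y (y + d • ν)) hz
      rw [mem_closedBall, dist_eq_norm, norm_sub_rev] at this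
      simpa [norm_smul, hνn, abs_of_pos hd0] using this
    calc u y ≤ |u y| := le_abs_self _
      _ ≤ _ := h1
      _ ≤ _ := mul_le_mul_of_nonneg_left h2 hC.le
  have h4 := H.P4 (t • ν) (t * ⟪ν, x⟫ + Real.log C - Real.log t - 1) (by
    intro y hy hyp
    have hyΩ : y ∈ Ω := by
      by_contra hn
      have : y ∈ frontier Ω := ⟨hy, fun h => hn (interior_subset h)⟩
      rw [hub y this] at hyp; exact lt_irrefl _ hyp
    have hd0 : 0 < ⟪ν, x⟫ - ⟪ν, y⟫ := sub_pos.2 (hlt y hyΩ)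
    have h1 : Real.log (u y) ≤ Real.log C + Real.log (⟪ν, x⟫ - ⟪ν, y⟫) := by
      rw [← Real.log_mul hC.ne' hd0.ne']
      exact Real.log_le_log hyp (hbd y hyΩ)
    have h2 := Real.log_le_sub_one_of_pos (mul_pos ht0 hd0)
    rw [Real.log_mul ht0.ne' hd0.ne'] at h2
    rw [real_inner_smul_left]
    linarith) x
  rw [real_inner_smul_left, norm_smul, hνn, mul_one, Real.norm_eq_abs, sq_abs] at h4
  have h5 : ε * t ^ 2 ≤ 1 := by rw [le_div_iff₀ (by positivity)] at hεε; exact hεε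
  have h6 : Real.log t = Real.log C - Real.log τ := Real.log_div hC.ne' hτ.ne'
  have h7 : Real.log τ ≤ -V x := by
    rw [← Real.exp_le_exp, Real.exp_log hτ]; exact hx
  linarith
end L8


section L3
variable {E : Type*} [NormedAddCommGroup E] [InnerProductSpace ℝ E] [FiniteDimensional ℝ E]

theorem grad_inner (f : E → ℝ) (x v : E) : ⟪gradient f x, v⟫ = fderiv ℝ f x v := by
  simp [gradient]

theorem aF_neg (p : ℝ) (P : E) : aF p (-P) = -aF p P := by simp [aF]

theorem grad_neglog {u : E → ℝ} {x : E} (hd : DifferentiableAt ℝ u x) (hpos : 0 < u x) :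
    gradient (fun x => -Real.log (u x)) x = -((u x)⁻¹ • gradient u x) := by
  have h1 : HasFDerivAt (fun x => -Real.log (u x)) (-((u x)⁻¹ • fderiv ℝ u x)) x :=
    (hd.hasFDerivAt.log hpos.ne').neg
  unfold gradient
  rw [h1.fderiv, map_neg]; congr 1
  exact map_smul (InnerProductSpace.toDual ℝ E).symm (u x)⁻¹ (fderiv ℝ u x)

theorem continuousOn_gradient {Ω : Set E} (hΩ : IsOpen Ω) {u : E → ℝ} (hu : ContDiffOn ℝ 1 u Ω) :
    ContinuousOn (gradient u) Ω := by
  have h := hu.continuousOn_fderiv_of_isOpen hΩ (by norm_num)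
  exact (InnerProductSpace.toDual ℝ E).symm.continuous.comp_continuousOn h

theorem hasFDerivAt_gauss (c : ℝ) (x : E) :
    HasFDerivAt (fun x : E => Real.exp (c * ‖x‖ ^ 2 / 2)) ((c * Real.exp (c * ‖x‖ ^ 2 / 2)) • innerSL ℝ x) x := by
  have h1 : HasFDerivAt (fun x : E => ‖x‖ ^ 2) (2 • innerSL ℝ x) x := by
    exact (hasStrictFDerivAt_norm_sq x).hasFDerivAt
  have h2 : HasFDerivAt (fun x : E => c * ‖x‖ ^ 2 / 2) (c • innerSL ℝ x) x := by
    have := h1.const_mul (c / 2)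
    have e1 : (fun x : E => c * ‖x‖ ^ 2 / 2) = fun x => c / 2 * ‖x‖ ^ 2 := by ext x; ring
    have e2 : c • innerSL ℝ x = (c / 2) • 2 • innerSL ℝ x := by ext v; simp; ring
    rw [e1, e2]; exact this
  have h3 := h2.exp
  rw [smul_smul, mul_comm] at h3
  exact h3

theorem contDiff_gauss (c : ℝ) : ContDiff ℝ 1 (fun x : E => Real.exp (c * ‖x‖ ^ 2 / 2)) := by
  have := contDiff_norm_sq ℝ (E := E) (n := 1)
  exact ((contDiff_const.mul this).div_const 2).exp

variable [MeasurableSpace E] [BorelSpace E]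

theorem integrable_cs {f : E → ℝ} {S Ω : Set E} (hS : IsCompact S) (hSΩ : S ⊆ Ω)
    (hf : ContinuousOn f Ω) (h0 : ∀ x, x ∉ S → f x = 0) : Integrable f := by
  have h1 : IntegrableOn f S := (hf.mono hSΩ).integrableOn_compact hS
  refine (integrableOn_iff_integrable_of_support_subset ?_).1 h1
  intro x hx
  by_contra h
  exact hx (h0 x h)

theorem L3gen {p lam : ℝ} (hp : 1 < p) {Ω : Set E} (hΩ : IsOpen Ω) {u : E → ℝ}
    (hu : ContDiffOn ℝ 1 u Ω) (hupos : ∀ x ∈ Ω, 0 < u x)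
    (h : ∀ φ : E → ℝ, ContDiff ℝ (⊤ : ℕ∞) φ → HasCompactSupport φ → tsupport φ ⊆ Ω →
      ∫ x in Ω, fderiv ℝ φ x (Real.exp ((-1) * ‖x‖ ^ 2 / 2) • aF p (gradient u x)) =
      ∫ x in Ω, (lam * u x ^ (p - 1) * Real.exp ((-1) * ‖x‖ ^ 2 / 2)) * φ x) :
    WeakW p lam Ω (fun x => -Real.log (u x)) := by
  intro ψ hψ hc hs
  have hgu : ContinuousOn (gradient u) Ω := continuousOn_gradient hΩ hu
  have haF : ContinuousOn (fun x => aF p (gradient u x)) Ω := (continuous_aF hp).comp_continuousOn hgu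
  have hρ : ∀ c : ℝ, Continuous (fun x : E => Real.exp (c * ‖x‖ ^ 2 / 2)) := fun c => (contDiff_gauss c).continuous
  have hw : ContDiffOn ℝ 1 (fun x => -Real.log (u x)) Ω := (hu.log (fun y hy => (hupos y hy).ne')).neg
  have hup : ∀ r : ℝ, ContDiffOn ℝ 1 (fun x => u x ^ r) Ω := fun r =>
    hu.rpow_const_of_ne (fun x hx => (hupos x hx).ne')
  set φ : E → ℝ := fun x => ψ x * (u x ^ (1 - p) * Real.exp (1 * ‖x‖ ^ 2 / 2)) with hφ
  have hts : tsupport φ ⊆ tsupport ψ := closure_mono (Function.support_mul_subset_left _ _)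
  have hφc : HasCompactSupport φ := hc.mul_right
  have hφ1 : ContDiff ℝ 1 φ := by
    refine contDiff_of_tsupp fun x hx => ?_
    have hxΩ := hs (hts hx)
    exact hψ.contDiffAt.mul (((hup _).contDiffAt (hΩ.mem_nhds hxΩ)).mul (contDiff_gauss 1).contDiffAt)
  have key := weak_C1 hΩ (A := fun x => Real.exp ((-1) * ‖x‖ ^ 2 / 2) • aF p (gradient u x))
    (H := fun x => lam * u x ^ (p - 1) * Real.exp ((-1) * ‖x‖ ^ 2 / 2))
    ((hρ _).continuousOn.smul haF)
    ((continuousOn_const.mul (hup _).continuousOn).mul (hρ _).continuousOn) h φ hφ1 hφc (hts.trans hs)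
  set w : E → ℝ := fun x => -Real.log (u x) with hwd
  have hgw : ContinuousOn (gradient w) Ω := continuousOn_gradient hΩ hw
  have hrr : ∀ x : E, Real.exp ((-1) * ‖x‖ ^ 2 / 2) * Real.exp (1 * ‖x‖ ^ 2 / 2) = 1 := fun x => by
    rw [← Real.exp_add]; simp; ring
  have hpt : ∀ x ∈ Ω, fderiv ℝ φ x (Real.exp ((-1) * ‖x‖ ^ 2 / 2) • aF p (gradient u x)) =
      -(fderiv ℝ ψ x (aF p (gradient w x))) - (Gf p lam x (gradient w x) * ψ x) + lam * ψ x := by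
    intro x hx
    have hux := hupos x hx
    have hdu := (hu.contDiffAt (hΩ.mem_nhds hx)).differentiableAt (by norm_num : (1 : WithTop ℕ∞) ≠ 0)
    have d1 : HasFDerivAt (fun x => u x ^ (1 - p)) (((1 - p) * u x ^ (1 - p - 1)) • fderiv ℝ u x) x :=
      hdu.hasFDerivAt.rpow_const (Or.inl hux.ne')
    have d2 := ((hψ.differentiable (by norm_num)) x).hasFDerivAt.mul (d1.mul (hasFDerivAt_gauss 1 x))
    have d3 : fderiv ℝ φ x = _ := d2.fderiv
    have hg := grad_neglog hdu hux
    have ha : aF p (gradient w x) = -(u x ^ (1 - p) • aF p (gradient u x)) := by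
      rw [hwd, hg, aF_neg, aF_smul hp (by positivity), Real.inv_rpow hux.le, ← Real.rpow_neg hux.le]
      congr 3; ring
    have hn : ‖gradient w x‖ ^ p = u x ^ (1 - p - 1) * ‖gradient u x‖ ^ p := by
      rw [hwd, hg, norm_neg, norm_smul, norm_inv, Real.norm_of_nonneg hux.le,
        Real.mul_rpow (by positivity) (norm_nonneg _), Real.inv_rpow hux.le, ← Real.rpow_neg hux.le]
      congr 2; ring
    have hfu : fderiv ℝ u x (aF p (gradient u x)) = ‖gradient u x‖ ^ p := by
      rw [← grad_inner, real_inner_comm, inner_aF_self hp]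
    rw [d3, map_smul, Gf, hn, ha]
    simp only [add_apply, smul_apply, innerSL_apply_apply, smul_eq_mul, hfu, map_neg, map_smul,
      inner_neg_left, real_inner_smul_left, Pi.mul_apply]
    rw [real_inner_comm x (aF p (gradient u x))]
    have := hrr x
    set a := Real.exp ((-1) * ‖x‖ ^ 2 / 2)
    set b := Real.exp (1 * ‖x‖ ^ 2 / 2)
    linear_combination (ψ x * (u x ^ (1 - p) * ⟪x, aF p (gradient u x)⟫ + (1 - p) * u x ^ (1 - p - 1) * ‖gradient u x‖ ^ p) + u x ^ (1 - p) * fderiv ℝ ψ x (aF p (gradient u x))) * this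
  have hpt2 : ∀ x ∈ Ω, lam * u x ^ (p - 1) * Real.exp ((-1) * ‖x‖ ^ 2 / 2) * φ x = lam * ψ x := by
    intro x hx
    have hux := hupos x hx
    have h1 : u x ^ (p - 1) * u x ^ (1 - p) = 1 := by
      rw [← Real.rpow_add hux]; simp
    have := hrr x
    simp only [hφ]
    set a := Real.exp ((-1) * ‖x‖ ^ 2 / 2)
    set b := Real.exp (1 * ‖x‖ ^ 2 / 2)
    linear_combination lam * ψ x * (u x ^ (p - 1) * u x ^ (1 - p)) * this + lam * ψ x * h1
  rw [setIntegral_congr_fun hΩ.measurableSet hpt, setIntegral_congr_fun hΩ.measurableSet hpt2] at key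
  have hψ' : Continuous (fderiv ℝ ψ) := hψ.continuous_fderiv (by norm_num)
  have k1 : Integrable (fun x => fderiv ℝ ψ x (aF p (gradient w x))) (volume.restrict Ω) := by
    refine (integrable_cs hc.isCompact hs ?_ ?_).restrict
    · exact hψ'.continuousOn.clm_apply ((continuous_aF hp).comp_continuousOn hgw)
    · intro x hx
      have : fderiv ℝ ψ x = 0 :=
        image_eq_zero_of_notMem_tsupport (fun h' => hx (tsupport_fderiv_subset ℝ (f := ψ) h'))
      simp [this]
  have k2 : Integrable (fun x => Gf p lam x (gradient w x) * ψ x) (volume.restrict Ω) := by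
    refine (integrable_cs hc.isCompact hs ?_ ?_).restrict
    · refine ContinuousOn.mul ?_ hψ.continuous.continuousOn
      unfold Gf
      refine ((continuousOn_const.mul (hgw.norm.rpow_const (fun _ _ => Or.inr (by linarith)))).add continuousOn_const).add
        (((continuous_aF hp).comp_continuousOn hgw).inner continuousOn_id)
    · intro x hx
      simp [image_eq_zero_of_notMem_tsupport hx]
  have k3 : Integrable (fun x => lam * ψ x) (volume.restrict Ω) :=
    ((hψ.continuous.integrable_of_hasCompactSupport hc).const_mul lam).restrict
  have k4 : Integrable (fun x => -(fderiv ℝ ψ x (aF p (gradient w x))) - (Gf p lam x (gradient w x) * ψ x)) (volume.restrict Ω) := k1.neg.sub k2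
  have k5 : Integrable (fun x => -(fderiv ℝ ψ x (aF p (gradient w x)))) (volume.restrict Ω) := k1.neg
  rw [integral_add k4 k3, integral_sub k5 k2, integral_neg] at key
  linarith
end L3


section L9
variable {E : Type*} [NormedAddCommGroup E] [InnerProductSpace ℝ E] [FiniteDimensional ℝ E]

noncomputable def chi (τ s : ℝ) : ℝ := (max (s - τ) 0) ^ 2 / s
noncomputable def chi' (τ s : ℝ) : ℝ := max (s - τ) 0 * (2 * s - max (s - τ) 0) / s ^ 2

theorem chi_hasDeriv (τ : ℝ) {s : ℝ} (hs : 0 < s) : HasDerivAt (chi τ) (chi' τ s) s := by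
  have h1 : HasDerivAt (fun s => (max (s - τ) 0) ^ 2) (2 * max (s - τ) 0) s := by
    have := (hasDerivAt_posSq (s - τ)).comp s ((hasDerivAt_id s).sub_const τ)
    rw [mul_one] at this
    exact this
  have h2 := h1.div (hasDerivAt_id s) hs.ne'
  have e : chi' τ s = (2 * max (s - τ) 0 * id s - (max (s - τ) 0) ^ 2 * 1) / (id s) ^ 2 := by
    unfold chi'; simp only [id]; ring
  rw [e]; exact h2

theorem chi_contDiffAt (τ : ℝ) {s : ℝ} (hs : 0 < s) : ContDiffAt ℝ 1 (chi τ) s := by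
  have h1 : ContDiff ℝ 1 (fun s : ℝ => (max (s - τ) 0) ^ 2) :=
    contDiff_posSq.comp (contDiff_id.sub contDiff_const)
  exact h1.contDiffAt.div contDiffAt_id hs.ne'

theorem chi_nonneg (τ : ℝ) {s : ℝ} (hs : 0 < s) : 0 ≤ chi τ s := by unfold chi; positivity

theorem chi_max_le {τ s : ℝ} (hτ : 0 < τ) (hs : 0 < s) : 0 ≤ max (s - τ) 0 ∧ max (s - τ) 0 ≤ s :=
  ⟨le_max_right _ _, max_le (by linarith) hs.le⟩

theorem chi_le {τ s : ℝ} (hτ : 0 < τ) (hs : 0 < s) : chi τ s ≤ s := by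
  obtain ⟨h1, h2⟩ := chi_max_le hτ hs
  unfold chi; rw [div_le_iff₀ hs]; nlinarith

theorem le_chi {τ s : ℝ} (hτ : 0 < τ) (hs : 0 < s) : s - 2 * τ ≤ chi τ s := by
  unfold chi; rw [le_div_iff₀ hs]
  rcases le_total (s - τ) 0 with h | h
  · rw [max_eq_right h]; nlinarith
  · rw [max_eq_left h]; nlinarith

theorem chi'_nonneg {τ s : ℝ} (hτ : 0 < τ) (hs : 0 < s) : 0 ≤ chi' τ s := by
  obtain ⟨h1, h2⟩ := chi_max_le hτ hs
  unfold chi'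
  have : 0 ≤ 2 * s - max (s - τ) 0 := by linarith
  positivity

theorem chi'_le {τ s : ℝ} (hτ : 0 < τ) (hs : 0 < s) : chi' τ s ≤ 1 := by
  obtain ⟨h1, h2⟩ := chi_max_le hτ hs
  unfold chi'
  rw [div_le_one (by positivity)]
  nlinarith [sq_nonneg (s - max (s - τ) 0)]

theorem chi_zero {τ s : ℝ} (hs : s ≤ τ) : chi τ s = 0 ∧ chi' τ s = 0 := by
  unfold chi chi'
  rw [max_eq_right (by linarith)]; simp

theorem bregD_smul {p : ℝ} (hp : 1 < p) {a b : ℝ} (ha : 0 ≤ a) (hb : 0 ≤ b) (Q P : E) :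
    bregD p (a • Q) (b • P) = a ^ p * ‖Q‖ ^ p + (p - 1) * (b ^ p * ‖P‖ ^ p)
      - p * (b ^ (p - 1) * (a * ⟪aF p P, Q⟫)) := by
  unfold bregD
  rw [norm_smul, norm_smul, Real.norm_of_nonneg ha, Real.norm_of_nonneg hb,
    Real.mul_rpow ha (norm_nonneg _), Real.mul_rpow hb (norm_nonneg _), aF_smul hp hb,
    real_inner_smul_left, real_inner_smul_right]

variable [MeasurableSpace E] [BorelSpace E]

theorem L9a {p lam τ : ℝ} (hp : 1 < p) (hτ : 0 < τ) {Ω : Set E} (hΩ : IsOpen Ω) (hΩb : IsBounded Ω)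
    {w V : E → ℝ} {qf : E → E} (hw : ContDiffOn ℝ 1 w Ω) (hww : WeakW p lam Ω w)
    (hV : ∀ x, HasGradientAt V (qf x) x) (hq : Continuous qf)
    (hS : ∀ x, τ ≤ Real.exp (-V x) → x ∈ Ω)
    (h7 : ∀ φ : E → ℝ, ContDiff ℝ 1 φ → HasCompactSupport φ → (∀ x, 0 ≤ φ x) →
      -∫ x, Gf p lam x (qf x) * φ x ≤ ∫ x, fderiv ℝ φ x (aF p (qf x))) :
    IntegrableOn (fun x => bregD p ((chi' τ (Real.exp (-V x)) * Real.exp (-V x)) • qf x)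
      (chi τ (Real.exp (-V x)) • gradient w x) * Real.exp ((-1) * ‖x‖ ^ 2 / 2)) Ω ∧
    ∫ x in Ω, bregD p ((chi' τ (Real.exp (-V x)) * Real.exp (-V x)) • qf x)
      (chi τ (Real.exp (-V x)) • gradient w x) * Real.exp ((-1) * ‖x‖ ^ 2 / 2) ≤
    ∫ x in Ω, lam * (chi τ (Real.exp (-V x)) * (Real.exp (-V x) ^ (p - 1) - chi τ (Real.exp (-V x)) ^ (p - 1)))
      * Real.exp ((-1) * ‖x‖ ^ 2 / 2) := by
  have hVf : ∀ x, HasFDerivAt V (innerSL ℝ (qf x)) x := fun x => hasFD_of_grad (hV x)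
  have hV1 : ContDiff ℝ 1 V := by
    rw [contDiff_one_iff_fderiv]
    refine ⟨fun x => (hVf x).differentiableAt, ?_⟩
    have : fderiv ℝ V = fun x => innerSL ℝ (qf x) := funext fun x => (hVf x).fderiv
    rw [this]; exact (innerSL ℝ).continuous.comp hq
  set U : E → ℝ := fun x => Real.exp (-V x) with hUd
  have hU0 : ∀ x, 0 < U x := fun x => Real.exp_pos _
  have hU1 : ContDiff ℝ 1 U := hV1.neg.exp
  have hUf : ∀ x, HasFDerivAt U (-(U x • innerSL ℝ (qf x))) x := fun x => by
    have := (hVf x).neg.exp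
    rw [smul_neg] at this
    exact this
  set X : E → ℝ := fun x => chi τ (U x) with hXd
  set X' : E → ℝ := fun x => chi' τ (U x) with hX'd
  have hX1 : ContDiff ℝ 1 X := contDiff_iff_contDiffAt.2 fun x =>
    (chi_contDiffAt τ (hU0 x)).comp x hU1.contDiffAt
  have hX0 : ∀ x, 0 ≤ X x := fun x => chi_nonneg τ (hU0 x)
  have hXf : ∀ x, HasFDerivAt X (-((X' x * U x) • innerSL ℝ (qf x))) x := fun x => by
    have := (chi_hasDeriv τ (hU0 x)).comp_hasFDerivAt x (hUf x)
    rw [smul_neg, smul_smul] at this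
    exact this
  have hX'c : Continuous X' := by
    have : X' = fun x => max (U x - τ) 0 * (2 * U x - max (U x - τ) 0) / U x ^ 2 := rfl
    rw [this]
    have hc := hU1.continuous
    exact ((hc.sub continuous_const).max continuous_const |>.mul
      ((continuous_const.mul hc).sub ((hc.sub continuous_const).max continuous_const))).div (hc.pow 2)
      (fun x => (pow_pos (hU0 x) 2).ne')
  set S : Set E := {x | τ ≤ U x} with hSd
  have hSΩ : S ⊆ Ω := fun x hx => hS x hx
  have hSc : IsClosed S := isClosed_le continuous_const hU1.continuous
  have hSk : IsCompact S := Metric.isCompact_of_isClosed_isBounded hSc (hΩb.subset hSΩ)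
  have hXS : ∀ x, x ∉ S → X x = 0 ∧ X' x = 0 := fun x hx => chi_zero (le_of_lt (not_le.1 hx))
  set ρ : E → ℝ := fun x => Real.exp ((-1) * ‖x‖ ^ 2 / 2) with hρd
  have hρ1 : ContDiff ℝ 1 ρ := contDiff_gauss (-1)
  have hρ0 : ∀ x, 0 < ρ x := fun x => Real.exp_pos _
  have hρf : ∀ x, HasFDerivAt ρ (((-1) * ρ x) • innerSL ℝ x) x := fun x => hasFDerivAt_gauss (-1) x
  have hgw : ContinuousOn (gradient w) Ω := continuousOn_gradient hΩ hw
  have haw : ContinuousOn (fun x => aF p (gradient w x)) Ω := (continuous_aF hp).comp_continuousOn hgw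
  have haq : Continuous (fun x => aF p (qf x)) := (continuous_aF hp).comp hq
  have hnw : ContinuousOn (fun x => ‖gradient w x‖ ^ p) Ω :=
    hgw.norm.rpow_const (fun _ _ => Or.inr (by linarith))
  have hnq : Continuous (fun x => ‖qf x‖ ^ p) := hq.norm.rpow_const (fun _ => Or.inr (by linarith))
  have hUc := hU1.continuous
  have hXc := hX1.continuous
  have hρc := hρ1.continuous
  have hUp : ∀ r : ℝ, Continuous (fun x => U x ^ r) := fun r => hUc.rpow_const (fun x => Or.inl (hU0 x).ne')
  have hXp : ∀ r : ℝ, 0 ≤ r → Continuous (fun x => X x ^ r) := fun r hr => hXc.rpow_const (fun x => Or.inr hr)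
  -- test functions
  set φ1 : E → ℝ := fun x => (U x ^ (p - 1) * X x) * ρ x with hφ1
  set φ2 : E → ℝ := fun x => X x ^ p * ρ x with hφ2
  have hφ1d : ContDiff ℝ 1 φ1 :=
    ((hU1.rpow_const_of_ne (fun x => (hU0 x).ne')).mul hX1).mul hρ1
  have hφ2d : ContDiff ℝ 1 φ2 :=
    (hX1.rpow_const_of_le (by norm_num; linarith)).mul hρ1
  have hz1 : ∀ x, x ∉ S → φ1 x = 0 := fun x hx => by simp [hφ1, (hXS x hx).1]
  have hz2 : ∀ x, x ∉ S → φ2 x = 0 := fun x hx => by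
    simp [hφ2, (hXS x hx).1, Real.zero_rpow (by linarith : p ≠ 0)]
  have hts : ∀ φ : E → ℝ, (∀ x, x ∉ S → φ x = 0) → tsupport φ ⊆ S := fun φ h =>
    closure_minimal (fun x hx => by by_contra h'; exact hx (h x h')) hSc
  have hφ1c : HasCompactSupport φ1 := hSk.of_isClosed_subset (isClosed_tsupport _) (hts _ hz1)
  have hφ2c : HasCompactSupport φ2 := hSk.of_isClosed_subset (isClosed_tsupport _) (hts _ hz2)
  have e1 := h7 φ1 hφ1d hφ1c (fun x => mul_nonneg (mul_nonneg (Real.rpow_nonneg (hU0 x).le _) (hX0 x)) (hρ0 x).le)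
  have e2 := hww φ2 hφ2d hφ2c ((hts _ hz2).trans hSΩ)
  have fz : ∀ φ : E → ℝ, (∀ x, x ∉ S → φ x = 0) → ∀ x, x ∉ S → fderiv ℝ φ x = 0 := fun φ h x hx =>
    image_eq_zero_of_notMem_tsupport (fun h' => hx (hts φ h (tsupport_fderiv_subset ℝ (f := φ) h')))
  -- pointwise identities
  have i1 : ∀ x, fderiv ℝ φ1 x (aF p (qf x)) + Gf p lam x (qf x) * φ1 x =
      (lam * (U x ^ (p - 1) * X x) - U x ^ p * X' x * ‖qf x‖ ^ p) * ρ x := by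
    intro x
    have d1 : HasFDerivAt (fun x => U x ^ (p - 1)) (((p - 1) * U x ^ (p - 1 - 1)) • (-(U x • innerSL ℝ (qf x)))) x :=
      (hUf x).rpow_const (Or.inl (hU0 x).ne')
    have d2 := (d1.mul (hXf x)).mul (hρf x)
    have d3 : fderiv ℝ φ1 x = _ := d2.fderiv
    have s1 : ⟪qf x, aF p (qf x)⟫ = ‖qf x‖ ^ p := by rw [real_inner_comm, inner_aF_self hp]
    have u1 : U x ^ (p - 1) = U x ^ (p - 1 - 1) * U x := by
      rw [← Real.rpow_add_one (hU0 x).ne']; congr 1; ring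
    have u2 : U x ^ p = U x ^ (p - 1 - 1) * U x * U x := by
      rw [← Real.rpow_add_one (hU0 x).ne', ← Real.rpow_add_one (hU0 x).ne']; congr 1; ring
    rw [d3, Gf]
    simp only [add_apply, smul_apply, neg_apply, innerSL_apply_apply, smul_eq_mul, Pi.mul_apply, s1]
    rw [real_inner_comm x (aF p (qf x))]
    simp only [hφ1]
    rw [u1, u2]; ring
  have i2 : ∀ x, fderiv ℝ φ2 x (aF p (gradient w x)) + Gf p lam x (gradient w x) * φ2 x =
      (-(p * (X x ^ (p - 1) * ((X' x * U x) * ⟪aF p (gradient w x), qf x⟫))) +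
        (p - 1) * (X x ^ p * ‖gradient w x‖ ^ p) + lam * X x ^ p) * ρ x := by
    intro x
    have d1 : HasFDerivAt (fun x => X x ^ p) ((p * X x ^ (p - 1)) • (-((X' x * U x) • innerSL ℝ (qf x)))) x :=
      (hXf x).rpow_const (Or.inr hp.le)
    have d2 := d1.mul (hρf x)
    have d3 : fderiv ℝ φ2 x = _ := d2.fderiv
    rw [d3, Gf]
    simp only [add_apply, smul_apply, neg_apply, innerSL_apply_apply, smul_eq_mul, Pi.mul_apply]
    rw [real_inner_comm x (aF p (gradient w x)), real_inner_comm (qf x) (aF p (gradient w x))]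
    simp only [hφ2]
    ring
  -- integrability
  have hGc : Continuous (fun x => Gf p lam x (qf x)) := continuous_Gf hp hq
  have hGw : ContinuousOn (fun x => Gf p lam x (gradient w x)) Ω := by
    unfold Gf
    exact ((continuousOn_const.mul hnw).add continuousOn_const).add (haw.inner continuousOn_id)
  have k1 : Integrable (fun x => fderiv ℝ φ1 x (aF p (qf x))) :=
    integrable_cs hSk hSΩ ((hφ1d.continuous_fderiv (by norm_num)).clm_apply haq).continuousOn
      (fun x hx => by simp [fz φ1 hz1 x hx])
  have k2 : Integrable (fun x => Gf p lam x (qf x) * φ1 x) :=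
    integrable_cs hSk hSΩ (hGc.mul hφ1d.continuous).continuousOn (fun x hx => by simp [hz1 x hx])
  have k3 : Integrable (fun x => fderiv ℝ φ2 x (aF p (gradient w x))) :=
    integrable_cs hSk hSΩ ((hφ2d.continuous_fderiv (by norm_num)).continuousOn.clm_apply haw)
      (fun x hx => by simp [fz φ2 hz2 x hx])
  have k4 : Integrable (fun x => Gf p lam x (gradient w x) * φ2 x) :=
    integrable_cs hSk hSΩ (hGw.mul hφ2d.continuous.continuousOn) (fun x hx => by simp [hz2 x hx])
  have c1 : ∫ x in Ω, (lam * (U x ^ (p - 1) * X x) - U x ^ p * X' x * ‖qf x‖ ^ p) * ρ x ≥ 0 := by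
    rw [setIntegral_eq_integral_of_forall_compl_eq_zero]
    · have : ∫ x, (lam * (U x ^ (p - 1) * X x) - U x ^ p * X' x * ‖qf x‖ ^ p) * ρ x =
        ∫ x, (fderiv ℝ φ1 x (aF p (qf x)) + Gf p lam x (qf x) * φ1 x) :=
        integral_congr_ae (Filter.Eventually.of_forall fun x => (i1 x).symm)
      rw [this, integral_add k1 k2]; linarith
    · intro x hx
      have := hXS x (fun h => hx (hSΩ h))
      simp [this.1, this.2]
  have c2 : ∫ x in Ω, (-(p * (X x ^ (p - 1) * ((X' x * U x) * ⟪aF p (gradient w x), qf x⟫))) +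
        (p - 1) * (X x ^ p * ‖gradient w x‖ ^ p) + lam * X x ^ p) * ρ x = 0 := by
    have : ∫ x in Ω, (-(p * (X x ^ (p - 1) * ((X' x * U x) * ⟪aF p (gradient w x), qf x⟫))) +
        (p - 1) * (X x ^ p * ‖gradient w x‖ ^ p) + lam * X x ^ p) * ρ x =
        ∫ x in Ω, (fderiv ℝ φ2 x (aF p (gradient w x)) + Gf p lam x (gradient w x) * φ2 x) :=
        integral_congr_ae (Filter.Eventually.of_forall fun x => (i2 x).symm)
    rw [this, integral_add k3.restrict k4.restrict]; linarith
  have n1 : Integrable (fun x => (lam * (U x ^ (p - 1) * X x) - U x ^ p * X' x * ‖qf x‖ ^ p) * ρ x) := by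
    refine (k1.add k2).congr (Filter.Eventually.of_forall fun x => ?_)
    exact i1 x
  have n2 : Integrable (fun x => (-(p * (X x ^ (p - 1) * ((X' x * U x) * ⟪aF p (gradient w x), qf x⟫))) +
        (p - 1) * (X x ^ p * ‖gradient w x‖ ^ p) + lam * X x ^ p) * ρ x) := by
    refine (k3.add k4).congr (Filter.Eventually.of_forall fun x => ?_)
    exact i2 x
  have n3 : Integrable (fun x => lam * (X x * (U x ^ (p - 1) - X x ^ (p - 1))) * ρ x) :=
    integrable_cs hSk hSΩ ((continuous_const.mul (hXc.mul ((hUp _).sub (hXp _ (by linarith))))).mul hρc).continuousOn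
      (fun x hx => by simp [(hXS x hx).1])
  have hXX : ∀ x, X x * X x ^ (p - 1) = X x ^ p := fun x => by
    rcases (hX0 x).eq_or_lt with h | h
    · rw [← h, Real.zero_rpow (by linarith : p ≠ 0)]; simp
    · nth_rewrite 1 [← Real.rpow_one (X x)]; rw [← Real.rpow_add h]; congr 1; ring
  have hB : ∀ x, bregD p ((X' x * U x) • qf x) (X x • gradient w x) =
      (X' x * U x) ^ p * ‖qf x‖ ^ p + (p - 1) * (X x ^ p * ‖gradient w x‖ ^ p)
      - p * (X x ^ (p - 1) * ((X' x * U x) * ⟪aF p (gradient w x), qf x⟫)) := fun x =>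
    bregD_smul hp (mul_nonneg (chi'_nonneg hτ (hU0 x)) (hU0 x).le) (hX0 x) _ _
  have n4 : Integrable (fun x => bregD p ((X' x * U x) • qf x) (X x • gradient w x) * ρ x) := by
    refine integrable_cs hSk hSΩ ?_ ?_
    · simp_rw [hB]
      refine ContinuousOn.mul (((ContinuousOn.mul ?_ hnq.continuousOn).add (continuousOn_const.mul
        (ContinuousOn.mul (hXp p (by linarith)).continuousOn hnw))).sub (continuousOn_const.mul
        (ContinuousOn.mul (hXp (p-1) (by linarith)).continuousOn (ContinuousOn.mul (hX'c.mul hUc).continuousOn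
          (haw.inner hq.continuousOn))))) hρc.continuousOn
      exact ((hX'c.mul hUc).rpow_const (fun x => Or.inr (by linarith))).continuousOn
    · intro x hx
      rw [hB, (hXS x hx).1, (hXS x hx).2]
      simp [Real.zero_rpow (by linarith : p ≠ 0)]
  refine ⟨n4.integrableOn, ?_⟩
  have n12 : Integrable (fun x => lam * (X x * (U x ^ (p - 1) - X x ^ (p - 1))) * ρ x
    - (lam * (U x ^ (p - 1) * X x) - U x ^ p * X' x * ‖qf x‖ ^ p) * ρ x) := n3.sub n1
  have hfin : ∫ x in Ω, bregD p ((X' x * U x) • qf x) (X x • gradient w x) * ρ x ≤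
      ∫ x in Ω, (lam * (X x * (U x ^ (p - 1) - X x ^ (p - 1))) * ρ x
    - (lam * (U x ^ (p - 1) * X x) - U x ^ p * X' x * ‖qf x‖ ^ p) * ρ x
    + (-(p * (X x ^ (p - 1) * ((X' x * U x) * ⟪aF p (gradient w x), qf x⟫))) +
        (p - 1) * (X x ^ p * ‖gradient w x‖ ^ p) + lam * X x ^ p) * ρ x) := by
    refine integral_mono n4.restrict (n12.add n2).restrict fun x => ?_
    have h1 : (X' x * U x) ^ p ≤ U x ^ p * X' x := by
      have hx0 := chi'_nonneg hτ (hU0 x)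
      have hx1 := chi'_le hτ (hU0 x)
      rw [Real.mul_rpow hx0 (hU0 x).le, mul_comm]
      refine mul_le_mul_of_nonneg_left ?_ (Real.rpow_nonneg (hU0 x).le _)
      have := Real.rpow_le_rpow_of_exponent_ge' hx0 hx1 zero_le_one hp.le
      rwa [Real.rpow_one] at this
    have h2 : (X' x * U x) ^ p * ‖qf x‖ ^ p * ρ x ≤ U x ^ p * X' x * ‖qf x‖ ^ p * ρ x := by
      have := Real.rpow_nonneg (norm_nonneg (qf x)) p
      exact mul_le_mul_of_nonneg_right (mul_le_mul_of_nonneg_right h1 this) (hρ0 x).le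
    show bregD p ((X' x * U x) • qf x) (X x • gradient w x) * ρ x ≤ _
    rw [hB]
    have h3 : lam * ρ x * (X x * X x ^ (p - 1)) = lam * ρ x * X x ^ p := by rw [hXX]
    linarith
  rw [integral_add n12.restrict n2.restrict, integral_sub n3.restrict n1.restrict, c2] at hfin
  linarith
end L9


section L10
variable {E : Type*} [NormedAddCommGroup E] [InnerProductSpace ℝ E] [FiniteDimensional ℝ E]

theorem convex_of_mono {Ω : Set E} (hΩ : IsOpen Ω) (hc : Convex ℝ Ω) {w : E → ℝ}
    (hw : ContDiffOn ℝ 1 w Ω)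
    (hm : ∀ x ∈ Ω, ∀ y ∈ Ω, 0 ≤ ⟪gradient w x - gradient w y, x - y⟫) : ConvexOn ℝ Ω w := by
  have hd : ∀ x ∈ Ω, HasFDerivAt w (fderiv ℝ w x) x := fun x hx =>
    ((hw.contDiffAt (hΩ.mem_nhds hx)).differentiableAt (by norm_num)).hasFDerivAt
  have hg : ∀ x ∈ Ω, ∀ y ∈ Ω, w x + ⟪gradient w x, y - x⟫ ≤ w y := by
    intro x hx y hy
    obtain ⟨z, hz, h⟩ := domain_mvt (fun z hz => (hd z hz).hasFDerivWithinAt) hc hx hy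
    have hzΩ : z ∈ Ω := hc.segment_subset hx hy hz
    rw [segment_eq_image'] at hz
    obtain ⟨t, ⟨ht0, ht1⟩, rfl⟩ := hz
    have h1 := hm _ hzΩ x hx
    simp only [add_sub_cancel_left, real_inner_smul_right, inner_sub_left] at h1
    rw [← grad_inner] at h
    rcases ht0.eq_or_lt with h0 | h0
    · rw [← h0] at h; simp only [zero_smul, add_zero] at h; linarith
    · rw [← mul_sub] at h1
      have := nonneg_of_mul_nonneg_right h1 h0
      linarith
  refine ⟨hc, fun x hx y hy a b ha hb hab => ?_⟩
  have hz := hc hx hy ha hb hab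
  have h1 := hg _ hz x hx
  have h2 := hg _ hz y hy
  set z := a • x + b • y with hzd
  have h3 : a * ⟪gradient w z, x - z⟫ + b * ⟪gradient w z, y - z⟫ = 0 := by
    rw [← real_inner_smul_right, ← real_inner_smul_right, ← inner_add_right]
    have : a • (x - z) + b • (y - z) = 0 := by
      have e : a • (x - z) + b • (y - z) = (a • x + b • y) - (a + b) • z := by
        rw [smul_sub, smul_sub, add_smul]; abel
      rw [e, hab, one_smul, ← hzd, sub_self]
    rw [this, inner_zero_right]
  simp only [smul_eq_mul]
  have h4 := mul_le_mul_of_nonneg_left h1 ha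
  have h5 := mul_le_mul_of_nonneg_left h2 hb
  have h6 : a * w z + b * w z = w z := by rw [← add_mul, hab, one_mul]
  linarith

theorem bregD_scale {p : ℝ} (hp : 1 < p) {b : ℝ} (hb : 0 < b) (Q P : E) :
    bregD p (b • Q) (b • P) = b ^ p * bregD p Q P := by
  rw [bregD_smul hp hb.le hb.le]
  have : b ^ p = b ^ (p - 1) * b := by rw [← Real.rpow_add_one hb.ne']; congr 1; ring
  unfold bregD
  rw [this]; ring

variable [MeasurableSpace E] [BorelSpace E]

theorem L9b {p lam : ℝ} (hp : 1 < p) (hlam : 0 ≤ lam) {Ω : Set E} (hΩ : IsOpen Ω) (hne : Ω.Nonempty)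
    (hΩb : IsBounded Ω) (hΩc : Convex ℝ Ω) {u : E → ℝ} (hu1 : ContDiffOn ℝ 1 u (closure Ω))
    (hupos : ∀ x ∈ Ω, 0 < u x) (hub : ∀ x ∈ frontier Ω, u x = 0)
    (hww : WeakW p lam Ω (fun x => -Real.log (u x))) {δ : ℝ} (hδ : 0 < δ) :
    ∃ (τ : ℝ) (V : E → ℝ) (qf : E → E), 0 < τ ∧ τ ≤ δ ∧
      (∀ x y, 0 ≤ ⟪qf x - qf y, x - y⟫) ∧ (∀ x ∈ Ω, u x ≤ Real.exp (-V x)) ∧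
      IntegrableOn (fun x => bregD p ((chi' τ (Real.exp (-V x)) * Real.exp (-V x)) • qf x)
        (chi τ (Real.exp (-V x)) • gradient (fun x => -Real.log (u x)) x) * Real.exp ((-1) * ‖x‖ ^ 2 / 2)) Ω ∧
      ∫ x in Ω, bregD p ((chi' τ (Real.exp (-V x)) * Real.exp (-V x)) • qf x)
        (chi τ (Real.exp (-V x)) • gradient (fun x => -Real.log (u x)) x) * Real.exp ((-1) * ‖x‖ ^ 2 / 2) ≤ δ := by
  obtain ⟨y0, hy0⟩ := hne
  have hK : IsCompact (closure Ω) := hΩb.isCompact_closure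
  have huc := hu1.continuousOn
  have hKpos : ∀ x ∈ closure Ω, 0 < u x → x ∈ Ω := by
    intro x hx h
    by_contra hn
    have : x ∈ frontier Ω := by rw [hΩ.frontier_eq]; exact ⟨hx, hn⟩
    linarith [hub x this]
  have hu0 : ∀ x ∈ closure Ω, 0 ≤ u x := by
    intro x hx
    by_cases hn : x ∈ Ω
    · exact (hupos x hn).le
    · have : x ∈ frontier Ω := by rw [hΩ.frontier_eq]; exact ⟨hx, hn⟩
      exact (hub x this).ge
  have huΩ := hu1.mono subset_closure
  have hw : ContDiffOn ℝ 1 (fun x => -Real.log (u x)) Ω := (huΩ.log (fun y hy => (hupos y hy).ne')).neg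
  obtain ⟨M0, hM0⟩ := hK.exists_bound_of_continuousOn huc
  set M := |M0| + 1 with hMd
  have hMpos : 0 < M := by positivity
  have hM : ∀ x ∈ closure Ω, u x ≤ M := fun x hx => by
    have h1 := hM0 x hx
    have h2 := le_abs_self (u x)
    have h3 := le_abs_self M0
    rw [Real.norm_eq_abs] at h1
    linarith
  set vol := (volume : Measure E).real Ω with hvol
  have hvol0 : 0 ≤ vol := measureReal_nonneg
  have hfin : (volume : Measure E) Ω ≠ ⊤ := hΩb.measure_lt_top.ne
  set δ' := δ / (lam * M * vol + 1) with hδ'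
  have hden : 0 < lam * M * vol + 1 := by positivity
  have hδ'0 : 0 < δ' := by positivity
  have huni : UniformContinuousOn (fun s : ℝ => s ^ (p - 1)) (Icc 0 M) :=
    isCompact_Icc.uniformContinuousOn_of_continuous
      (continuousOn_id.rpow_const (fun _ _ => Or.inr (by linarith)))
  rw [Metric.uniformContinuousOn_iff] at huni
  obtain ⟨η, hη, huni⟩ := huni δ' hδ'0
  set τ := min δ (η / 4) with hτd
  have hτ : 0 < τ := lt_min hδ (by positivity)
  have hτη : 2 * τ < η := by have := min_le_right δ (η / 4); linarith
  obtain ⟨ε, hε, h8⟩ := L8 hΩ ⟨y0, hy0⟩ hΩb hΩc hu1 hub hτ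
  obtain ⟨V, qf, H⟩ := legData_exists hK huc hu0 (subset_closure hy0) (hupos y0 hy0) hε
  have hmono : ∀ x y, 0 ≤ ⟪qf x - qf y, x - y⟫ := fun x y => le_trans (by positivity) (H.P1 x y)
  have hlip := H.lip hε
  have h9 := L9a (lam := lam) hp hτ hΩ hΩb hw hww (H.hasGradientAt hε) hlip.continuous
    (h8 ε hε le_rfl V qf H)
    (fun φ h1 h2 h3 => L7 hp hlam hlip (fun x hd v => leg_psd hmono hd v)
      (fun x hd hq0 => L6main hp hΩ subset_closure huΩ hupos hKpos hww hε H hd hq0) h1 h2 h3)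
  refine ⟨τ, V, qf, hτ, min_le_left _ _, hmono, ?_, h9.1, h9.2.trans ?_⟩
  · intro x hx
    have := H.P3 x (subset_closure hx) (hupos x hx)
    rw [← Real.exp_log (hupos x hx)]
    exact Real.exp_le_exp.2 (by linarith)
  · have hUM : ∀ x, Real.exp (-V x) ≤ M := by
      intro x
      have := H.P4 0 (Real.log M) (fun y hy h => by
        rw [inner_zero_left, zero_add]; exact Real.log_le_log h (hM y hy)) x
      simp only [inner_zero_left, norm_zero] at this
      rw [← Real.exp_log hMpos]
      exact Real.exp_le_exp.2 (by linarith)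
    have hb : ∀ x ∈ Ω, ‖lam * (chi τ (Real.exp (-V x)) * (Real.exp (-V x) ^ (p - 1) - chi τ (Real.exp (-V x)) ^ (p - 1)))
      * Real.exp ((-1) * ‖x‖ ^ 2 / 2)‖ ≤ lam * M * δ' := by
      intro x hx
      have hU0 := Real.exp_pos (-V x)
      have hU1 := hUM x
      set U := Real.exp (-V x)
      have c0 := chi_nonneg τ hU0
      have c1 := chi_le hτ hU0
      have c2 := le_chi hτ hU0
      have c3 := huni U ⟨hU0.le, hU1⟩ (chi τ U) ⟨c0, by linarith⟩ (by
        rw [Real.dist_eq, abs_lt]; constructor <;> linarith)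
      rw [Real.dist_eq] at c3
      have r1 : Real.exp ((-1) * ‖x‖ ^ 2 / 2) ≤ 1 := Real.exp_le_one_iff.2 (by nlinarith [sq_nonneg ‖x‖])
      have r0 := Real.exp_pos ((-1) * ‖x‖ ^ 2 / 2)
      rw [norm_mul, norm_mul, norm_mul, Real.norm_of_nonneg hlam, Real.norm_of_nonneg c0, Real.norm_of_nonneg r0.le,
        Real.norm_eq_abs]
      have m1 : chi τ U * |U ^ (p - 1) - chi τ U ^ (p - 1)| ≤ M * δ' :=
        mul_le_mul (by linarith) c3.le (abs_nonneg _) hMpos.le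
      have m2 := mul_le_mul_of_nonneg_left m1 hlam
      have m3 : 0 ≤ lam * (M * δ') := by positivity
      calc _ ≤ lam * (M * δ') * 1 := mul_le_mul m2 r1 r0.le m3
        _ = _ := by ring
    have := norm_setIntegral_le_of_norm_le_const hfin.lt_top hb
    refine (le_abs_self _).trans (this.trans ?_)
    have e : lam * M * δ' * vol = (lam * M * vol) / (lam * M * vol + 1) * δ := by
      rw [hδ']; field_simp
    show lam * M * δ' * vol ≤ δ
    rw [e]
    have : (lam * M * vol) / (lam * M * vol + 1) ≤ 1 := by rw [div_le_one hden]; linarith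
    nlinarith

theorem L9pt {p : ℝ} (hp : 1 < p) {P : E} {τ U : ℕ → ℝ} {Q : ℕ → E} {m : ℝ} (hm : 0 < m)
    (hτ0 : ∀ k, 0 < τ k) (hτ : Filter.Tendsto τ Filter.atTop (𝓝 0)) (hU : ∀ k, m ≤ U k)
    (h : Filter.Tendsto (fun k => bregD p ((chi' (τ k) (U k) * U k) • Q k) (chi (τ k) (U k) • P))
      Filter.atTop (𝓝 0)) : Filter.Tendsto Q Filter.atTop (𝓝 P) := by
  have hU0 : ∀ k, 0 < U k := fun k => hm.trans_le (hU k)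
  have hev : ∀ᶠ k in Filter.atTop, τ k < m / 4 := hτ.eventually_lt_const (by positivity)
  set t : ℕ → ℝ := fun k => τ k / U k with htd
  have ht0 : ∀ k, 0 < t k := fun k => div_pos (hτ0 k) (hU0 k)
  have ht : Filter.Tendsto t Filter.atTop (𝓝 0) := by
    have h1 : Filter.Tendsto (fun k => τ k / m) Filter.atTop (𝓝 0) := by simpa using hτ.div_const m
    refine squeeze_zero (fun k => (ht0 k).le) (fun k => ?_) h1
    exact div_le_div_of_nonneg_left (hτ0 k).le hm (hU k)
  set d : ℕ → ℝ := fun k => (1 - t k) / (1 + t k) with hdd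
  have hd : Filter.Tendsto d Filter.atTop (𝓝 1) := by
    have := (ht.const_sub 1).div (ht.const_add 1) (by norm_num)
    rw [sub_zero, add_zero, div_one] at this
    exact this
  set c : ℕ → ℝ := fun k => chi' (τ k) (U k) * U k / chi (τ k) (U k) with hcd
  have hX : ∀ᶠ k in Filter.atTop, m / 2 ≤ chi (τ k) (U k) := by
    filter_upwards [hev] with k hk
    have := le_chi (hτ0 k) (hU0 k)
    have := hU k
    linarith
  have hdc : ∀ᶠ k in Filter.atTop, d k * c k = 1 := by
    filter_upwards [hev] with k hk
    have h1 : 0 < U k - τ k := by have := hU k; linarith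
    have h2 := hU0 k
    have h3 := hτ0 k
    have h4 : 0 < U k + τ k := by linarith
    simp only [hdd, hcd, htd, chi, chi', max_eq_left h1.le]
    have e1 : (1 - τ k / U k) / (1 + τ k / U k) = (U k - τ k) / (U k + τ k) := by field_simp
    rw [e1]
    field_simp
    ring
  have hc : Filter.Tendsto (fun k => c k • Q k) Filter.atTop (𝓝 P) := by
    refine bregD_conv hp P ?_
    have hmp : 0 < (m / 2) ^ p := Real.rpow_pos_of_pos (by positivity) _
    have h1 := h.div_const ((m / 2) ^ p)
    rw [zero_div] at h1
    refine squeeze_zero' (Filter.Eventually.of_forall fun k => bregD_nonneg hp _ _) ?_ h1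
    filter_upwards [hX] with k hk
    have hX0 : 0 < chi (τ k) (U k) := by linarith
    have e : (chi' (τ k) (U k) * U k) • Q k = chi (τ k) (U k) • (c k • Q k) := by
      rw [smul_smul]; congr 1; simp only [hcd]; field_simp
    rw [e, bregD_scale hp hX0, le_div_iff₀ hmp, mul_comm]
    exact mul_le_mul_of_nonneg_right (Real.rpow_le_rpow (by positivity) hk (by linarith)) (bregD_nonneg hp _ _)
  have hf := hd.smul hc
  rw [one_smul] at hf
  refine hf.congr' ?_
  filter_upwards [hdc] with k hk
  rw [smul_smul, hk, one_smul]

theorem L10 {p lam : ℝ} (hp : 1 < p) (hlam : 0 ≤ lam) {Ω : Set E} (hΩ : IsOpen Ω) (hne : Ω.Nonempty)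
    (hΩb : IsBounded Ω) (hΩc : Convex ℝ Ω) {u : E → ℝ} (hu1 : ContDiffOn ℝ 1 u (closure Ω))
    (hupos : ∀ x ∈ Ω, 0 < u x) (hub : ∀ x ∈ frontier Ω, u x = 0)
    (hww : WeakW p lam Ω (fun x => -Real.log (u x))) :
    ConvexOn ℝ Ω (fun x => -Real.log (u x)) := by
  have huΩ := hu1.mono subset_closure
  have hw : ContDiffOn ℝ 1 (fun x => -Real.log (u x)) Ω := (huΩ.log (fun y hy => (hupos y hy).ne')).neg
  have hδ0 : ∀ k : ℕ, (0:ℝ) < 1 / ((k : ℝ) + 1) := fun k => by positivity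
  have hδ : Filter.Tendsto (fun k : ℕ => 1 / ((k : ℝ) + 1)) Filter.atTop (𝓝 0) := tendsto_one_div_add_atTop_nhds_zero_nat
  choose τ V qf hτ hτδ hmono huV hint hle using
    fun k : ℕ => L9b hp hlam hΩ hne hΩb hΩc hu1 hupos hub hww (hδ0 k)
  set w : E → ℝ := fun x => -Real.log (u x) with hwd
  have hgw : ContinuousOn (gradient w) Ω := continuousOn_gradient hΩ hw
  have hτ0 : Filter.Tendsto τ Filter.atTop (𝓝 0) := squeeze_zero (fun k => (hτ k).le) hτδ hδ
  set f : ℕ → E → ℝ := fun k x => bregD p ((chi' (τ k) (Real.exp (-V k x)) * Real.exp (-V k x)) • qf k x)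
        (chi (τ k) (Real.exp (-V k x)) • gradient w x) * Real.exp ((-1) * ‖x‖ ^ 2 / 2) with hfd
  have hf0 : ∀ k x, 0 ≤ f k x := fun k x => mul_nonneg (bregD_nonneg hp _ _) (Real.exp_pos _).le
  have hL1 : Filter.Tendsto (fun k => eLpNorm (f k - fun _ => (0:ℝ)) 1 (volume.restrict Ω)) Filter.atTop (𝓝 0) := by
    have hub' : ∀ k, eLpNorm (f k - fun _ => (0:ℝ)) 1 (volume.restrict Ω) ≤ ENNReal.ofReal (1 / ((k : ℝ) + 1)) := by
      intro k
      have e : (f k - fun _ => (0:ℝ)) = f k := by ext x; simp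
      rw [e, eLpNorm_one_eq_lintegral_enorm, ← ofReal_integral_norm_eq_lintegral_enorm (hint k)]
      refine ENNReal.ofReal_le_ofReal (le_trans (le_of_eq ?_) (hle k))
      exact integral_congr_ae (Filter.Eventually.of_forall fun x => Real.norm_of_nonneg (hf0 k x))
    have h0 : Filter.Tendsto (fun k : ℕ => ENNReal.ofReal (1 / ((k : ℝ) + 1))) Filter.atTop (𝓝 0) := by
      simpa using ENNReal.tendsto_ofReal hδ
    exact tendsto_of_tendsto_of_tendsto_of_le_of_le tendsto_const_nhds h0 (fun _ => bot_le) hub'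
  have hmeas := tendstoInMeasure_of_tendsto_eLpNorm one_ne_zero
    (fun k => (hint k).aestronglyMeasurable) aestronglyMeasurable_const hL1
  obtain ⟨ns, hns, hae⟩ := hmeas.exists_seq_tendsto_ae
  rw [ae_restrict_iff' hΩ.measurableSet] at hae
  have hD := Measure.dense_of_ae hae
  have hconv : ∀ x ∈ Ω ∩ {x | x ∈ Ω → Filter.Tendsto (fun i => f (ns i) x) Filter.atTop (𝓝 0)},
      Filter.Tendsto (fun i => qf (ns i) x) Filter.atTop (𝓝 (gradient w x)) := by
    rintro x ⟨hx, hx2⟩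
    have h1 := (hx2 hx).div_const (Real.exp ((-1) * ‖x‖ ^ 2 / 2))
    rw [zero_div] at h1
    refine L9pt hp (hupos x hx) (fun k => hτ (ns k)) (hτ0.comp hns.tendsto_atTop)
      (U := fun k => Real.exp (-V (ns k) x)) (fun k => huV (ns k) x hx) ?_
    refine h1.congr fun k => ?_
    simp only [hfd]
    rw [mul_div_assoc, div_self (Real.exp_pos _).ne', mul_one]
  have hcl := hD.open_subset_closure_inter hΩ
  refine convex_of_mono hΩ hΩc hw fun x hx y hy => ?_
  obtain ⟨xs, hxs, hxl⟩ := mem_closure_iff_seq_limit.1 (hcl hx)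
  obtain ⟨ys, hys, hyl⟩ := mem_closure_iff_seq_limit.1 (hcl hy)
  have hgx := ((hgw.continuousAt (hΩ.mem_nhds hx)).tendsto).comp hxl
  have hgy := ((hgw.continuousAt (hΩ.mem_nhds hy)).tendsto).comp hyl
  refine ge_of_tendsto' ((hgx.sub hgy).inner (hxl.sub hyl)) fun j => ?_
  exact ge_of_tendsto' (((hconv _ (hxs j)).sub (hconv _ (hys j))).inner tendsto_const_nhds)
    fun i => hmono _ _ _
end L10


theorem gauss_integral {n : ℕ} {Ω : Set (EuclideanSpace ℝ (Fin n))} (hΩ : MeasurableSet Ω)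
    (f : EuclideanSpace ℝ (Fin n) → ℝ) :
    ∫ x in Ω, f x ∂(gaussianMeasure n) =
      (2 * π) ^ (-(n : ℝ) / 2) * ∫ x in Ω, Real.exp ((-1) * ‖x‖ ^ 2 / 2) * f x := by
  have hc : (0:ℝ) < (2 * π) ^ (-(n : ℝ) / 2) := Real.rpow_pos_of_pos (by positivity) _
  unfold gaussianMeasure
  rw [restrict_withDensity hΩ, integral_withDensity_eq_integral_toReal_smul, ← integral_const_mul]
  · refine integral_congr_ae (Filter.Eventually.of_forall fun x => ?_)
    simp only [smul_eq_mul]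
    rw [ENNReal.toReal_ofReal (by positivity), mul_assoc, neg_one_mul]
  · refine ENNReal.measurable_ofReal.comp (Continuous.measurable ?_)
    fun_prop
  · exact Filter.Eventually.of_forall fun x => ENNReal.ofReal_lt_top

/-- **Log-concavity of the first eigenfunction of the Gaussian-weighted `p`-Laplacian**
(Theorem 1.1 of the paper): if `Ω ⊂ ℝⁿ` (`n ≥ 2`) is a bounded open convex set with `C²`
boundary, `p > 1`, and `u ∈ C¹(cl Ω)` is a positive first eigenfunction of the weighted
`p`-Laplace operator, then `w = -log u` is convex on `Ω`. -/
theorem log_concavity_first_eigenfunction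
    (n : ℕ) (hn : 2 ≤ n) (p : ℝ) (hp : 1 < p)
    (Ω : Set (EuclideanSpace ℝ (Fin n)))
    (hΩo : IsOpen Ω) (hΩb : IsBounded Ω) (hΩconv : Convex ℝ Ω) (hΩ2 : HasC2Boundary n Ω)
    (u : EuclideanSpace ℝ (Fin n) → ℝ)
    (hu1 : ContDiffOn ℝ 1 u (closure Ω))
    (hupos : ∀ x ∈ Ω, 0 < u x)
    (hub : ∀ x ∈ frontier Ω, u x = 0)
    (heig : ∀ φ : EuclideanSpace ℝ (Fin n) → ℝ, IsTestFun n Ω φ →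
      ∫ x in Ω, ‖gradient u x‖ ^ (p - 2) * ⟪gradient u x, gradient φ x⟫ ∂(gaussianMeasure n)
        = lambdaPGamma n p Ω * ∫ x in Ω, u x ^ (p - 1) * φ x ∂(gaussianMeasure n)) :
    ConvexOn ℝ Ω (fun x => -Real.log (u x)) := by
  rcases Ω.eq_empty_or_nonempty with he | hne
  · subst he; exact ⟨convex_empty, fun x hx => absurd hx (Set.notMem_empty x)⟩
  have hlam : 0 ≤ lambdaPGamma n p Ω := by
    unfold lambdaPGamma
    refine Real.sInf_nonneg ?_
    rintro r ⟨v, _, _, rfl⟩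
    exact div_nonneg (integral_nonneg fun x => by positivity) (integral_nonneg fun x => by positivity)
  refine L10 hp hlam hΩo hne hΩb hΩconv hu1 hupos hub ?_
  refine L3gen hp hΩo (hu1.mono subset_closure) hupos ?_
  intro φ h1 h2 h3
  have h := heig φ ⟨h1, h2, h3⟩
  rw [gauss_integral hΩo.measurableSet, gauss_integral hΩo.measurableSet] at h
  have hc : (0:ℝ) < (2 * π) ^ (-(n : ℝ) / 2) := Real.rpow_pos_of_pos (by positivity) _
  have h' : ∫ x in Ω, Real.exp ((-1) * ‖x‖ ^ 2 / 2) * (‖gradient u x‖ ^ (p - 2) * ⟪gradient u x, gradient φ x⟫)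
      = lambdaPGamma n p Ω * ∫ x in Ω, Real.exp ((-1) * ‖x‖ ^ 2 / 2) * (u x ^ (p - 1) * φ x) := by
    refine mul_left_cancel₀ hc.ne' ?_
    rw [h]; ring
  rw [← integral_const_mul] at h'
  calc _ = ∫ x in Ω, Real.exp ((-1) * ‖x‖ ^ 2 / 2) * (‖gradient u x‖ ^ (p - 2) * ⟪gradient u x, gradient φ x⟫) := by
        refine integral_congr_ae (Filter.Eventually.of_forall fun x => ?_)
        show fderiv ℝ φ x (Real.exp ((-1) * ‖x‖ ^ 2 / 2) • aF p (gradient u x)) = _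
        rw [map_smul, aF, map_smul, ← grad_inner, smul_eq_mul, smul_eq_mul, real_inner_comm]
    _ = _ := h'
    _ = _ := by
        refine integral_congr_ae (Filter.Eventually.of_forall fun x => ?_)
        show _ = lambdaPGamma n p Ω * u x ^ (p - 1) * Real.exp ((-1) * ‖x‖ ^ 2 / 2) * φ x
        ring
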